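/- arXiv:2511.03885 — 2 statements merged into one kernel-verified Lean document; each statement's English description precedes it below -/
import Mathlib

section
/- For every iterated sequence S for Gr(3,6), the Plücker coordinates form a Khovanskii basis for (A_{3,6}, v_S): for every polynomial f ∈ ℂ[p_K : K ∈ I_{3,6}] with f ∉ 𝓘_{3,6}, the valuation v_S(f̄) := ⪯_{Ψ_S}-min of the support of the polynomial obtained from f by substituting p_K ↦ φ_S^*(p̄_K) lies in the additive submonoid of ℤ^9 generated by { v_S(p̄_K) : K ∈ I_{3,6} }; i.e. the value semigroup S(A_{3,6}, v_S) is generated by the valuations of the Plücker coordinates. -/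
/-!
Common framework: iterated sequences for Gr(3,n), the matrix `A_S`, pullbacks of
Plücker coordinates, the weighted reverse lexicographic order, lowest-term
valuations, Plücker relations, weighting matrices and initial ideals.
-/

open MvPolynomial

noncomputable section

/-- Height of a positive root `(i,j) ↦ j - i`. -/
def Ht (β : ℕ × ℕ) : ℕ := β.2 - β.1

/-- `IsIter n S` : `S` is an iterated sequence for `Gr(3,n)`: it starts (as base of the
iteration) from a PBW sequence for `Gr(3,4)`, i.e. an ordering of `((1,4),(2,4),(3,4))`,
and for each `r = 5, …, n` a triple `((i₁,r),(i₂,r),(i₃,r))` with `i₁,i₂,i₃ ∈ [r-1]`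
pairwise distinct is prepended. -/
inductive IsIter : ℕ → List (ℕ × ℕ) → Prop
  | base (L : List (ℕ × ℕ)) : L.Perm [(1,4),(2,4),(3,4)] → IsIter 4 L
  | step (r : ℕ) (L : List (ℕ × ℕ)) (i₁ i₂ i₃ : ℕ) :
      4 ≤ r → IsIter r L →
      1 ≤ i₁ → i₁ ≤ r → 1 ≤ i₂ → i₂ ≤ r → 1 ≤ i₃ → i₃ ≤ r →
      i₁ ≠ i₂ → i₁ ≠ i₃ → i₂ ≠ i₃ →
      IsIter (r+1) ((i₁, r+1) :: (i₂, r+1) :: (i₃, r+1) :: L)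

/-- `Sorted k n I` : `I ∈ I_{k,n}`, a strictly increasing `k`-tuple in `{1,…,n}`. -/
def Sorted (k n : ℕ) (I : Fin k → ℕ) : Prop :=
  StrictMono I ∧ ∀ a, 1 ≤ I a ∧ I a ≤ n

/-- `ℕ`-indexed square "matrices" (1-based indexing, size given by a parameter `n`). -/
abbrev NMat := ℕ → ℕ → MvPolynomial (ℕ × ℕ) ℂ

/-- Product of two `n × n` matrices, 1-based indexing. -/
def matMul (n : ℕ) (A B : NMat) : NMat := fun i j => ∑ k ∈ Finset.Icc 1 n, A i k * B k j

/-- Identity matrix. -/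
def idN : NMat := fun i j => if i = j then 1 else 0

/-- The factor `1 + x_β f_β`, where `f_β` is the matrix unit in entry `β = (i,j)`. -/
def factor (β : ℕ × ℕ) : NMat := fun i j =>
  (if i = j then (1 : MvPolynomial (ℕ × ℕ) ℂ) else 0) +
    (if i = β.1 ∧ j = β.2 then (MvPolynomial.X β : MvPolynomial (ℕ × ℕ) ℂ) else 0)

/-- `A_S := (1 + x_{β_N} f_{β_N}) ⋯ (1 + x_{β_1} f_{β_1})` for `S = (β_1, …, β_N)`. -/
def ASmat (n : ℕ) : List (ℕ × ℕ) → NMat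
  | [] => idN
  | β :: L => matMul n (ASmat n L) (factor β)

/-- `φ_S^*(p̄_I)` : the determinant of the `3×3` submatrix of `A_S` on rows `(1,2,3)`
and columns `I = (i₁,i₂,i₃)`. -/
def phiStar (n : ℕ) (S : List (ℕ × ℕ)) (I : Fin 3 → ℕ) : MvPolynomial (ℕ × ℕ) ℂ :=
  Matrix.det (Matrix.of fun a b : Fin 3 => ASmat n S (a.val + 1) (I b))

/-- `Ψ_S(a) = Σ_l a_l Ht(β_l)`, the height-weighted function (written on exponents). -/
def Psi (d : (ℕ × ℕ) →₀ ℕ) : ℕ := d.sum fun β c => c * Ht β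

/-- `a <_lex b` : lexicographic comparison of exponent vectors, the coordinates being
read in the order `β_1, …, β_N` of the sequence `S`. -/
def lexLT (S : List (ℕ × ℕ)) (a b : (ℕ × ℕ) →₀ ℕ) : Prop :=
  ∃ k < S.length, (∀ m < k, a (S.getD m (0,0)) = b (S.getD m (0,0))) ∧
    a (S.getD k (0,0)) < b (S.getD k (0,0))

/-- `a ≤_lex b` on coordinates indexed by `S`. -/
def lexLE (S : List (ℕ × ℕ)) (a b : (ℕ × ℕ) →₀ ℕ) : Prop :=
  lexLT S a b ∨ ∀ k < S.length, a (S.getD k (0,0)) = b (S.getD k (0,0))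

/-- `a ≺_{Ψ_S} b` : the strict `Ψ_S`-weighted reverse lexicographic order:
`Ψ_S(a) < Ψ_S(b)`, or `Ψ_S(a) = Ψ_S(b)` and `a >_lex b`. -/
def psiLT (S : List (ℕ × ℕ)) (a b : (ℕ × ℕ) →₀ ℕ) : Prop :=
  Psi a < Psi b ∨ (Psi a = Psi b ∧ lexLT S b a)

/-- `a ⪯_{Ψ_S} b`. -/
def psiLE (S : List (ℕ × ℕ)) (a b : (ℕ × ℕ) →₀ ℕ) : Prop :=
  Psi a < Psi b ∨ (Psi a = Psi b ∧ lexLE S b a)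

open scoped Classical in
/-- The `⪯_{Ψ_S}`-minimum of the support of a polynomial (defaulting to `0` if no
minimum exists). -/
def minSupp (S : List (ℕ × ℕ)) (f : MvPolynomial (ℕ × ℕ) ℂ) : (ℕ × ℕ) →₀ ℕ :=
  if h : ∃ m ∈ f.support, ∀ m' ∈ f.support, psiLE S m m' then h.choose else 0

/-- The lowest-term valuation `v_S(p̄_I)` : the `⪯_{Ψ_S}`-minimum of the support of
`φ_S^*(p̄_I)`. -/
def valS (n : ℕ) (S : List (ℕ × ℕ)) (I : Fin 3 → ℕ) : (ℕ × ℕ) →₀ ℕ :=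
  minSupp S (phiStar n S I)

/-- The index set `I_{3,n}` of Plücker variables. -/
abbrev MI (n : ℕ) := {v : Fin 3 → ℕ // Sorted 3 n v}

/-- The Plücker polynomial ring `ℂ[p_K : K ∈ I_{3,n}]`. -/
abbrev PRing (n : ℕ) := MvPolynomial (MI n) ℂ

open scoped Classical in
/-- The Plücker variable `p_K`, defined to be `0` if `K` is not strictly increasing
(in particular `p_{I ∪ j} = 0` if `j ∈ I`). -/
def pvar (n : ℕ) (K : Fin 3 → ℕ) : PRing n :=
  if h : Sorted 3 n K then MvPolynomial.X (⟨K, h⟩ : MI n) else 0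

/-- `I ∪ j` : the sorted triple obtained by adjoining `j` to the pair `I`. -/
def insert3 (I : Fin 2 → ℕ) (j : ℕ) : Fin 3 → ℕ :=
  fun a => (List.insertionSort (· ≤ ·) [I 0, I 1, j]).getD a 0

/-- `J ∖ j` : the sorted triple obtained by removing `j` from the 4-tuple `J`. -/
def erase4 (J : Fin 4 → ℕ) (j : ℕ) : Fin 3 → ℕ :=
  fun a => (([J 0, J 1, J 2, J 3]).erase j).getD a 0

/-- The Plücker relation
`R_{I,J} = Σ_{j ∈ J} (−1)^{#{i∈I : i<j} + #{j'∈J : j<j'}} p_{I∪j} p_{J∖j}`. -/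
def Rrel (n : ℕ) (I : Fin 2 → ℕ) (J : Fin 4 → ℕ) : PRing n :=
  ∑ a : Fin 4,
    (-1 : PRing n) ^ ((Finset.univ.filter fun b : Fin 2 => I b < J a).card +
        (Finset.univ.filter fun b : Fin 4 => J a < J b).card) *
      (pvar n (insert3 I (J a)) * pvar n (erase4 J (J a)))

/-- The Plücker ideal `𝓘_{3,n}`, generated by all Plücker relations. -/
def PluckerIdeal (n : ℕ) : Ideal (PRing n) :=
  Ideal.span {f | ∃ I J, Sorted 2 n I ∧ Sorted 4 n J ∧ f = Rrel n I J}

/-- `M_S · m = Σ_K m_K v_S(p̄_K)` : the weighting matrix applied to an exponent. -/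
def MSdot (n : ℕ) (S : List (ℕ × ℕ)) (m : MI n →₀ ℕ) : (ℕ × ℕ) →₀ ℕ :=
  m.sum fun K c => c • valS n S K.val

open scoped Classical in
/-- The initial form `In_{M_S}(f)` : the sum of the terms of `f` whose `M_S`-weight is
`⪯_{Ψ_S}`-minimal. -/
def inM (n : ℕ) (S : List (ℕ × ℕ)) (f : PRing n) : PRing n :=
  ∑ m ∈ f.support.filter fun m => ∀ m' ∈ f.support, psiLE S (MSdot n S m) (MSdot n S m'),
    MvPolynomial.monomial m (f.coeff m)

/-- The initial ideal `In_{M_S}(𝓘_{3,n}) = ⟨In_{M_S}(g) : g ∈ 𝓘_{3,n}, g ≠ 0⟩`. -/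
def InIdeal (n : ℕ) (S : List (ℕ × ℕ)) : Ideal (PRing n) :=
  Ideal.span {g | ∃ f, f ∈ PluckerIdeal n ∧ f ≠ 0 ∧ g = inM n S f}

/-- Evaluation of the `ℤ`-linear functional with coefficients `c` on an exponent
vector (i.e. an element `e ∈ (ℤ^{3(n-3)})^*` given by its coefficients). -/
def evalF (c : ℕ × ℕ → ℤ) (d : (ℕ × ℕ) →₀ ℕ) : ℤ := d.sum fun β m => c β * (m : ℤ)

/-- `v_S(p̄_{I∪j}) + v_S(p̄_{J∖j})`, the `M_S`-weight of the term of `R_{I,J}`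
corresponding to `j = J a`. -/
def wvec (n : ℕ) (S : List (ℕ × ℕ)) (I : Fin 2 → ℕ) (J : Fin 4 → ℕ) (a : Fin 4) :
    (ℕ × ℕ) →₀ ℕ :=
  valS n S (insert3 I (J a)) + valS n S (erase4 J (J a))

/-- A `ℤ`-linear functional `e` (given by its coefficients `c`) *preserves inequalities*
with respect to `S` if for every nonzero Plücker relation `R_{I,J}` and all
`s₁, s₂ ∈ J ∖ I`, `v_S(p̄_{I∪s₁}) + v_S(p̄_{J∖s₁}) ≺_{Ψ_S} v_S(p̄_{I∪s₂}) + v_S(p̄_{J∖s₂})`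
implies the corresponding strict inequality of the values of `e`. -/
def PreservesIneq (n : ℕ) (S : List (ℕ × ℕ)) (c : ℕ × ℕ → ℤ) : Prop :=
  ∀ (I : Fin 2 → ℕ) (J : Fin 4 → ℕ), Sorted 2 n I → Sorted 4 n J → Rrel n I J ≠ 0 →
    ∀ a b : Fin 4, (∀ t : Fin 2, I t ≠ J a) → (∀ t : Fin 2, I t ≠ J b) →
      psiLT S (wvec n S I J a) (wvec n S I J b) →
      evalF c (wvec n S I J a) < evalF c (wvec n S I J b)

end

noncomputable section

section Lead

variable {σ Γ : Type*} [AddCommGroup Γ] [LinearOrder Γ]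

/-- `e` is the unique exponent of `g` whose key is minimal. -/
def IsLead (key : (σ →₀ ℕ) →+ Γ) (g : MvPolynomial σ ℂ) (e : σ →₀ ℕ) : Prop :=
  g.coeff e ≠ 0 ∧ ∀ m ∈ g.support, m ≠ e → key e < key m

variable {key : (σ →₀ ℕ) →+ Γ}

theorem IsLead.le {g : MvPolynomial σ ℂ} {e m : σ →₀ ℕ} (h : IsLead key g e)
    (hm : m ∈ g.support) : key e ≤ key m := by
  by_cases hme : m = e
  · rw [hme]
  · exact (h.2 m hm hme).le

theorem IsLead.one : IsLead key (1 : MvPolynomial σ ℂ) 0 := by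
  classical
  refine ⟨by simp, fun m hm hne => ?_⟩
  rw [mem_support_iff, coeff_one] at hm
  exact absurd (by simpa [eq_comm] using hm) hne

theorem IsLead.mul [IsOrderedAddMonoid Γ] {g g' : MvPolynomial σ ℂ} {e e' : σ →₀ ℕ}
    (h : IsLead key g e)
    (h' : IsLead key g' e') : IsLead key (g * g') (e + e') := by
  classical
  have main : ∀ a b, a ∈ g.support → b ∈ g'.support → (a, b) ≠ (e, e') →
      key (e + e') < key (a + b) := by
    intro a b ha hb hab
    rw [map_add, map_add]
    by_cases hae : a = e
    · have hbe : b ≠ e' := fun hbe => hab (by rw [hae, hbe])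
      exact add_lt_add_of_le_of_lt (h.le ha) (h'.2 b hb hbe)
    · exact add_lt_add_of_lt_of_le (h.2 a ha hae) (h'.le hb)
  constructor
  · rw [coeff_mul, Finset.sum_eq_single (e, e')]
    · exact mul_ne_zero h.1 h'.1
    · rintro ⟨a, b⟩ hab hne
      by_contra hc
      have hc' := mul_ne_zero_iff.mp hc
      have := main a b (mem_support_iff.mpr hc'.1) (mem_support_iff.mpr hc'.2) hne
      rw [Finset.HasAntidiagonal.mem_antidiagonal.mp hab] at this
      exact lt_irrefl _ this
    · intro hn
      exact absurd (by simp [Finset.HasAntidiagonal.mem_antidiagonal]) hn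
  · intro m hm hne
    obtain ⟨a, ha, b, hb, rfl⟩ := Finset.mem_add.mp (support_mul g g' hm)
    refine main a b ha hb fun hab => hne ?_
    rw [Prod.mk.injEq] at hab
    rw [hab.1, hab.2]

theorem IsLead.multiset_prod [IsOrderedAddMonoid Γ] {ι : Type*} {Q : ι → MvPolynomial σ ℂ}
    {E : ι → σ →₀ ℕ}
    (hQ : ∀ i, IsLead key (Q i) (E i)) (m : Multiset ι) :
    IsLead key (m.map Q).prod (m.map E).sum := by
  induction m using Multiset.induction_on with
  | empty => simpa using IsLead.one
  | cons a s ih => simpa using (hQ a).mul ih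

/-- In a linear combination of polynomials with pairwise distinct leads, a term with
nonzero coefficient contributes an exponent of no larger key. -/
theorem exists_isLead_sum {T : Finset (σ →₀ ℕ)} {p : (σ →₀ ℕ) → MvPolynomial σ ℂ}
    (hp : ∀ w ∈ T, IsLead key (p w) w)
    (c : (σ →₀ ℕ) → ℂ)
    {w₀ : σ →₀ ℕ} (hw₀ : w₀ ∈ T) (hc : c w₀ ≠ 0) :
    ∃ w ∈ T, key w ≤ key w₀ ∧ (∑ w ∈ T, c w • p w).coeff w ≠ 0 := by
  classical
  have hne : (T.filter fun w => c w ≠ 0).Nonempty := ⟨w₀, by simp [hw₀, hc]⟩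
  obtain ⟨w, hw, hmin⟩ := Finset.exists_min_image _ key hne
  rw [Finset.mem_filter] at hw
  refine ⟨w, hw.1, hmin w₀ (by simp [hw₀, hc]), ?_⟩
  rw [coeff_sum, Finset.sum_eq_single w]
  · simpa [coeff_smul] using ⟨hw.2, (hp w hw.1).1⟩
  · intro w' hw' hne'
    rw [coeff_smul, smul_eq_mul]
    by_contra hcon
    obtain ⟨h1, h2⟩ := mul_ne_zero_iff.mp hcon
    have hle : key w ≤ key w' := hmin w' (by simp [hw', h1])
    exact absurd ((hp w' hw').2 w (mem_support_iff.mpr h2) (Ne.symm hne')) (not_lt.mpr hle)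
  · exact fun h => absurd hw.1 h

/-- The span of the `n`-fold products of the generators `Q` with lead key above `x`. -/
def spanAbove {ι : Type*} (key : (σ →₀ ℕ) →+ Γ) (Q : ι → MvPolynomial σ ℂ) (E : ι → σ →₀ ℕ)
    (n : ℕ) (x : Γ) : Submodule ℂ (MvPolynomial σ ℂ) :=
  Submodule.span ℂ {g | ∃ m : Multiset ι, m.card = n ∧ x < key (m.map E).sum ∧
    g = (m.map Q).prod}

/-- If the products of two generators realise at least as many exponents as the dimension
of their span, then every binomial relation between exponents of two-fold products lifts
to a relation between these products modulo terms with larger key. -/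
theorem exists_sub_mem_spanAbove [IsOrderedAddMonoid Γ] {ι : Type*} [Fintype ι]
    [DecidableEq σ] {Q : ι → MvPolynomial σ ℂ} {E : ι → σ →₀ ℕ}
    (hQ : ∀ i, IsLead key (Q i) (E i))
    (hfin : Module.finrank ℂ
        (Submodule.span ℂ (Set.range fun p : ι × ι => Q p.1 * Q p.2)) ≤
      (Finset.univ.image fun p : ι × ι => E p.1 + E p.2).card)
    (a b a' b' : ι) (hE : E a + E b = E a' + E b') :
    ∃ c : ℂ, c ≠ 0 ∧
      Q a * Q b - c • (Q a' * Q b') ∈ spanAbove key Q E 2 (key (E a + E b)) := by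
  classical
  set T := Finset.univ.image fun p : ι × ι => E p.1 + E p.2 with hT
  have hrep : ∀ w : σ →₀ ℕ, ∃ p : ι × ι, w ∈ T → E p.1 + E p.2 = w := by
    intro w
    by_cases hw : w ∈ T
    · obtain ⟨p, -, hp⟩ := Finset.mem_image.mp hw
      exact ⟨p, fun _ => hp⟩
    · exact ⟨(a, a), fun h => absurd h hw⟩
  choose rep hrep using hrep
  let p : (σ →₀ ℕ) → MvPolynomial σ ℂ := fun w => Q (rep w).1 * Q (rep w).2
  have hp : ∀ w ∈ T, IsLead key (p w) w := fun w hw => by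
    have := (hQ (rep w).1).mul (hQ (rep w).2)
    rwa [hrep w hw] at this
  set A := Submodule.span ℂ (Set.range fun p : ι × ι => Q p.1 * Q p.2) with hA
  have hpA : ∀ w, p w ∈ A := fun w => Submodule.subset_span ⟨rep w, rfl⟩
  have hli : LinearIndependent ℂ fun w : T => p w := by
    rw [Fintype.linearIndependent_iff]
    intro c hc w
    by_contra hcw
    obtain ⟨w', -, -, h⟩ := exists_isLead_sum hp
      (fun w => if h : w ∈ T then c ⟨w, h⟩ else 0) w.2 (by simpa using hcw)
    apply h
    rw [← Finset.sum_attach, ← Finset.univ_eq_attach]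
    have : (∑ x : T, (if h : (x : σ →₀ ℕ) ∈ T then c ⟨x, h⟩ else 0) • p x) = 0 := by
      rw [← hc]
      exact Finset.sum_congr rfl fun x _ => by simp
    rw [this, coeff_zero]
  have hspan : Submodule.span ℂ (Set.range fun w : T => p w) = A := by
    have : FiniteDimensional ℂ A := FiniteDimensional.span_of_finite ℂ (Set.finite_range _)
    apply Submodule.eq_of_le_of_finrank_le
    · rw [Submodule.span_le]
      rintro _ ⟨w, rfl⟩
      exact hpA w
    · rw [finrank_span_eq_card hli, Fintype.card_coe]
      exact hfin
  have hl := (hQ a).mul (hQ b)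
  have hl' := (hQ a').mul (hQ b')
  rw [← hE] at hl'
  set w₀ := E a + E b with hw₀
  refine ⟨(Q a * Q b).coeff w₀ / (Q a' * Q b').coeff w₀, div_ne_zero hl.1 hl'.1, ?_⟩
  set g := Q a * Q b - ((Q a * Q b).coeff w₀ / (Q a' * Q b').coeff w₀) • (Q a' * Q b') with hg
  have hgA : g ∈ A := A.sub_mem (Submodule.subset_span ⟨(a, b), rfl⟩)
    (A.smul_mem _ (Submodule.subset_span ⟨(a', b'), rfl⟩))
  have hg0 : g.coeff w₀ = 0 := by
    rw [hg, coeff_sub, coeff_smul, smul_eq_mul, div_mul_cancel₀ _ hl'.1, sub_self]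
  have hgk : ∀ m, g.coeff m ≠ 0 → key w₀ < key m := by
    intro m hm
    have hne : m ≠ w₀ := fun h => hm (h ▸ hg0)
    by_cases h1 : (Q a * Q b).coeff m = 0
    · refine hl'.2 m (mem_support_iff.mpr fun h2 => hm ?_) hne
      rw [hg, coeff_sub, coeff_smul, h1, h2, smul_zero, sub_zero]
    · exact hl.2 m (mem_support_iff.mpr h1) hne
  rw [← hspan, Submodule.mem_span_range_iff_exists_fun] at hgA
  obtain ⟨c, hc⟩ := hgA
  have hsum : (∑ w ∈ T, (if h : w ∈ T then c ⟨w, h⟩ else 0) • p w) = g := by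
    rw [← Finset.sum_attach, ← Finset.univ_eq_attach, ← hc]
    exact Finset.sum_congr rfl fun x _ => by simp
  rw [← hc]
  refine Submodule.sum_mem _ fun w _ => ?_
  by_cases hcw : c w = 0
  · rw [hcw, zero_smul]
    exact Submodule.zero_mem _
  · refine Submodule.smul_mem _ _ (Submodule.subset_span
      ⟨{(rep w).1, (rep w).2}, by simp, ?_, by simp [p]⟩)
    obtain ⟨w', -, hle, h⟩ := exists_isLead_sum hp
      (fun w => if h : w ∈ T then c ⟨w, h⟩ else 0) w.2 (by simpa using hcw)
    rw [hsum] at h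
    have : (Multiset.map E {(rep w).1, (rep w).2}).sum = w := by
      simpa using hrep w w.2
    rw [this]
    exact (hgk w' h).trans_le hle

theorem key_lt_of_mem_spanAbove [IsOrderedAddMonoid Γ] {ι : Type*}
    {Q : ι → MvPolynomial σ ℂ} {E : ι → σ →₀ ℕ} (hQ : ∀ i, IsLead key (Q i) (E i)) {n : ℕ}
    {x : Γ} {g : MvPolynomial σ ℂ} (hg : g ∈ spanAbove key Q E n x) :
    ∀ m ∈ g.support, x < key m := by
  classical
  induction hg using Submodule.span_induction with
  | mem g hg =>
    obtain ⟨m, -, hx, rfl⟩ := hg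
    exact fun k hk => hx.trans_le ((IsLead.multiset_prod hQ m).le hk)
  | zero => simp
  | add g h _ _ hg hh =>
    intro m hm
    rcases Finset.mem_union.mp (support_add hm) with h | h
    exacts [hg m h, hh m h]
  | smul c g _ hg => exact fun m hm => hg m (support_smul hm)

theorem mul_mem_spanAbove [IsOrderedAddMonoid Γ] {ι : Type*}
    {Q : ι → MvPolynomial σ ℂ} {E : ι → σ →₀ ℕ} {n : ℕ} {x : Γ} {g : MvPolynomial σ ℂ}
    (hg : g ∈ spanAbove key Q E n x) (c : Multiset ι) :
    g * (c.map Q).prod ∈ spanAbove key Q E (n + c.card) (x + key (c.map E).sum) := by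
  induction hg using Submodule.span_induction with
  | mem g hg =>
    obtain ⟨m, hm, hx, rfl⟩ := hg
    refine Submodule.subset_span ⟨m + c, by simp [hm], ?_, by simp⟩
    rw [Multiset.map_add, Multiset.sum_add, map_add]
    exact add_lt_add_left hx _
  | zero => simp
  | add g h _ _ hg hh => rw [add_mul]; exact Submodule.add_mem _ hg hh
  | smul a g _ hg => rw [smul_mul_assoc]; exact Submodule.smul_mem _ _ hg

/-- Two products of generators are *equivalent* if they have the same number of factors
and the same lead exponent, and agree up to a scalar and terms with larger key. -/
def LeadEquiv {ι : Type*} (key : (σ →₀ ℕ) →+ Γ) (Q : ι → MvPolynomial σ ℂ)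
    (E : ι → σ →₀ ℕ) (m m' : Multiset ι) : Prop :=
  m.card = m'.card ∧ (m.map E).sum = (m'.map E).sum ∧ ∃ c : ℂ, c ≠ 0 ∧
    (m.map Q).prod - c • (m'.map Q).prod ∈ spanAbove key Q E m.card (key (m.map E).sum)

theorem leadEquiv_equivalence {ι : Type*} (Q : ι → MvPolynomial σ ℂ) (E : ι → σ →₀ ℕ) :
    Equivalence (LeadEquiv key Q E) where
  refl m := ⟨rfl, rfl, 1, one_ne_zero, by simp⟩
  symm := by
    rintro m m' ⟨h1, h2, c, hc, h⟩
    refine ⟨h1.symm, h2.symm, c⁻¹, inv_ne_zero hc, ?_⟩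
    rw [← h1, ← h2]
    have : (m'.map Q).prod - c⁻¹ • (m.map Q).prod =
        (-c⁻¹) • ((m.map Q).prod - c • (m'.map Q).prod) := by
      rw [smul_sub, smul_smul, neg_mul, inv_mul_cancel₀ hc, neg_smul, neg_smul, one_smul]
      ring
    rw [this]
    exact Submodule.smul_mem _ _ h
  trans := by
    rintro m m' m'' ⟨h1, h2, c, hc, h⟩ ⟨h1', h2', c', hc', h'⟩
    refine ⟨h1.trans h1', h2.trans h2', c * c', mul_ne_zero hc hc', ?_⟩
    rw [← h1, ← h2] at h'
    have : (m.map Q).prod - (c * c') • (m''.map Q).prod =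
        ((m.map Q).prod - c • (m'.map Q).prod) +
          c • ((m'.map Q).prod - c' • (m''.map Q).prod) := by
      rw [smul_sub, smul_smul]
      ring
    rw [this]
    exact Submodule.add_mem _ h (Submodule.smul_mem _ _ h')

theorem leadEquiv_pair [IsOrderedAddMonoid Γ] {ι : Type*} [Fintype ι]
    [DecidableEq σ] {Q : ι → MvPolynomial σ ℂ} {E : ι → σ →₀ ℕ}
    (hQ : ∀ i, IsLead key (Q i) (E i))
    (hfin : Module.finrank ℂ
        (Submodule.span ℂ (Set.range fun p : ι × ι => Q p.1 * Q p.2)) ≤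
      (Finset.univ.image fun p : ι × ι => E p.1 + E p.2).card)
    (a b a' b' : ι) (c : Multiset ι) (hE : E a + E b = E a' + E b') :
    LeadEquiv key Q E (a ::ₘ b ::ₘ c) (a' ::ₘ b' ::ₘ c) := by
  obtain ⟨x, hx, h⟩ := exists_sub_mem_spanAbove hQ hfin a b a' b' hE
  refine ⟨by simp, by simp [← add_assoc, hE], x, hx, ?_⟩
  have := mul_mem_spanAbove h c
  rw [sub_mul, smul_mul_assoc, ← map_add] at this
  convert this using 2
  · simp only [Multiset.card_cons]
    omega
  · simp [add_assoc]
  · simp [mul_assoc]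
  · simp [mul_assoc]

/-- If products with equal lead exponents are equivalent, then the lead exponents of all
combinations of `n`-fold products are lead exponents of `n`-fold products. -/
theorem exists_isLead_of_mem_span [IsOrderedAddMonoid Γ] {ι : Type*} [Fintype ι]
    {Q : ι → MvPolynomial σ ℂ} {E : ι → σ →₀ ℕ} (hQ : ∀ i, IsLead key (Q i) (E i)) {n : ℕ}
    (hinj : ∀ m m' : Multiset ι, key (m.map E).sum = key (m'.map E).sum →
      (m.map E).sum = (m'.map E).sum)
    (hconn : ∀ m m' : Multiset ι, m.card = n → m'.card = n →
      (m.map E).sum = (m'.map E).sum → LeadEquiv key Q E m m')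
    {g : MvPolynomial σ ℂ}
    (hg : g ∈ Submodule.span ℂ {g | ∃ m : Multiset ι, m.card = n ∧ g = (m.map Q).prod})
    (hg0 : g ≠ 0) : ∃ m : Multiset ι, IsLead key g (m.map E).sum := by
  classical
  have main : ∀ (k : ℕ) (T : Finset (Sym ι n)), T.card ≤ k →
      (∀ m ∈ T, ∀ m' : Sym ι n, key ((m : Multiset ι).map E).sum <
        key ((m' : Multiset ι).map E).sum → m' ∈ T) →
      ∀ g ∈ Submodule.span ℂ ((fun m : Sym ι n => ((m : Multiset ι).map Q).prod) '' T),
        g ≠ 0 → ∃ m : Multiset ι, IsLead key g (m.map E).sum := by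
    intro k
    induction k with
    | zero =>
      intro T hT _ g hg hg0
      rw [Finset.card_eq_zero.mp (Nat.le_zero.mp hT)] at hg
      simp at hg
      exact absurd hg hg0
    | succ k ih =>
      intro T hT hup g hg hg0
      rcases T.eq_empty_or_nonempty with rfl | hne
      · simp at hg
        exact absurd hg hg0
      obtain ⟨m₀, hm₀, hmin⟩ := Finset.exists_min_image T
        (fun m : Sym ι n => key ((m : Multiset ι).map E).sum) hne
      set w := key ((m₀ : Multiset ι).map E).sum with hw
      set T' := T.filter fun m : Sym ι n => w < key ((m : Multiset ι).map E).sum with hT'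
      have habove : spanAbove key Q E n w ≤ Submodule.span ℂ
          ((fun m : Sym ι n => ((m : Multiset ι).map Q).prod) '' T') := by
        refine Submodule.span_le.mpr ?_
        rintro _ ⟨m, hm, hx, rfl⟩
        refine Submodule.subset_span ⟨Sym.mk m hm, ?_, rfl⟩
        rw [Finset.mem_coe, hT', Finset.mem_filter]
        exact ⟨hup m₀ hm₀ (Sym.mk m hm) hx, hx⟩
      have hdecomp : ∃ c : ℂ, ∃ h ∈ spanAbove key Q E n w,
          g = c • ((m₀ : Multiset ι).map Q).prod + h := by
        induction hg using Submodule.span_induction with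
        | mem g hg =>
          obtain ⟨m, hm, rfl⟩ := hg
          rcases (hmin m hm).lt_or_eq with h | h
          · exact ⟨0, _, Submodule.subset_span ⟨m, m.2, h, rfl⟩, by simp⟩
          · obtain ⟨-, h2, c, -, h3⟩ := hconn m m₀ m.2 m₀.2 (hinj _ _ h.symm)
            refine ⟨c, _, ?_, (add_sub_cancel _ _).symm⟩
            rwa [h2, show Multiset.card (m : Multiset ι) = n from m.2] at h3
        | zero => exact ⟨0, 0, Submodule.zero_mem _, by simp⟩
        | add g g' _ _ hg hg' =>
          by_cases h1 : g = 0
          · by_cases h2 : g' = 0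
            · exact ⟨0, 0, Submodule.zero_mem _, by simp [h1, h2]⟩
            · simpa [h1] using hg' h2
          by_cases h2 : g' = 0
          · simpa [h2] using hg h1
          obtain ⟨c, h, hh, rfl⟩ := hg h1
          obtain ⟨c', h', hh', rfl⟩ := hg' h2
          exact ⟨c + c', h + h', Submodule.add_mem _ hh hh', by rw [add_smul]; ring⟩
        | smul a g _ hg =>
          by_cases h1 : g = 0
          · exact ⟨0, 0, Submodule.zero_mem _, by simp [h1]⟩
          obtain ⟨c, h, hh, rfl⟩ := hg h1
          exact ⟨a * c, a • h, Submodule.smul_mem _ _ hh, by rw [smul_add, smul_smul]⟩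
      obtain ⟨c, h, hh, rfl⟩ := hdecomp
      by_cases hc : c = 0
      · rw [hc, zero_smul, zero_add] at hg0 ⊢
        refine ih T' ?_ ?_ h (habove hh) hg0
        · have : T' ⊂ T := Finset.filter_ssubset.mpr ⟨m₀, hm₀, lt_irrefl _⟩
          have := Finset.card_lt_card this
          omega
        · intro m hm m' hlt
          rw [hT', Finset.mem_filter] at hm ⊢
          exact ⟨hup m hm.1 m' hlt, hm.2.trans hlt⟩
      · have hl := IsLead.multiset_prod hQ (m₀ : Multiset ι)
        have hk := key_lt_of_mem_spanAbove hQ hh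
        refine ⟨m₀, ?_, fun m hm hne => ?_⟩
        · have : h.coeff ((m₀ : Multiset ι).map E).sum = 0 := by
            by_contra hcon
            exact lt_irrefl _ (hk _ (mem_support_iff.mpr hcon))
          rw [coeff_add, this, add_zero, coeff_smul]
          exact mul_ne_zero hc hl.1
        · rcases Finset.mem_union.mp (support_add hm) with h' | h'
          · exact hl.2 m (support_smul h') hne
          · exact hk m h'
  refine main _ Finset.univ le_rfl (fun _ _ _ _ => Finset.mem_univ _) g ?_ hg0
  refine Submodule.span_mono ?_ hg
  rintro _ ⟨m, hm, rfl⟩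
  exact ⟨Sym.mk m hm, by simp, rfl⟩

/-- Every polynomial expression in the generators is a combination of `n`-fold products
for some `n`, provided one of the generators is a nonzero constant. -/
theorem exists_aeval_mem_span {ι : Type*} {Q : ι → MvPolynomial σ ℂ} {i₀ : ι}
    {c₀ : ℂ} (h₀ : c₀ • Q i₀ = 1) {τ : Type*} (P : τ → MvPolynomial σ ℂ)
    (hP : ∀ k, ∃ i, ∃ c : ℂ, P k = c • Q i) (f : MvPolynomial τ ℂ) :
    ∃ n, aeval P f ∈
      Submodule.span ℂ {g | ∃ m : Multiset ι, m.card = n ∧ g = (m.map Q).prod} := by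
  let W : ℕ → Submodule ℂ (MvPolynomial σ ℂ) := fun n =>
    Submodule.span ℂ {g | ∃ m : Multiset ι, m.card = n ∧ g = (m.map Q).prod}
  have hstep : ∀ n i, ∀ g ∈ W n, g * Q i ∈ W (n + 1) := by
    intro n i g hg
    induction hg using Submodule.span_induction with
    | mem g hg =>
      obtain ⟨m, hm, rfl⟩ := hg
      exact Submodule.subset_span ⟨i ::ₘ m, by simp [hm], by simp [mul_comm]⟩
    | zero => simp
    | add g h _ _ hg hh => rw [add_mul]; exact Submodule.add_mem _ hg hh
    | smul a g _ hg => rw [smul_mul_assoc]; exact Submodule.smul_mem _ _ hg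
  have hmono : Monotone W := monotone_nat_of_le_succ fun n g hg => by
    rw [← mul_one g, ← h₀, mul_smul_comm]
    exact Submodule.smul_mem _ _ (hstep n i₀ g hg)
  change ∃ n, aeval P f ∈ W n
  induction f using MvPolynomial.induction_on with
  | C a =>
    refine ⟨0, ?_⟩
    rw [aeval_C, Algebra.algebraMap_eq_smul_one]
    exact Submodule.smul_mem _ _ (Submodule.subset_span ⟨0, by simp⟩)
  | add p q hp hq =>
    obtain ⟨n, hn⟩ := hp
    obtain ⟨k, hk⟩ := hq
    refine ⟨max n k, ?_⟩
    rw [map_add]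
    exact Submodule.add_mem _ (hmono (le_max_left _ _) hn) (hmono (le_max_right _ _) hk)
  | mul_X p k hp =>
    obtain ⟨n, hn⟩ := hp
    obtain ⟨i, c, hc⟩ := hP k
    refine ⟨n + 1, ?_⟩
    rw [map_mul, aeval_X, hc, mul_smul_comm]
    exact Submodule.smul_mem _ _ (hstep n i _ hn)

end Lead

set_option maxHeartbeats 4000000 in
theorem table_sign {o₁ o₂ o₃ o₄ o₅ : Bool}
    (ho : (o₁, o₂, o₃, o₄, o₅) ∈ [(true, true, true, true, true), (false, false, true, true, true),
      (true, true, false, true, true), (true, true, true, false, false),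
      (false, false, false, false, true), (true, false, false, false, true),
      (false, true, true, true, false), (true, true, true, true, false),
      (true, false, false, false, false), (false, true, true, true, true)])
    {a b c d e f g h : ℤ}
    (h₁ : ∀ ε : ℤ, ε = 1 ∨ ε = -1 →
      (bif o₁ then ε * b ≤ 0 ∨ ε * d ≤ 0 else ε * a ≤ 0 ∨ ε * e ≤ 0) ∧
      (bif o₂ then ε * c ≤ 0 ∨ ε * d ≤ 0 else ε * a ≤ 0 ∨ ε * f ≤ 0) ∧
      (bif o₃ then ε * c ≤ 0 ∨ ε * e ≤ 0 else ε * b ≤ 0 ∨ ε * f ≤ 0) ∧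
      (bif o₄ then ε * c ≤ 0 ∨ ε * g ≤ 0 else ε * b ≤ 0 ∨ ε * h ≤ 0) ∧
      (bif o₅ then ε * f ≤ 0 ∨ ε * g ≤ 0 else ε * e ≤ 0 ∨ ε * h ≤ 0))
    (r0 : a + b + c = 0) (r1 : d + e + f = 0) (r2 : g + h = 0)
    (c1 : a + d = 0) (c2 : b + e + g = 0) :
    (a = 0 ∧ b = 0 ∧ g = 0) ∨
      ((o₁, o₂, o₃, o₄, o₅) = (true, false, false, false, true) ∧ b = 0 ∧ g = -a) ∨
      ((o₁, o₂, o₃, o₄, o₅) = (false, true, true, true, false) ∧ b = -a ∧ g = a) := by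
  have h₂ := h₁ 1 (Or.inl rfl)
  have h₃ := h₁ (-1) (Or.inr rfl)
  clear h₁
  obtain rfl : d = -a := by lia
  obtain rfl : h = -g := by lia
  obtain rfl : c = -a - b := by lia
  obtain rfl : e = -b - g := by lia
  obtain rfl : f = a + b + g := by lia
  clear r0 r1 r2 c1 c2
  simp only [List.mem_cons, Prod.mk.injEq, List.not_mem_nil, or_false] at ho
  rcases ho with ⟨rfl, rfl, rfl, rfl, rfl⟩ | ⟨rfl, rfl, rfl, rfl, rfl⟩ | ⟨rfl, rfl, rfl, rfl, rfl⟩ |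
    ⟨rfl, rfl, rfl, rfl, rfl⟩ | ⟨rfl, rfl, rfl, rfl, rfl⟩ | ⟨rfl, rfl, rfl, rfl, rfl⟩ |
    ⟨rfl, rfl, rfl, rfl, rfl⟩ | ⟨rfl, rfl, rfl, rfl, rfl⟩ | ⟨rfl, rfl, rfl, rfl, rfl⟩ |
    ⟨rfl, rfl, rfl, rfl, rfl⟩ <;>
  · simp only [cond_true, cond_false, one_mul, neg_mul, neg_neg, Left.neg_nonpos_iff,
      Prod.mk.injEq, Bool.false_eq_true, Bool.true_eq_false, and_true, true_and, and_false,
      false_and, or_false, false_or] at h₂ h₃ ⊢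
    obtain ⟨h₂, k₂, l₂, m₂, n₂⟩ := h₂
    obtain ⟨h₃, k₃, l₃, m₃, n₃⟩ := h₃
    rcases lt_trichotomy a 0 with ha | rfl | ha <;>
    rcases lt_trichotomy g 0 with hg | rfl | hg <;>
    rcases lt_trichotomy b 0 with hb | rfl | hb <;> omega

section Combinatorics

/-- The ten pairs `(t, u)` with `t ≤ u ≤ 3`. -/
def bases : List (ℕ × ℕ) :=
  [(0,0),(0,1),(0,2),(0,3),(1,1),(1,2),(1,3),(2,2),(2,3),(3,3)]

/-- Membership of the label `i ≤ 4` in the three-element set encoded by `(t, u)`: it is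
`{0,1,2,3} \ {u}` for `t = 0` and `{0,1,2,3,4} \ {u, t - 1}` for `t ≥ 1`. -/
def inBase (b : ℕ × ℕ) (i : ℕ) : Bool :=
  bif i.beq 4 then Nat.ble 1 b.1 else !(i.beq b.2) && !((i + 1).beq b.1)

/-- The number of initial entries of `T` contained in the set encoded by `b`. -/
def rk (T : ℕ × ℕ × ℕ) (b : ℕ × ℕ) : ℕ :=
  bif inBase b T.1 then bif inBase b T.2.1 then bif inBase b T.2.2 then 3 else 2 else 1 else 0

/-- The weight deciding which exchanges of second entries are improvements. -/
def om (T : ℕ × ℕ × ℕ) (b : ℕ × ℕ) : ℕ := 40 * rk T b + 5 * rk T b ^ 2 + b.1 * b.2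

/-- A linear order on `bases` refining the order by rank. -/
def rho (T : ℕ × ℕ × ℕ) (b : ℕ × ℕ) : ℕ := 16 * rk T b + 4 * b.1 + b.2

/-- The ordered triples of distinct labels below `5`. -/
def triples : List (ℕ × ℕ × ℕ) :=
  ((List.range 5).flatMap fun i => (List.range 5).flatMap fun j =>
    (List.range 5).map fun k => (i, j, k)).filter
      fun T => !(T.1.beq T.2.1) && !(T.1.beq T.2.2) && !(T.2.1.beq T.2.2)

theorem rk_le (T : ℕ × ℕ × ℕ) (b : ℕ × ℕ) : rk T b ≤ 3 := by
  unfold rk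
  cases inBase b T.1 <;> cases inBase b T.2.1 <;> cases inBase b T.2.2 <;> simp

theorem le_three_of_mem_bases {b : ℕ × ℕ} (hb : b ∈ bases) : b.1 ≤ b.2 ∧ b.2 ≤ 3 := by
  revert b; decide

theorem mem_bases {b : ℕ × ℕ} (h : b.1 ≤ b.2) (h' : b.2 ≤ 3) : b ∈ bases := by
  obtain ⟨t, u⟩ := b
  simp only at h h'
  interval_cases u <;> interval_cases t <;> decide

set_option maxRecDepth 100000 in
theorem rk_exchange : ∀ T ∈ triples, ∀ b ∈ bases, ∀ c ∈ bases, c.1 ≤ b.2 → b.1 ≤ c.2 →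
    om T b + om T c < om T (b.1, c.2) + om T (c.1, b.2) →
    min (rk T b) (rk T c) ≤ min (rk T (b.1, c.2)) (rk T (c.1, b.2)) ∧
    max (rk T b) (rk T c) ≤ max (rk T (b.1, c.2)) (rk T (c.1, b.2)) := by
  decide +kernel

/-- The orientations of the five exchanges of bases that are possible. -/
def orient (T : ℕ × ℕ × ℕ) : Bool × Bool × Bool × Bool × Bool :=
  let f : ℕ × ℕ → ℕ × ℕ → Bool := fun b c =>
    Nat.blt (om T (b.1, c.2) + om T (c.1, b.2)) (om T b + om T c)
  (f (0,1) (1,2), f (0,1) (1,3), f (0,2) (1,3), f (0,2) (2,3), f (1,2) (2,3))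

set_option maxRecDepth 100000 in
theorem om_exchange_ne : ∀ T ∈ triples,
    ∀ p ∈ [((0,1),(1,2)),((0,1),(1,3)),((0,2),(1,3)),((0,2),(2,3)),((1,2),(2,3))],
      om T p.1 + om T p.2 ≠ om T (p.1.1, p.2.2) + om T (p.2.1, p.1.2) := by
  decide +kernel

set_option maxRecDepth 100000 in
theorem orient_mem : ∀ T ∈ triples, orient T ∈
    [(true, true, true, true, true), (false, false, true, true, true),
      (true, true, false, true, true), (true, true, true, false, false),
      (false, false, false, false, true), (true, false, false, false, true),
      (false, true, true, true, false), (true, true, true, true, false),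
      (true, false, false, false, false), (false, true, true, true, true)] := by
  decide +kernel

/-- `b` and `c` have the same entries as `b'` and `c'`. -/
def SamePair (b c b' c' : ℕ × ℕ) : Prop :=
  (b.1 = b'.1 ∧ c.1 = c'.1 ∨ b.1 = c'.1 ∧ c.1 = b'.1) ∧
    (b.2 = b'.2 ∧ c.2 = c'.2 ∨ b.2 = c'.2 ∧ c.2 = b'.2)

instance (b c b' c' : ℕ × ℕ) : Decidable (SamePair b c b' c') := by
  unfold SamePair; infer_instance

/-- The bases `p₀, x, y` of ranks `0, 2, 2` can be exchanged in two steps for the bases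
`q₀, q₁, q₂` of ranks `0, 1, 3`, the first step moving an entry at most `1`. -/
def TripleStep (T : ℕ × ℕ × ℕ) (p₀ x y q₀ q₁ q₂ : ℕ × ℕ) : Prop :=
  ∃ w ∈ bases, 1 ≤ rk T w ∧ SamePair p₀ x q₀ w ∧ SamePair w y q₁ q₂ ∨
    SamePair p₀ x w q₁ ∧ SamePair w y q₀ q₂

instance (T : ℕ × ℕ × ℕ) (p₀ x y q₀ q₁ q₂ : ℕ × ℕ) :
    Decidable (TripleStep T p₀ x y q₀ q₁ q₂) := by
  unfold TripleStep; infer_instance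

/-- The bases `p` have ranks `0, 2, 2`, the bases `q` have ranks `0, 1, 3`, and the former
can be exchanged for the latter. -/
def TripleMove (T : ℕ × ℕ × ℕ) (p₀ p₁ p₂ q₀ q₁ q₂ : ℕ × ℕ) : Prop :=
  rk T p₀ = 0 ∧ rk T p₁ = 2 ∧ rk T p₂ = 2 ∧ rk T q₀ = 0 ∧ rk T q₁ = 1 ∧ rk T q₂ = 3 ∧
    om T p₀ + om T p₁ + om T p₂ < om T q₀ + om T q₁ + om T q₂ ∧
    (∀ b ∈ bases, rk T b = 2 → b = p₁ ∨ b = p₂) ∧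
    TripleStep T p₀ p₁ p₂ q₀ q₁ q₂ ∧ TripleStep T p₀ p₂ p₁ q₀ q₁ q₂

instance (T : ℕ × ℕ × ℕ) (p₀ p₁ p₂ q₀ q₁ q₂ : ℕ × ℕ) :
    Decidable (TripleMove T p₀ p₁ p₂ q₀ q₁ q₂) := by
  unfold TripleMove; infer_instance

set_option maxRecDepth 100000 in
theorem tripleMove_of_orient_diag : ∀ T ∈ triples, orient T = (true, false, false, false, true) →
    TripleMove T (1,2) (0,1) (2,3) (1,1) (2,2) (0,3) ∨
    TripleMove T (1,2) (0,1) (2,3) (2,2) (1,1) (0,3) ∨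
    TripleMove T (0,3) (1,1) (2,2) (2,3) (0,1) (1,2) ∨
    TripleMove T (0,3) (1,1) (2,2) (0,1) (2,3) (1,2) := by
  decide +kernel

set_option maxRecDepth 100000 in
theorem tripleMove_of_orient_anti : ∀ T ∈ triples, orient T = (false, true, true, true, false) →
    TripleMove T (1,3) (0,1) (2,2) (1,1) (2,3) (0,2) ∨
    TripleMove T (1,3) (0,1) (2,2) (2,3) (1,1) (0,2) ∨
    TripleMove T (0,2) (1,1) (2,3) (2,2) (0,1) (1,3) ∨
    TripleMove T (0,2) (1,1) (2,3) (0,1) (2,2) (1,3) := by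
  decide +kernel

/-- The generators: a base with a mark not exceeding its rank. -/
abbrev Gen (T : ℕ × ℕ × ℕ) : Type :=
  {g : ℕ × ℕ × ℕ // g.2 ∈ bases ∧ g.1 ≤ rk T g.2}

/-- Two multisets of generators have the same entries in each of the three positions. -/
def SameMarg {T : ℕ × ℕ × ℕ} (m m' : Multiset (Gen T)) : Prop :=
  m.map (fun g => g.1.1) = m'.map (fun g => g.1.1) ∧
    m.map (fun g => g.1.2.1) = m'.map (fun g => g.1.2.1) ∧
    m.map (fun g => g.1.2.2) = m'.map (fun g => g.1.2.2)

theorem SameMarg.card {T : ℕ × ℕ × ℕ} {m m' : Multiset (Gen T)} (h : SameMarg m m') :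
    m.card = m'.card := by
  simpa using congrArg Multiset.card h.1

/-- The weight which increases under improvements. -/
def weight {T : ℕ × ℕ × ℕ} (g : Gen T) : ℕ := 1000 * om T g.1.2 + g.1.1 * rho T g.1.2

theorem mul_rho_le {T : ℕ × ℕ × ℕ} (g : Gen T) : g.1.1 * rho T g.1.2 ≤ 189 := by
  have h := le_three_of_mem_bases g.2.1
  have hr := rk_le T g.1.2
  calc g.1.1 * rho T g.1.2 ≤ 3 * 63 :=
        Nat.mul_le_mul (g.2.2.trans hr) (by unfold rho; omega)
    _ = 189 := rfl

theorem weight_le {T : ℕ × ℕ × ℕ} (g : Gen T) : weight g ≤ 200000 := by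
  have h := le_three_of_mem_bases g.2.1
  have hr := rk_le T g.1.2
  have := mul_rho_le g
  have h1 : rk T g.1.2 ^ 2 ≤ 3 ^ 2 := Nat.pow_le_pow_left hr 2
  have h2 : g.1.2.1 * g.1.2.2 ≤ 3 * 3 := Nat.mul_le_mul (h.1.trans h.2) h.2
  unfold weight om
  omega

theorem weight_sum_le {T : ℕ × ℕ × ℕ} (m : Multiset (Gen T)) :
    (m.map weight).sum ≤ 200000 * m.card := by
  have := Multiset.sum_le_card_nsmul (m.map weight) 200000 (by
    intro x hx
    obtain ⟨g, -, rfl⟩ := Multiset.mem_map.mp hx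
    exact weight_le g)
  simpa [mul_comm] using this

/-- Exchanging two bases improves the weight. -/
def BadBase (T : ℕ × ℕ × ℕ) (b c : ℕ × ℕ) : Prop :=
  c.1 ≤ b.2 ∧ b.1 ≤ c.2 ∧ om T b + om T c < om T (b.1, c.2) + om T (c.1, b.2)

/-- Exchanging two marks improves the weight. -/
def BadMark {T : ℕ × ℕ × ℕ} (x y : Gen T) : Prop :=
  rho T x.1.2 < rho T y.1.2 ∧ y.1.1 < x.1.1

theorem exists_of_badBase {T : ℕ × ℕ × ℕ} (hT : T ∈ triples) {x y : Gen T}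
    (h : BadBase T x.1.2 y.1.2) :
    ∃ x' y' : Gen T, SameMarg {x, y} {x', y'} ∧ weight x + weight y < weight x' + weight y' := by
  obtain ⟨h1, h2, h3⟩ := h
  have hx := le_three_of_mem_bases x.2.1
  have hy := le_three_of_mem_bases y.2.1
  obtain ⟨h4, h5⟩ := rk_exchange T hT _ x.2.1 _ y.2.1 h1 h2 h3
  have hp : (x.1.2.1, y.1.2.2) ∈ bases := mem_bases h2 hy.2
  have hq : (y.1.2.1, x.1.2.2) ∈ bases := mem_bases h1 hx.2
  have hxr := x.2.2
  have hyr := y.2.2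
  have key : ∃ a b, a ≤ rk T (x.1.2.1, y.1.2.2) ∧ b ≤ rk T (y.1.2.1, x.1.2.2) ∧
      ({x.1.1, y.1.1} : Multiset ℕ) = {a, b} := by
    rcases le_total (rk T (x.1.2.1, y.1.2.2)) (rk T (y.1.2.1, x.1.2.2)) with hr | hr <;>
    rcases le_total x.1.1 y.1.1 with hs | hs
    · exact ⟨x.1.1, y.1.1, by omega, by omega, rfl⟩
    · exact ⟨y.1.1, x.1.1, by omega, by omega, Multiset.pair_comm _ _⟩
    · exact ⟨y.1.1, x.1.1, by omega, by omega, Multiset.pair_comm _ _⟩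
    · exact ⟨x.1.1, y.1.1, by omega, by omega, rfl⟩
  obtain ⟨a, b, ha, hb, hab⟩ := key
  let x' : Gen T := ⟨(a, (x.1.2.1, y.1.2.2)), hp, ha⟩
  let y' : Gen T := ⟨(b, (y.1.2.1, x.1.2.2)), hq, hb⟩
  refine ⟨x', y', ⟨by simpa using hab, by simp [x', y'], ?_⟩, ?_⟩
  · simpa [x', y'] using Multiset.pair_comm _ _
  · have := mul_rho_le x
    have := mul_rho_le y
    simp only [weight, x', y'] at *
    omega

theorem exists_of_badMark {T : ℕ × ℕ × ℕ} {x y : Gen T} (h : BadMark x y) :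
    ∃ x' y' : Gen T, SameMarg {x, y} {x', y'} ∧ weight x + weight y < weight x' + weight y' := by
  obtain ⟨h1, h2⟩ := h
  have hx := le_three_of_mem_bases x.2.1
  have hy := le_three_of_mem_bases y.2.1
  have hr : rk T x.1.2 ≤ rk T y.1.2 := by
    unfold rho at h1
    omega
  refine ⟨⟨(y.1.1, x.1.2), x.2.1, h2.le.trans x.2.2⟩, ⟨(x.1.1, y.1.2), y.2.1, x.2.2.trans hr⟩,
    ⟨by simpa using Multiset.pair_comm _ _, by simp, by simp⟩, ?_⟩
  simp only [weight]
  nlinarith [mul_pos (Nat.sub_pos_of_lt h1) (Nat.sub_pos_of_lt h2),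
    Nat.sub_add_cancel h1.le, Nat.sub_add_cancel h2.le]

theorem exists_cons_cons {α : Type*} {m : Multiset α} {x y : α} (hx : x ∈ m) (hy : y ∈ m)
    (hxy : x ≠ y) : ∃ c, m = x ::ₘ y ::ₘ c := by
  obtain ⟨c, rfl⟩ := Multiset.exists_cons_of_mem hx
  obtain ⟨d, rfl⟩ := Multiset.exists_cons_of_mem
    ((Multiset.mem_cons.mp hy).resolve_left (Ne.symm hxy))
  exact ⟨d, rfl⟩

/-- The multiplicities of bases with first entry `i` add up to the number of first
entries `i`. -/
theorem sum_count_fst {B : Multiset (ℕ × ℕ)} (hB : ∀ b ∈ B, b ∈ bases) :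
    B.count (0,0) + B.count (0,1) + B.count (0,2) + B.count (0,3) = (B.map Prod.fst).count 0 ∧
    B.count (1,1) + B.count (1,2) + B.count (1,3) = (B.map Prod.fst).count 1 ∧
    B.count (2,2) + B.count (2,3) = (B.map Prod.fst).count 2 ∧
    B.count (3,3) = (B.map Prod.fst).count 3 ∧
    B.count (0,0) = (B.map Prod.snd).count 0 ∧
    B.count (0,1) + B.count (1,1) = (B.map Prod.snd).count 1 ∧
    B.count (0,2) + B.count (1,2) + B.count (2,2) = (B.map Prod.snd).count 2 := by
  induction B using Multiset.induction_on with
  | empty => simp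
  | cons b B ih =>
    have ih := ih fun c hc => hB c (Multiset.mem_cons_of_mem hc)
    have hb := hB b (Multiset.mem_cons_self b B)
    simp only [bases, List.mem_cons, List.not_mem_nil, or_false] at hb
    rcases hb with rfl | rfl | rfl | rfl | rfl | rfl | rfl | rfl | rfl | rfl <;>
    · simp
      omega

theorem ext_of_count {B B' : Multiset (ℕ × ℕ)} (hB : ∀ b ∈ B, b ∈ bases)
    (hB' : ∀ b ∈ B', b ∈ bases) (h : ∀ b ∈ bases, B.count b = B'.count b) : B = B' := by
  ext b
  by_cases hb : b ∈ bases
  · exact h b hb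
  · rw [Multiset.count_eq_zero_of_notMem fun hm => hb (hB b hm),
      Multiset.count_eq_zero_of_notMem fun hm => hb (hB' b hm)]

/-- Bases and marks determine a multiset without bad marks. -/
theorem eq_of_bases_eq {T : ℕ × ℕ × ℕ} (m m' : Multiset (Gen T))
    (hm : ∀ x ∈ m, ∀ y ∈ m, ¬ BadMark x y) (hm' : ∀ x ∈ m', ∀ y ∈ m', ¬ BadMark x y)
    (hs : m.map (fun g => g.1.1) = m'.map (fun g => g.1.1))
    (hb : m.map (fun g => g.1.2) = m'.map (fun g => g.1.2)) : m = m' := by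
  classical
  have hmax : ∀ m : Multiset (Gen T), (∀ x ∈ m, ∀ y ∈ m, ¬ BadMark x y) → m ≠ 0 →
      ∃ x ∈ m, (∀ y ∈ m, rho T y.1.2 ≤ rho T x.1.2) ∧ ∀ y ∈ m, y.1.1 ≤ x.1.1 := by
    intro m hm h0
    have hne : m.toFinset.Nonempty := by simpa using h0
    obtain ⟨x, hx, hx'⟩ := Finset.exists_max_image m.toFinset
      (fun g => 4 * rho T g.1.2 + g.1.1) hne
    rw [Multiset.mem_toFinset] at hx
    have hb : ∀ y : Gen T, y.1.1 ≤ 3 := fun y => y.2.2.trans (rk_le _ _)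
    have hle : ∀ y ∈ m, rho T y.1.2 ≤ rho T x.1.2 := by
      intro y hy
      have h1 := hx' y (by simpa using hy)
      have h2 := hb x
      omega
    refine ⟨x, hx, hle, fun y hy => ?_⟩
    by_contra hc
    have h1 := hx' y (by simpa using hy)
    have h2 := hle y hy
    have h3 := hm y hy x hx
    unfold BadMark at h3
    omega
  induction hn : m.card generalizing m m' with
  | zero =>
    have h1 := congrArg Multiset.card hb
    rw [Multiset.card_map, Multiset.card_map, hn] at h1
    rw [Multiset.card_eq_zero.mp hn, Multiset.card_eq_zero.mp h1.symm]
  | succ n ih =>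
    have h1 := congrArg Multiset.card hb
    rw [Multiset.card_map, Multiset.card_map, hn] at h1
    obtain ⟨x, hx, hxr, hxs⟩ := hmax m hm fun h => by simp [h] at hn
    obtain ⟨y, hy, hyr, hys⟩ := hmax m' hm' fun h => by simp [h] at h1
    have hxy : x = y := by
      have e1 : x.1.1 ≤ y.1.1 := by
        have : x.1.1 ∈ m'.map (fun g => g.1.1) := hs ▸ Multiset.mem_map_of_mem _ hx
        obtain ⟨z, hz, hzx⟩ := Multiset.mem_map.mp this
        exact hzx ▸ hys z hz
      have e2 : y.1.1 ≤ x.1.1 := by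
        have : y.1.1 ∈ m.map (fun g => g.1.1) := hs ▸ Multiset.mem_map_of_mem _ hy
        obtain ⟨z, hz, hzx⟩ := Multiset.mem_map.mp this
        exact hzx ▸ hxs z hz
      have e3 : rho T x.1.2 ≤ rho T y.1.2 := by
        have : x.1.2 ∈ m'.map (fun g => g.1.2) := hb ▸ Multiset.mem_map_of_mem _ hx
        obtain ⟨z, hz, hzx⟩ := Multiset.mem_map.mp this
        exact hzx ▸ hyr z hz
      have e4 : rho T y.1.2 ≤ rho T x.1.2 := by
        have : y.1.2 ∈ m.map (fun g => g.1.2) := hb ▸ Multiset.mem_map_of_mem _ hy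
        obtain ⟨z, hz, hzx⟩ := Multiset.mem_map.mp this
        exact hzx ▸ hxr z hz
      have h3 := le_three_of_mem_bases x.2.1
      have h4 := le_three_of_mem_bases y.2.1
      unfold rho at e3 e4
      refine Subtype.ext (Prod.ext (le_antisymm e1 e2) (Prod.ext ?_ ?_)) <;> omega
    subst hxy
    obtain ⟨c, rfl⟩ := Multiset.exists_cons_of_mem hx
    obtain ⟨d, rfl⟩ := Multiset.exists_cons_of_mem hy
    rw [ih c d (fun a ha b hb => hm a (Multiset.mem_cons_of_mem ha) b (Multiset.mem_cons_of_mem hb))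
      (fun a ha b hb => hm' a (Multiset.mem_cons_of_mem ha) b (Multiset.mem_cons_of_mem hb))
      (by simpa using hs) (by simpa using hb) (by simpa using hn)]

/-- An equivalent multiset of larger weight exists. -/
def Reducible {T : ℕ × ℕ × ℕ} (r : Multiset (Gen T) → Multiset (Gen T) → Prop)
    (m : Multiset (Gen T)) : Prop :=
  ∃ m', r m m' ∧ (m.map weight).sum < (m'.map weight).sum

theorem SamePair.sameMarg {T : ℕ × ℕ × ℕ} {x y x' y' : Gen T}
    (h : SamePair x.1.2 y.1.2 x'.1.2 y'.1.2)
    (hs : x.1.1 = x'.1.1 ∧ y.1.1 = y'.1.1 ∨ x.1.1 = y'.1.1 ∧ y.1.1 = x'.1.1) :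
    SameMarg {x, y} {x', y'} := by
  have key : ∀ f : Gen T → ℕ, (f x = f x' ∧ f y = f y' ∨ f x = f y' ∧ f y = f x') →
      Multiset.map f {x, y} = Multiset.map f {x', y'} := by
    rintro f (⟨h1, h2⟩ | ⟨h1, h2⟩)
    · simp [h1, h2]
    · simpa [h1, h2] using Multiset.pair_comm _ _
  exact ⟨key _ hs, key _ h.1, key _ h.2⟩

theorem reducible_of_pair {T : ℕ × ℕ × ℕ} {r : Multiset (Gen T) → Multiset (Gen T) → Prop}
    (hpair : ∀ a b a' b' c, SameMarg {a, b} {a', b'} → r (a ::ₘ b ::ₘ c) (a' ::ₘ b' ::ₘ c))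
    {m : Multiset (Gen T)} {x y : Gen T} (hx : x ∈ m) (hy : y ∈ m) (hxy : x ≠ y)
    (h : ∃ x' y' : Gen T, SameMarg {x, y} {x', y'} ∧
      weight x + weight y < weight x' + weight y') : Reducible r m := by
  obtain ⟨c, rfl⟩ := exists_cons_cons hx hy hxy
  obtain ⟨x', y', h1, h2⟩ := h
  exact ⟨_, hpair x y x' y' c h1, by simp; omega⟩

theorem exists_of_tripleStep {T : ℕ × ℕ × ℕ} {r : Multiset (Gen T) → Multiset (Gen T) → Prop}
    (hr : Equivalence r)
    (hpair : ∀ a b a' b' c, SameMarg {a, b} {a', b'} → r (a ::ₘ b ::ₘ c) (a' ::ₘ b' ::ₘ c))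
    {z x y : Gen T} {q₀ q₁ q₂ : ℕ × ℕ} (h : TripleStep T z.1.2 x.1.2 y.1.2 q₀ q₁ q₂)
    (hq₀ : q₀ ∈ bases) (hq₁ : q₁ ∈ bases) (hq₂ : q₂ ∈ bases)
    (hr₁ : rk T q₁ = 1) (hr₂ : rk T q₂ = 3)
    (hz : z.1.1 = 0) (hx : x.1.1 ≤ 1) (c : Multiset (Gen T)) :
    ∃ z' x' y' : Gen T, z'.1.2 = q₀ ∧ x'.1.2 = q₁ ∧ y'.1.2 = q₂ ∧
      r (z ::ₘ x ::ₘ y ::ₘ c) (z' ::ₘ x' ::ₘ y' ::ₘ c) := by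
  have hy : y.1.1 ≤ 3 := y.2.2.trans (rk_le _ _)
  let z' : Gen T := ⟨(0, q₀), hq₀, Nat.zero_le _⟩
  let x' : Gen T := ⟨(x.1.1, q₁), hq₁, hx.trans hr₁.ge⟩
  let y' : Gen T := ⟨(y.1.1, q₂), hq₂, hy.trans hr₂.ge⟩
  refine ⟨z', x', y', rfl, rfl, rfl, ?_⟩
  obtain ⟨w, hw, ⟨h1, h2, h3⟩ | ⟨h2, h3⟩⟩ := h
  · let w' : Gen T := ⟨(x.1.1, w), hw, hx.trans h1⟩
    refine hr.trans (hpair z x z' w' _ (SamePair.sameMarg h2 (Or.inl ⟨hz, rfl⟩))) ?_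
    have h4 := hpair w' y x' y' (z' ::ₘ c) (SamePair.sameMarg h3 (Or.inl ⟨rfl, rfl⟩))
    have e1 : z' ::ₘ w' ::ₘ y ::ₘ c = w' ::ₘ y ::ₘ z' ::ₘ c := by
      rw [Multiset.cons_swap z', Multiset.cons_swap z']
    have e2 : z' ::ₘ x' ::ₘ y' ::ₘ c = x' ::ₘ y' ::ₘ z' ::ₘ c := by
      rw [Multiset.cons_swap z', Multiset.cons_swap z']
    rwa [e1, e2]
  · let w' : Gen T := ⟨(0, w), hw, Nat.zero_le _⟩
    refine hr.trans (hpair z x w' x' _ (SamePair.sameMarg h2 (Or.inl ⟨hz, rfl⟩))) ?_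
    have h4 := hpair w' y z' y' (x' ::ₘ c) (SamePair.sameMarg h3 (Or.inl ⟨rfl, rfl⟩))
    have e1 : w' ::ₘ x' ::ₘ y ::ₘ c = w' ::ₘ y ::ₘ x' ::ₘ c := by
      rw [Multiset.cons_swap x']
    have e2 : z' ::ₘ x' ::ₘ y' ::ₘ c = z' ::ₘ y' ::ₘ x' ::ₘ c := by
      rw [Multiset.cons_swap x']
    rwa [e1, e2]

theorem reducible_of_triple {T : ℕ × ℕ × ℕ} {r : Multiset (Gen T) → Multiset (Gen T) → Prop}
    (hr : Equivalence r)
    (hpair : ∀ a b a' b' c, SameMarg {a, b} {a', b'} → r (a ::ₘ b ::ₘ c) (a' ::ₘ b' ::ₘ c))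
    {z x y : Gen T} {q₀ q₁ q₂ : ℕ × ℕ} (h : TripleStep T z.1.2 x.1.2 y.1.2 q₀ q₁ q₂)
    (hq₀ : q₀ ∈ bases) (hq₁ : q₁ ∈ bases) (hq₂ : q₂ ∈ bases)
    (hr₁ : rk T q₁ = 1) (hr₂ : rk T q₂ = 3)
    (hom : om T z.1.2 + om T x.1.2 + om T y.1.2 < om T q₀ + om T q₁ + om T q₂)
    (hz : z.1.1 = 0) (hx : x.1.1 ≤ 1) {m : Multiset (Gen T)} (hzm : z ∈ m) (hxm : x ∈ m)
    (hym : y ∈ m) (hzx : z ≠ x) (hzy : z ≠ y) (hxy : x ≠ y) : Reducible r m := by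
  obtain ⟨d, rfl⟩ := Multiset.exists_cons_of_mem hzm
  obtain ⟨c, rfl⟩ := exists_cons_cons ((Multiset.mem_cons.mp hxm).resolve_left (Ne.symm hzx))
    ((Multiset.mem_cons.mp hym).resolve_left (Ne.symm hzy)) hxy
  obtain ⟨z', x', y', hz', hx', hy', h⟩ :=
    exists_of_tripleStep hr hpair h hq₀ hq₁ hq₂ hr₁ hr₂ hz hx c
  refine ⟨_, h, ?_⟩
  have := mul_rho_le z
  have := mul_rho_le x
  have := mul_rho_le y
  rw [← hz', ← hx', ← hy'] at hom
  simp only [Multiset.map_cons, Multiset.sum_cons, weight]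
  omega

/-- A multiset containing the bases `p₀, p₁, p₂` of a triple move is reducible if another
multiset with the same marks has fewer bases of rank at least two. -/
theorem reducible_of_tripleMove {T : ℕ × ℕ × ℕ}
    {r : Multiset (Gen T) → Multiset (Gen T) → Prop} (hr : Equivalence r)
    (hpair : ∀ a b a' b' c, SameMarg {a, b} {a', b'} → r (a ::ₘ b ::ₘ c) (a' ::ₘ b' ::ₘ c))
    {p₀ p₁ p₂ q₀ q₁ q₂ : ℕ × ℕ} (h : TripleMove T p₀ p₁ p₂ q₀ q₁ q₂)
    (hq₀ : q₀ ∈ bases) (hq₁ : q₁ ∈ bases) (hq₂ : q₂ ∈ bases) (hp : p₁ ≠ p₂)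
    {m m' : Multiset (Gen T)} (hm : ∀ x ∈ m, ∀ y ∈ m, ¬ BadMark x y)
    (hs : m.map (fun g => g.1.1) = m'.map (fun g => g.1.1))
    (h₀ : p₀ ∈ m.map (fun g => g.1.2)) (h₁ : p₁ ∈ m.map (fun g => g.1.2))
    (h₂ : p₂ ∈ m.map (fun g => g.1.2))
    (hlt : ((m'.map fun g => g.1.2).map fun b => if 2 ≤ rk T b then 1 else 0).sum <
      ((m.map fun g => g.1.2).map fun b => if 2 ≤ rk T b then 1 else 0).sum) :
    Reducible r m := by
  obtain ⟨a₀, a₁, a₂, b₀, b₁, b₂, hom, honly, hstep, hstep'⟩ := h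
  have hex : ∃ x ∈ m, 2 ≤ rk T x.1.2 ∧ x.1.1 ≤ 1 := by
    by_contra! hcon
    have e1 : ((m.map fun g => g.1.2).map fun b => if 2 ≤ rk T b then 1 else 0).sum ≤
        ((m.map fun g => g.1.1).map fun s => if 2 ≤ s then 1 else 0).sum := by
      rw [Multiset.map_map, Multiset.map_map]
      refine Multiset.sum_map_le_sum_map _ _ fun x hx => ?_
      have := hcon x hx
      simp only [Function.comp_apply]
      split_ifs <;> omega
    have e2 : ((m'.map fun g => g.1.1).map fun s => if 2 ≤ s then 1 else 0).sum ≤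
        ((m'.map fun g => g.1.2).map fun b => if 2 ≤ rk T b then 1 else 0).sum := by
      rw [Multiset.map_map, Multiset.map_map]
      refine Multiset.sum_map_le_sum_map _ _ fun x hx => ?_
      have := x.2.2
      simp only [Function.comp_apply]
      split_ifs <;> omega
    rw [hs] at e1
    omega
  obtain ⟨y₀, hy₀, rfl⟩ := Multiset.mem_map.mp h₀
  obtain ⟨y₁, hy₁, rfl⟩ := Multiset.mem_map.mp h₁
  obtain ⟨y₂, hy₂, rfl⟩ := Multiset.mem_map.mp h₂
  have hz : y₀.1.1 = 0 := by have := y₀.2.2; omega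
  have hne : ∀ g g' : Gen T, rk T g.1.2 ≠ rk T g'.1.2 → g ≠ g' := fun g g' h e => h (e ▸ rfl)
  obtain ⟨x, hx, hxr, hxs⟩ := hex
  have hlow : y₁.1.1 ≤ 1 ∨ ∃ g ∈ m, (g.1.2 = y₁.1.2 ∨ g.1.2 = y₂.1.2) ∧ g.1.1 ≤ 1 := by
    by_cases hx2 : rk T x.1.2 = 2
    · exact Or.inr ⟨x, hx, honly _ x.2.1 hx2, hxs⟩
    · left
      have h3 := hm y₁ hy₁ x hx
      have hb := le_three_of_mem_bases y₁.2.1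
      have : rho T y₁.1.2 < rho T x.1.2 := by unfold rho; omega
      unfold BadMark at h3
      omega
  have main : ∃ g ∈ m, (g.1.2 = y₁.1.2 ∨ g.1.2 = y₂.1.2) ∧ g.1.1 ≤ 1 :=
    hlow.elim (fun h => ⟨y₁, hy₁, Or.inl rfl, h⟩) id
  obtain ⟨g, hg, hgb | hgb, hgs⟩ := main
  · rw [← hgb] at hstep hom a₁ hp
    exact reducible_of_triple hr hpair hstep hq₀ hq₁ hq₂ b₁ b₂ hom hz hgs hy₀ hg hy₂
      (hne _ _ (by omega)) (hne _ _ (by omega)) fun e => hp (e ▸ rfl)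
  · rw [← hgb] at hstep' hom a₂ hp
    exact reducible_of_triple hr hpair hstep' hq₀ hq₁ hq₂ b₁ b₂ (by omega) hz hgs hy₀ hg hy₁
      (hne _ _ (by omega)) (hne _ _ (by omega)) fun e => hp (e ▸ rfl)

theorem reducible_of_add_eq {T : ℕ × ℕ × ℕ}
    {r : Multiset (Gen T) → Multiset (Gen T) → Prop} (hr : Equivalence r)
    (hpair : ∀ a b a' b' c, SameMarg {a, b} {a', b'} → r (a ::ₘ b ::ₘ c) (a' ::ₘ b' ::ₘ c))
    {p₀ p₁ p₂ q₀ q₁ q₂ : ℕ × ℕ} (h : TripleMove T p₀ p₁ p₂ q₀ q₁ q₂)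
    (hd : [p₀, p₁, p₂, q₀, q₁, q₂].Nodup) (hq : ∀ q ∈ [q₀, q₁, q₂], q ∈ bases)
    {m m' : Multiset (Gen T)} (hm : ∀ x ∈ m, ∀ y ∈ m, ¬ BadMark x y)
    (hs : m.map (fun g => g.1.1) = m'.map (fun g => g.1.1)) {k : ℕ} (hk : 0 < k)
    (heq : m'.map (fun g => g.1.2) + k • {p₀, p₁, p₂} =
      m.map (fun g => g.1.2) + k • {q₀, q₁, q₂}) : Reducible r m := by
  have hin : ∀ p ∈ ({p₀, p₁, p₂} : Multiset (ℕ × ℕ)), p ∉ ({q₀, q₁, q₂} : Multiset (ℕ × ℕ)) →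
      p ∈ m.map (fun g => g.1.2) := by
    intro p hp hpq
    have : p ∈ m'.map (fun g => g.1.2) + k • {p₀, p₁, p₂} :=
      Multiset.mem_add.mpr (Or.inr (Multiset.mem_nsmul.mpr ⟨hk.ne', hp⟩))
    rw [heq, Multiset.mem_add] at this
    exact this.resolve_right fun h => hpq (Multiset.mem_nsmul.mp h).2
  simp only [List.nodup_cons, List.mem_cons, List.not_mem_nil, or_false, not_or,
    List.nodup_nil, and_true] at hd
  obtain ⟨⟨d1, d2, d3, d4, d5⟩, ⟨d6, d7, d8, d9⟩, ⟨d10, d11, d12⟩, -⟩ := hd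
  obtain ⟨a₀, a₁, a₂, b₀, b₁, b₂, -⟩ := id h
  refine reducible_of_tripleMove hr hpair h (hq _ (by simp)) (hq _ (by simp)) (hq _ (by simp))
    d6 hm hs (hin _ (by simp) (by simp [*])) (hin _ (by simp) (by simp [*]))
    (hin _ (by simp) (by simp [*])) ?_
  have := congrArg (fun B : Multiset (ℕ × ℕ) =>
    (B.map fun b => if 2 ≤ rk T b then 1 else 0).sum) heq
  simp only [Multiset.map_add, Multiset.sum_add, Multiset.map_nsmul, Multiset.sum_nsmul,
    Multiset.insert_eq_cons, Multiset.map_cons, Multiset.map_singleton, Multiset.sum_cons,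
    Multiset.sum_singleton, a₀, a₁, a₂, b₀, b₁, b₂, smul_eq_mul] at this
  simp only [show (2 ≤ 0) = False by decide, show (2 ≤ 1) = False by decide,
    show (2 ≤ 3) = True by decide, le_refl, if_true, if_false] at this
  omega

set_option maxHeartbeats 1000000 in
theorem eq_of_not_reducible {T : ℕ × ℕ × ℕ} (hT : T ∈ triples)
    {r : Multiset (Gen T) → Multiset (Gen T) → Prop} (hr : Equivalence r)
    (hpair : ∀ a b a' b' c, SameMarg {a, b} {a', b'} → r (a ::ₘ b ::ₘ c) (a' ::ₘ b' ::ₘ c))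
    {m m' : Multiset (Gen T)} (hm : ¬ Reducible r m) (hm' : ¬ Reducible r m')
    (h : SameMarg m m') : m = m' := by
  have hmark : ∀ m : Multiset (Gen T), ¬ Reducible r m →
      ∀ x ∈ m, ∀ y ∈ m, ¬ BadMark x y := by
    intro m hm x hx y hy hb
    refine hm (reducible_of_pair hpair hx hy ?_ (exists_of_badMark hb))
    rintro rfl
    exact lt_irrefl _ hb.1
  have hbase : ∀ m : Multiset (Gen T), ¬ Reducible r m → ∀ b c, BadBase T b c →
      (m.map fun g => g.1.2).count b = 0 ∨ (m.map fun g => g.1.2).count c = 0 := by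
    intro m hm b c hb
    by_contra! hcon
    obtain ⟨x, hx, rfl⟩ := Multiset.mem_map.mp (Multiset.count_pos.mp (Nat.pos_of_ne_zero hcon.1))
    obtain ⟨y, hy, rfl⟩ := Multiset.mem_map.mp (Multiset.count_pos.mp (Nat.pos_of_ne_zero hcon.2))
    refine hm (reducible_of_pair hpair hx hy ?_ (exists_of_badBase hT hb))
    rintro rfl
    exact lt_irrefl _ hb.2.2
  have hmem : ∀ m : Multiset (Gen T), ∀ b ∈ m.map (fun g => g.1.2), b ∈ bases := by
    intro m b hb
    obtain ⟨x, -, rfl⟩ := Multiset.mem_map.mp hb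
    exact x.2.1
  obtain ⟨hs, hf, hu⟩ := h
  have hB := hmem m
  have hB' := hmem m'
  have k := hbase m hm
  have k' := hbase m' hm'
  set B := m.map fun g => g.1.2 with hBdef
  set B' := m'.map fun g => g.1.2 with hBdef'
  have c := sum_count_fst hB
  have c' := sum_count_fst hB'
  have ef : B.map Prod.fst = B'.map Prod.fst := by
    rw [hBdef, hBdef', Multiset.map_map, Multiset.map_map]
    exact hf
  have eu : B.map Prod.snd = B'.map Prod.snd := by
    rw [hBdef, hBdef', Multiset.map_map, Multiset.map_map]
    exact hu
  rw [← ef, ← eu] at c'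
  obtain ⟨f0, f1, f2, f3, g0, g1, g2⟩ := c
  obtain ⟨f0', f1', f2', f3', g0', g1', g2'⟩ := c'
  rw [← f0] at f0'
  rw [← f1] at f1'
  rw [← f2] at f2'
  rw [← f3] at f3'
  rw [← g0] at g0'
  rw [← g1] at g1'
  rw [← g2] at g2'
  clear f0 f1 f2 f3 g0 g1 g2 ef eu
  have hor := orient_mem T hT
  have hdiag : ∀ b c : ℕ × ℕ, (b, c) ∈ [((0,1),(1,2)),((0,1),(1,3)),((0,2),(1,3)),
      ((0,2),(2,3)),((1,2),(2,3))] → ∀ ε : ℤ, ε = 1 ∨ ε = -1 →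
      bif Nat.blt (om T (b.1, c.2) + om T (c.1, b.2)) (om T b + om T c) then
        ε * ((B'.count (b.1, c.2) : ℤ) - B.count (b.1, c.2)) ≤ 0 ∨
          ε * ((B'.count (c.1, b.2) : ℤ) - B.count (c.1, b.2)) ≤ 0
      else ε * ((B'.count b : ℤ) - B.count b) ≤ 0 ∨ ε * ((B'.count c : ℤ) - B.count c) ≤ 0 := by
    intro b c hbc ε hε
    have hle : c.1 ≤ b.2 ∧ b.1 ≤ c.2 ∧ b.1 ≤ b.2 ∧ c.1 ≤ c.2 := by
      simp only [List.mem_cons, Prod.mk.injEq, List.not_mem_nil, or_false] at hbc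
      rcases hbc with ⟨rfl, rfl⟩ | ⟨rfl, rfl⟩ | ⟨rfl, rfl⟩ | ⟨rfl, rfl⟩ | ⟨rfl, rfl⟩ <;> decide
    have hne := om_exchange_ne T hT (b, c) hbc
    have hlin : ∀ b c, (B.count b = 0 ∨ B.count c = 0) → (B'.count b = 0 ∨ B'.count c = 0) →
        ε * ((B'.count b : ℤ) - B.count b) ≤ 0 ∨ ε * ((B'.count c : ℤ) - B.count c) ≤ 0 := by
      intro b c h1 h2
      rcases hε with rfl | rfl <;> omega
    cases hlt : Nat.blt (om T (b.1, c.2) + om T (c.1, b.2)) (om T b + om T c) with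
    | true =>
      have hlt : om T (b.1, c.2) + om T (c.1, b.2) < om T b + om T c := by simpa using hlt
      have hb : BadBase T (b.1, c.2) (c.1, b.2) := ⟨hle.2.2.2, hle.2.2.1, hlt⟩
      exact hlin _ _ (k _ _ hb) (k' _ _ hb)
    | false =>
      have hlt : ¬ om T (b.1, c.2) + om T (c.1, b.2) < om T b + om T c := by
        intro h
        rw [← Nat.blt_eq, hlt] at h
        exact Bool.false_ne_true h
      have hb : BadBase T b c := ⟨hle.1, hle.2.1, by simp only at hne; omega⟩
      exact hlin _ _ (k _ _ hb) (k' _ _ hb)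
  have hsign := table_sign hor (a := (B'.count (0,1) : ℤ) - B.count (0,1))
    (b := (B'.count (0,2) : ℤ) - B.count (0,2)) (c := (B'.count (0,3) : ℤ) - B.count (0,3))
    (d := (B'.count (1,1) : ℤ) - B.count (1,1)) (e := (B'.count (1,2) : ℤ) - B.count (1,2))
    (f := (B'.count (1,3) : ℤ) - B.count (1,3)) (g := (B'.count (2,2) : ℤ) - B.count (2,2))
    (h := (B'.count (2,3) : ℤ) - B.count (2,3))
    (fun ε hε => ⟨hdiag (0,1) (1,2) (by decide) ε hε, hdiag (0,1) (1,3) (by decide) ε hε,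
      hdiag (0,2) (1,3) (by decide) ε hε, hdiag (0,2) (2,3) (by decide) ε hε,
      hdiag (1,2) (2,3) (by decide) ε hε⟩)
    (by omega) (by omega) (by omega) (by omega) (by omega)
  clear hdiag k k'
  have hfin : ∀ p₀ p₁ p₂ q₀ q₁ q₂, TripleMove T p₀ p₁ p₂ q₀ q₁ q₂ →
      [p₀, p₁, p₂, q₀, q₁, q₂].Nodup → (∀ q ∈ [p₀, p₁, p₂, q₀, q₁, q₂], q ∈ bases) →
      ∀ k : ℤ, (∀ b ∈ bases, (B'.count b : ℤ) +
        k * ({p₀, p₁, p₂} : Multiset (ℕ × ℕ)).count b = B.count b +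
        k * ({q₀, q₁, q₂} : Multiset (ℕ × ℕ)).count b) → k = 0 := by
    intro p₀ p₁ p₂ q₀ q₁ q₂ hmove hd hq k hk
    have hq' : ∀ q ∈ [q₀, q₁, q₂], q ∈ bases := fun q h =>
      hq q (List.mem_append_right [p₀, p₁, p₂] h)
    have hadd : ∀ (C : Multiset (ℕ × ℕ)) (l : ℕ) (a b c : ℕ × ℕ), (∀ x ∈ C, x ∈ bases) → a ∈ bases →
        b ∈ bases → c ∈ bases → ∀ x ∈ C + l • {a, b, c}, x ∈ bases := by
      intro C l a b c hC ha hb hc x hx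
      rcases Multiset.mem_add.mp hx with h | h
      · exact hC x h
      · have := (Multiset.mem_nsmul.mp h).2
        simp only [Multiset.insert_eq_cons, Multiset.mem_cons, Multiset.mem_singleton] at this
        rcases this with rfl | rfl | rfl <;> assumption
    have hp0 := hq p₀ (by simp)
    have hp1 := hq p₁ (by simp)
    have hp2 := hq p₂ (by simp)
    have hq0 := hq q₀ (by simp)
    have hq1 := hq q₁ (by simp)
    have hq2 := hq q₂ (by simp)
    rcases lt_trichotomy k 0 with hk0 | hk0 | hk0
    · obtain ⟨l, rfl⟩ := Int.exists_eq_neg_ofNat hk0.le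
      refine absurd (reducible_of_add_eq hr hpair hmove hd hq' (hmark m' hm') hs.symm (k := l)
        (by omega) ?_) hm'
      refine ext_of_count (hadd _ _ _ _ _ hB hp0 hp1 hp2) (hadd _ _ _ _ _ hB' hq0 hq1 hq2)
        fun b hb => ?_
      have := hk b hb
      rw [Multiset.count_add, Multiset.count_add, Multiset.count_nsmul, Multiset.count_nsmul]
      zify
      linarith
    · exact hk0
    · obtain ⟨l, rfl⟩ := Int.eq_ofNat_of_zero_le hk0.le
      refine absurd (reducible_of_add_eq hr hpair hmove hd hq' (hmark m hm) hs (k := l)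
        (by omega) ?_) hm
      refine ext_of_count (hadd _ _ _ _ _ hB' hp0 hp1 hp2) (hadd _ _ _ _ _ hB hq0 hq1 hq2)
        fun b hb => ?_
      have := hk b hb
      rw [Multiset.count_add, Multiset.count_add, Multiset.count_nsmul, Multiset.count_nsmul]
      zify
      exact this
  have hzero : (B'.count (0,1) : ℤ) - B.count (0,1) = 0 ∧
      (B'.count (0,2) : ℤ) - B.count (0,2) = 0 ∧ (B'.count (2,2) : ℤ) - B.count (2,2) = 0 := by
    rcases hsign with h | ⟨h, hb, hg⟩ | ⟨h, hb, hg⟩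
    · exact h
    · have ha : (B'.count (0,1) : ℤ) - B.count (0,1) = 0 := by
        rcases tripleMove_of_orient_diag T hT h with h | h | h | h
        · have := hfin _ _ _ _ _ _ h (by decide) (by decide)
            (-((B'.count (0,1) : ℤ) - B.count (0,1)))
            (by simp [bases, Multiset.count_cons]; omega)
          omega
        · have := hfin _ _ _ _ _ _ h (by decide) (by decide)
            (-((B'.count (0,1) : ℤ) - B.count (0,1)))
            (by simp [bases, Multiset.count_cons]; omega)
          omega
        · exact hfin _ _ _ _ _ _ h (by decide) (by decide) _
            (by simp [bases, Multiset.count_cons]; omega)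
        · exact hfin _ _ _ _ _ _ h (by decide) (by decide) _
            (by simp [bases, Multiset.count_cons]; omega)
      omega
    · have ha : (B'.count (0,1) : ℤ) - B.count (0,1) = 0 := by
        rcases tripleMove_of_orient_anti T hT h with h | h | h | h
        · have := hfin _ _ _ _ _ _ h (by decide) (by decide)
            (-((B'.count (0,1) : ℤ) - B.count (0,1)))
            (by simp [bases, Multiset.count_cons]; omega)
          omega
        · have := hfin _ _ _ _ _ _ h (by decide) (by decide)
            (-((B'.count (0,1) : ℤ) - B.count (0,1)))
            (by simp [bases, Multiset.count_cons]; omega)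
          omega
        · exact hfin _ _ _ _ _ _ h (by decide) (by decide) _
            (by simp [bases, Multiset.count_cons]; omega)
        · exact hfin _ _ _ _ _ _ h (by decide) (by decide) _
            (by simp [bases, Multiset.count_cons]; omega)
      omega
  refine eq_of_bases_eq m m' (hmark m hm) (hmark m' hm') hs
    (ext_of_count hB hB' ?_)
  change ∀ b ∈ bases, B.count b = B'.count b
  simp only [bases, List.forall_mem_cons, List.not_mem_nil, IsEmpty.forall_iff, implies_true,
    and_true]
  omega

/-- Any two multisets with the same entries are connected by exchanges between two
elements. -/
theorem rel_of_sameMarg {T : ℕ × ℕ × ℕ} (hT : T ∈ triples)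
    {r : Multiset (Gen T) → Multiset (Gen T) → Prop} (hr : Equivalence r)
    (hmarg : ∀ m m', r m m' → SameMarg m m')
    (hpair : ∀ a b a' b' c, SameMarg {a, b} {a', b'} → r (a ::ₘ b ::ₘ c) (a' ::ₘ b' ::ₘ c))
    {m m' : Multiset (Gen T)} (h : SameMarg m m') : r m m' := by
  have hnf : ∀ (k : ℕ) (m : Multiset (Gen T)), 200000 * m.card - (m.map weight).sum ≤ k →
      ∃ m', r m m' ∧ ¬ Reducible r m' := by
    intro k
    induction k with
    | zero =>
      intro m hk
      refine ⟨m, hr.refl m, ?_⟩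
      rintro ⟨m', h1, h2⟩
      have := weight_sum_le m'
      rw [← (hmarg m m' h1).card] at this
      omega
    | succ k ih =>
      intro m hk
      by_cases hred : Reducible r m
      · obtain ⟨m', h1, h2⟩ := hred
        have := weight_sum_le m'
        rw [← (hmarg m m' h1).card] at this
        obtain ⟨m'', h3, h4⟩ := ih m' (by rw [← (hmarg m m' h1).card]; omega)
        exact ⟨m'', hr.trans h1 h3, h4⟩
      · exact ⟨m, hr.refl m, hred⟩
  obtain ⟨n, h1, h2⟩ := hnf _ m le_rfl
  obtain ⟨n', h3, h4⟩ := hnf _ m' le_rfl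
  have e1 := hmarg m n h1
  have e2 := hmarg m' n' h3
  have : n = n' := eq_of_not_reducible hT hr hpair h2 h4
    ⟨e1.1.symm.trans (h.1.trans e2.1), e1.2.1.symm.trans (h.2.1.trans e2.2.1),
      e1.2.2.symm.trans (h.2.2.trans e2.2.2)⟩
  exact hr.trans h1 (this ▸ hr.symm h3)

end Combinatorics

section Count

/-- The generators as a list. -/
def genList (T : ℕ × ℕ × ℕ) : List (ℕ × ℕ × ℕ) :=
  bases.flatMap fun b => ((List.range 4).filter fun s => Nat.ble s (rk T b)).map fun s => (s, b)

theorem mem_genList {T g : ℕ × ℕ × ℕ} : g ∈ genList T ↔ g.2 ∈ bases ∧ g.1 ≤ rk T g.2 := by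
  have := rk_le T g.2
  simp only [genList, List.mem_flatMap, List.mem_map, List.mem_filter, List.mem_range,
    Nat.ble_eq]
  constructor
  · rintro ⟨b, hb, s, ⟨-, hs⟩, rfl⟩
    exact ⟨hb, hs⟩
  · exact fun h => ⟨g.2, h.1, g.1, ⟨by omega, h.2⟩, rfl⟩

/-- Pairs of numbers at most three are determined by the sum of their codes. -/
def sidon (s : ℕ) : ℕ :=
  bif s.beq 0 then 0 else bif s.beq 1 then 1 else bif s.beq 2 then 4 else 6

/-- The code of a generator. -/
def code (g : ℕ × ℕ × ℕ) : ℕ := sidon g.1 + 13 * sidon g.2.1 + 169 * sidon g.2.2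

/-- The set of the sums of two elements of a list, as the set of binary digits of a number. -/
def pairMask (l : List ℕ) : ℕ :=
  (l.flatMap fun a => l.map fun b => a + b).foldr (fun k a => 2 ^ k ||| a) 0

theorem testBit_foldr (l : List ℕ) (k : ℕ) :
    (l.foldr (fun k a => 2 ^ k ||| a) 0).testBit k = decide (k ∈ l) := by
  induction l with
  | nil => simp
  | cons a l ih =>
    rw [List.foldr_cons, Nat.testBit_or, ih, Nat.testBit_two_pow]
    by_cases h : a = k
    · simp [h]
    · simp [h, Ne.symm h]

theorem exists_of_testBit_pairMask {l : List ℕ} {k : ℕ} (h : (pairMask l).testBit k) :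
    ∃ a ∈ l, ∃ b ∈ l, a + b = k := by
  rw [pairMask, testBit_foldr, decide_eq_true_eq] at h
  simpa using h

/-- The codes of pairs of bases. -/
def basePairCodes : List ℕ :=
  [0, 169, 182, 338, 351, 364, 676, 689, 728, 845, 858, 871, 897, 910, 1014, 1027, 1066,
   1092, 1183, 1196, 1209, 1235, 1248, 1261, 1274, 1352, 1365, 1378, 1404, 1417, 1456,
   1690, 1703, 1716, 1742, 1755, 1768, 1781, 1794, 1820, 2028, 2041, 2054, 2080, 2093,
   2106, 2119, 2132, 2158, 2184]

/-- The codes of pairs of generators. -/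
def pairCodes : List ℕ :=
  basePairCodes.flatMap fun c => [0, 1, 2, 4, 5, 6, 7, 8, 10, 12].map fun a => a + c

theorem nodup_pairCodes : pairCodes.Nodup := by
  have : pairCodes.IsChain (· < ·) := by decide +kernel
  exact (List.isChain_iff_pairwise.mp this).imp fun h => h.ne

set_option maxRecDepth 100000 in
theorem le_countP_pairMask : ∀ T ∈ triples,
    Nat.ble 175 (pairCodes.countP (pairMask ((genList T).map code)).testBit) := by
  decide +kernel

theorem card_image_le_of_factors {α β γ : Type*} [Fintype α] [DecidableEq β] [DecidableEq γ]
    {f : α → β} {g : α → γ} (h : ∀ a b, f a = f b → g a = g b) :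
    (Finset.univ.image g).card ≤ (Finset.univ.image f).card := by
  classical
  cases isEmpty_or_nonempty γ with
  | inl hγ =>
    have : IsEmpty α := ⟨fun a => hγ.elim (g a)⟩
    simp
  | inr hγ =>
    have : Finset.univ.image g =
        (Finset.univ.image f).image (Function.extend f g fun _ => Classical.arbitrary γ) := by
      rw [Finset.image_image]
      refine Finset.image_congr fun a _ => ?_
      exact (Function.FactorsThrough.extend_apply (fun a b hab => h a b hab) _ a).symm
    rw [this]
    exact Finset.card_image_le

instance (T : ℕ × ℕ × ℕ) : Fintype (Gen T) :=
  Fintype.subtype (genList T).toFinset fun g => by rw [List.mem_toFinset, mem_genList]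

theorem le_card_image_code {T : ℕ × ℕ × ℕ} (hT : T ∈ triples) :
    175 ≤ (Finset.univ.image fun p : Gen T × Gen T => code p.1.1 + code p.2.1).card := by
  have h := Nat.le_of_ble_eq_true (le_countP_pairMask T hT)
  rw [List.countP_eq_length_filter] at h
  refine h.trans ?_
  rw [← List.toFinset_card_of_nodup (nodup_pairCodes.filter _)]
  refine Finset.card_le_card fun k hk => ?_
  rw [List.mem_toFinset, List.mem_filter] at hk
  obtain ⟨a, ha, b, hb, rfl⟩ := exists_of_testBit_pairMask hk.2
  obtain ⟨x, hx, rfl⟩ := List.mem_map.mp ha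
  obtain ⟨y, hy, rfl⟩ := List.mem_map.mp hb
  exact Finset.mem_image.mpr ⟨(⟨x, mem_genList.mp hx⟩, ⟨y, mem_genList.mp hy⟩),
    Finset.mem_univ _, rfl⟩

theorem SameMarg.code_add {T : ℕ × ℕ × ℕ} {a b a' b' : Gen T} (h : SameMarg {a, b} {a', b'}) :
    code a.1 + code b.1 = code a'.1 + code b'.1 := by
  have key : ∀ f : Gen T → ℕ, Multiset.map f {a, b} = Multiset.map f {a', b'} →
      sidon (f a) + sidon (f b) = sidon (f a') + sidon (f b') := by
    intro f hf
    simpa using congrArg (fun m => (m.map sidon).sum) hf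
  have h1 := key _ h.1
  have h2 := key _ h.2.1
  have h3 := key _ h.2.2
  unfold code
  omega

end Count

section Connect

/-- The exponent of the variable `p v`, or zero for the value `v₀`. -/
def unitExp {σ : Type*} (v₀ : ℕ) (p : ℕ → σ) (v : ℕ) : σ →₀ ℕ :=
  if v = v₀ then 0 else Finsupp.single (p v) 1

theorem sum_unitExp_apply {σ ι : Type*} {v₀ : ℕ} {p : ℕ → σ} {f : ι → ℕ} {N v : ℕ}
    (hp : ∀ v ≤ N, ∀ w ≤ N, v ≠ v₀ → w ≠ v₀ → p v = p w → v = w) (hf : ∀ g, f g ≤ N)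
    (hv : v ≤ N) (hv₀ : v ≠ v₀) (m : Multiset ι) :
    (m.map fun g => unitExp v₀ p (f g)).sum (p v) = (m.map f).count v := by
  classical
  induction m using Multiset.induction_on with
  | empty => simp
  | cons a m ih =>
    rw [Multiset.map_cons, Multiset.sum_cons, Finsupp.add_apply, ih, Multiset.map_cons,
      Multiset.count_cons, add_comm, unitExp]
    congr 1
    by_cases h : f a = v₀
    · rw [if_pos h, if_neg (by rintro rfl; exact hv₀ h), Finsupp.zero_apply]
    · rw [if_neg h, Finsupp.single_apply]
      by_cases h2 : v = f a
      · rw [if_pos h2, if_pos (by rw [h2])]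
      · rw [if_neg h2, if_neg fun h3 => h2 (hp v hv _ (hf a) hv₀ h h3.symm)]

theorem sum_unitExp_apply_eq_zero {σ ι : Type*} {v₀ : ℕ} {p : ℕ → σ} {f : ι → ℕ} {q : σ}
    (hq : ∀ v, p v ≠ q) (m : Multiset ι) :
    (m.map fun g => unitExp v₀ p (f g)).sum q = 0 := by
  classical
  induction m using Multiset.induction_on with
  | empty => simp
  | cons a m ih =>
    rw [Multiset.map_cons, Multiset.sum_cons, Finsupp.add_apply, ih, unitExp]
    split_ifs
    · simp
    · rw [Finsupp.single_apply, if_neg (hq _)]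

theorem eq_of_count_eq_of_ne {m m' : Multiset ℕ} {v₀ N : ℕ} (hm : ∀ v ∈ m, v ≤ N)
    (hm' : ∀ v ∈ m', v ≤ N) (hc : m.card = m'.card)
    (h : ∀ v ≤ N, v ≠ v₀ → m.count v = m'.count v) : m = m' := by
  have hne : ∀ v, v ≠ v₀ → m.count v = m'.count v := by
    intro v hv
    by_cases hN : v ≤ N
    · exact h v hN hv
    · rw [Multiset.count_eq_zero_of_notMem fun h => hN (hm v h),
        Multiset.count_eq_zero_of_notMem fun h => hN (hm' v h)]
  have hf : m.filter (fun v => ¬ v₀ = v) = m'.filter (fun v => ¬ v₀ = v) := by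
    ext v
    rw [Multiset.count_filter, Multiset.count_filter]
    split_ifs with hv
    exacts [rfl, hne v fun h => hv h.symm]
  ext v
  by_cases hv : v = v₀
  · subst hv
    have e := congrArg Multiset.card (Multiset.filter_add_not (v = ·) m)
    have e' := congrArg Multiset.card (Multiset.filter_add_not (v = ·) m')
    rw [Multiset.card_add] at e e'
    have hf' := congrArg Multiset.card hf
    simp only [Multiset.count, Multiset.countP_eq_card_filter]
    omega
  · exact hne v hv

variable {σ : Type*} {T : ℕ × ℕ × ℕ} {E : Gen T → σ →₀ ℕ} {v₀ : ℕ} {p₁ p₂ p₃ : ℕ → σ}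

/-- The exponent of a generator records its three entries independently. -/
structure IsExp (E : Gen T → σ →₀ ℕ) (v₀ : ℕ) (p₁ p₂ p₃ : ℕ → σ) : Prop where
  eq : ∀ g : Gen T, E g = unitExp 0 p₁ g.1.1 + unitExp 0 p₂ g.1.2.1 + unitExp v₀ p₃ g.1.2.2
  inj₁ : ∀ v ≤ 3, ∀ w ≤ 3, v ≠ 0 → w ≠ 0 → p₁ v = p₁ w → v = w
  inj₂ : ∀ v ≤ 3, ∀ w ≤ 3, v ≠ 0 → w ≠ 0 → p₂ v = p₂ w → v = w
  inj₃ : ∀ v ≤ 3, ∀ w ≤ 3, v ≠ v₀ → w ≠ v₀ → p₃ v = p₃ w → v = w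
  ne₁₂ : ∀ v w, p₁ v ≠ p₂ w
  ne₁₃ : ∀ v w, p₁ v ≠ p₃ w
  ne₂₃ : ∀ v w, p₂ v ≠ p₃ w

theorem IsExp.sum_eq (h : IsExp E v₀ p₁ p₂ p₃) (m : Multiset (Gen T)) :
    (m.map E).sum = (m.map fun g => unitExp 0 p₁ g.1.1).sum +
      (m.map fun g => unitExp 0 p₂ g.1.2.1).sum + (m.map fun g => unitExp v₀ p₃ g.1.2.2).sum := by
  rw [← Multiset.sum_map_add, ← Multiset.sum_map_add]
  exact congrArg Multiset.sum (Multiset.map_congr rfl fun g _ => h.eq g)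

theorem IsExp.sameMarg_iff (h : IsExp E v₀ p₁ p₂ p₃) {m m' : Multiset (Gen T)} :
    SameMarg m m' ↔ m.card = m'.card ∧ (m.map E).sum = (m'.map E).sum := by
  have h1 : ∀ g : Gen T, g.1.1 ≤ 3 := fun g => g.2.2.trans (rk_le _ _)
  have h2 : ∀ g : Gen T, g.1.2.1 ≤ 3 := fun g => by
    have := le_three_of_mem_bases g.2.1
    omega
  have h3 : ∀ g : Gen T, g.1.2.2 ≤ 3 := fun g => (le_three_of_mem_bases g.2.1).2
  have hle : ∀ (f : Gen T → ℕ) (hf : ∀ g, f g ≤ 3) (m : Multiset (Gen T)), ∀ v ∈ m.map f,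
      v ≤ 3 := by
    intro f hf m v hv
    obtain ⟨g, -, rfl⟩ := Multiset.mem_map.mp hv
    exact hf g
  constructor
  · intro hm
    refine ⟨hm.card, ?_⟩
    have key : ∀ (f : Gen T → ℕ) (u : ℕ → σ →₀ ℕ), m.map f = m'.map f →
        (m.map fun g => u (f g)).sum = (m'.map fun g => u (f g)).sum := by
      intro f u hf
      simpa [Multiset.map_map] using congrArg (fun m => (m.map u).sum) hf
    rw [h.sum_eq, h.sum_eq, key _ (unitExp 0 p₁) hm.1, key _ (unitExp 0 p₂) hm.2.1,
      key _ (unitExp v₀ p₃) hm.2.2]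
  · rintro ⟨hc, hs⟩
    rw [h.sum_eq, h.sum_eq] at hs
    refine ⟨eq_of_count_eq_of_ne (v₀ := 0) (hle _ h1 m) (hle _ h1 m') (by simpa) ?_,
      eq_of_count_eq_of_ne (v₀ := 0) (hle _ h2 m) (hle _ h2 m') (by simpa) ?_,
      eq_of_count_eq_of_ne (v₀ := v₀) (hle _ h3 m) (hle _ h3 m') (by simpa) ?_⟩
    · intro v hv hv0
      have := DFunLike.congr_fun hs (p₁ v)
      simp only [Finsupp.add_apply] at this
      rwa [sum_unitExp_apply h.inj₁ h1 hv hv0, sum_unitExp_apply h.inj₁ h1 hv hv0,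
        sum_unitExp_apply_eq_zero (fun w => (h.ne₁₂ v w).symm),
        sum_unitExp_apply_eq_zero (fun w => (h.ne₁₂ v w).symm),
        sum_unitExp_apply_eq_zero (fun w => (h.ne₁₃ v w).symm),
        sum_unitExp_apply_eq_zero (fun w => (h.ne₁₃ v w).symm)] at this
    · intro v hv hv0
      have := DFunLike.congr_fun hs (p₂ v)
      simp only [Finsupp.add_apply] at this
      rw [sum_unitExp_apply h.inj₂ h2 hv hv0, sum_unitExp_apply h.inj₂ h2 hv hv0,
        sum_unitExp_apply_eq_zero (fun w => h.ne₁₂ w v),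
        sum_unitExp_apply_eq_zero (fun w => h.ne₁₂ w v),
        sum_unitExp_apply_eq_zero (fun w => (h.ne₂₃ v w).symm),
        sum_unitExp_apply_eq_zero (fun w => (h.ne₂₃ v w).symm)] at this
      omega
    · intro v hv hv0
      have := DFunLike.congr_fun hs (p₃ v)
      simp only [Finsupp.add_apply] at this
      rw [sum_unitExp_apply h.inj₃ h3 hv hv0, sum_unitExp_apply h.inj₃ h3 hv hv0,
        sum_unitExp_apply_eq_zero (fun w => h.ne₁₃ w v),
        sum_unitExp_apply_eq_zero (fun w => h.ne₁₃ w v),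
        sum_unitExp_apply_eq_zero (fun w => h.ne₂₃ w v),
        sum_unitExp_apply_eq_zero (fun w => h.ne₂₃ w v)] at this
      omega

/-- Products of generators with the same number of factors and the same lead exponent are
equivalent. -/
theorem IsExp.leadEquiv {Γ : Type*} [AddCommGroup Γ] [LinearOrder Γ] [IsOrderedAddMonoid Γ]
    {key : (σ →₀ ℕ) →+ Γ} (hT : T ∈ triples) (h : IsExp E v₀ p₁ p₂ p₃)
    {Q : Gen T → MvPolynomial σ ℂ} (hQ : ∀ g, IsLead key (Q g) (E g))
    (hfin : Module.finrank ℂ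
      (Submodule.span ℂ (Set.range fun p : Gen T × Gen T => Q p.1 * Q p.2)) ≤ 175)
    {m m' : Multiset (Gen T)} (hc : m.card = m'.card) (hs : (m.map E).sum = (m'.map E).sum) :
    LeadEquiv key Q E m m' := by
  classical
  have hfin' := hfin.trans ((le_card_image_code hT).trans (card_image_le_of_factors
    (f := fun p : Gen T × Gen T => E p.1 + E p.2) fun a b hab =>
      SameMarg.code_add (h.sameMarg_iff.mpr ⟨rfl, by simpa using hab⟩)))
  refine rel_of_sameMarg hT (leadEquiv_equivalence Q E)
    (fun m m' hm => h.sameMarg_iff.mpr ⟨hm.1, hm.2.1⟩) (fun a b a' b' c hab => ?_)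
    (h.sameMarg_iff.mpr ⟨hc, hs⟩)
  exact leadEquiv_pair hQ hfin' a b a' b' c (by simpa using (h.sameMarg_iff.mp hab).2)

end Connect

section Straightening

variable {R : Type*} [CommRing R]

/-- The minor of a matrix with three rows on the columns `a, b, c`. -/
def minor (M : ℕ → Fin 3 → R) (a b c : ℕ) : R :=
  Matrix.det (Matrix.of fun r s : Fin 3 => M (![a, b, c] s) r)

theorem minor_eq (M : ℕ → Fin 3 → R) (a b c : ℕ) : minor M a b c =
    M a 0 * (M b 1 * M c 2 - M b 2 * M c 1) - M a 1 * (M b 0 * M c 2 - M b 2 * M c 0) +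
      M a 2 * (M b 0 * M c 1 - M b 1 * M c 0) := by
  simp only [minor, Matrix.det_fin_three, Matrix.of_apply, Matrix.cons_val_zero,
    Matrix.cons_val_one, Matrix.cons_val]
  ring

/-- The span of the products of two minors whose columns form a standard tableau. -/
def standardSpan [Algebra ℂ R] (M : ℕ → Fin 3 → R) : Submodule ℂ R :=
  Submodule.span ℂ {g | ∃ a b c x y z, a < b ∧ b < c ∧ x < y ∧ y < z ∧ z ≤ 5 ∧
    a ≤ x ∧ b ≤ y ∧ c ≤ z ∧ g = minor M a b c * minor M x y z}

theorem mul_minor_mem_of_le [Algebra ℂ R] (M : ℕ → Fin 3 → R) {a b c x y z : ℕ} (h₁ : a < b)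
    (h₂ : b < c) (h₃ : x < y) (h₄ : y < z) (h₅ : z ≤ 5) (h₆ : a ≤ x) (h₇ : b ≤ y) (h₈ : c ≤ z) :
    minor M a b c * minor M x y z ∈ standardSpan M :=
  Submodule.subset_span ⟨a, b, c, x, y, z, h₁, h₂, h₃, h₄, h₅, h₆, h₇, h₈, rfl⟩

/-- The strictly increasing triples of numbers at most five. -/
def incTriples : List (ℕ × ℕ × ℕ) :=
  ((List.range 6).flatMap fun i => (List.range 6).flatMap fun j =>
    (List.range 6).map fun k => (i, j, k)).filter
      fun T => Nat.blt T.1 T.2.1 && Nat.blt T.2.1 T.2.2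

theorem mem_incTriples {a b c : ℕ} (h₁ : a < b) (h₂ : b < c) (h₃ : c ≤ 5) :
    (a, b, c) ∈ incTriples := by
  simp only [incTriples, List.mem_filter, List.mem_flatMap, List.mem_map, List.mem_range,
    Prod.mk.injEq, Bool.and_eq_true, Nat.blt_eq]
  exact ⟨⟨a, by omega, b, by omega, c, by omega, rfl, rfl, rfl⟩, h₁, h₂⟩

theorem lt_of_mem_incTriples :
    ∀ {A}, A ∈ incTriples → A.1 < A.2.1 ∧ A.2.1 < A.2.2 ∧ A.2.2 ≤ 5 := by
  have h : ∀ A ∈ incTriples, A.1 < A.2.1 ∧ A.2.1 < A.2.2 ∧ A.2.2 ≤ 5 := by decide +kernel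
  exact fun {A} hA => h A hA

/-- The standard tableaux with two rows of length three. -/
def standardPairs : List ((ℕ × ℕ × ℕ) × (ℕ × ℕ × ℕ)) :=
  (incTriples.flatMap fun A => incTriples.map fun B => (A, B)).filter
    fun p => Nat.ble p.1.1 p.2.1 && Nat.ble p.1.2.1 p.2.2.1 && Nat.ble p.1.2.2 p.2.2.2

theorem length_standardPairs : standardPairs.length = 175 := by decide +kernel

theorem standardSpan_le [Algebra ℂ R] (M : ℕ → Fin 3 → R) [DecidableEq R] :
    standardSpan M ≤ Submodule.span ℂ ((standardPairs.map fun p =>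
      minor M p.1.1 p.1.2.1 p.1.2.2 * minor M p.2.1 p.2.2.1 p.2.2.2).toFinset : Set R) := by
  refine Submodule.span_mono ?_
  rintro _ ⟨a, b, c, x, y, z, h₁, h₂, h₃, h₄, h₅, h₆, h₇, h₈, rfl⟩
  rw [Finset.mem_coe, List.mem_toFinset, List.mem_map]
  refine ⟨((a, b, c), (x, y, z)), ?_, rfl⟩
  simp only [standardPairs, List.mem_filter, List.mem_flatMap, List.mem_map, Prod.mk.injEq,
    Bool.and_eq_true, Nat.ble_eq]
  exact ⟨⟨_, mem_incTriples h₁ h₂ (h₈.trans h₅), _, mem_incTriples h₃ h₄ h₅, rfl, rfl⟩,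
    ⟨h₆, h₇⟩, h₈⟩

/-- The pairs of triples with one common element whose other elements are nested. -/
def Nested (a b c x y z : ℕ) : Prop :=
  a = x ∧ b < y ∧ z < c ∨ b = x ∧ z < c ∨ b = y ∧ a < x ∧ z < c ∨
    b = z ∧ a < x ∨ c = z ∧ a < x ∧ y < b

instance (a b c x y z : ℕ) : Decidable (Nested a b c x y z) := by
  unfold Nested; infer_instance

theorem mul_minor_mem_of_nested [Algebra ℂ R] (M : ℕ → Fin 3 → R) {a b c x y z : ℕ}
    (h₁ : a < b) (h₂ : b < c) (h₃ : x < y) (h₄ : y < z) (h₅ : c ≤ 5) (h₆ : z ≤ 5)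
    (h : Nested a b c x y z) : minor M a b c * minor M x y z ∈ standardSpan M := by
  rcases h with ⟨rfl, h, h'⟩ | ⟨rfl, h⟩ | ⟨rfl, h, h'⟩ | ⟨rfl, h⟩ | ⟨rfl, h, h'⟩
  · rw [show minor M a b c * minor M a y z =
      minor M a b z * minor M a y c - minor M a b y * minor M a z c by simp only [minor_eq]; ring]
    exact Submodule.sub_mem _ (mul_minor_mem_of_le M (by omega) (by omega) (by omega) (by omega)
      (by omega) (by omega) (by omega) (by omega)) (mul_minor_mem_of_le M (by omega) (by omega)
      (by omega) (by omega) (by omega) (by omega) (by omega) (by omega))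
  · rw [show minor M a b c * minor M b y z =
      minor M a b z * minor M b y c - minor M a b y * minor M b z c by simp only [minor_eq]; ring]
    exact Submodule.sub_mem _ (mul_minor_mem_of_le M (by omega) (by omega) (by omega) (by omega)
      (by omega) (by omega) (by omega) (by omega)) (mul_minor_mem_of_le M (by omega) (by omega)
      (by omega) (by omega) (by omega) (by omega) (by omega) (by omega))
  · rw [show minor M a b c * minor M x b z =
      minor M a b z * minor M x b c - minor M a x b * minor M b z c by simp only [minor_eq]; ring]
    exact Submodule.sub_mem _ (mul_minor_mem_of_le M (by omega) (by omega) (by omega) (by omega)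
      (by omega) (by omega) (by omega) (by omega)) (mul_minor_mem_of_le M (by omega) (by omega)
      (by omega) (by omega) (by omega) (by omega) (by omega) (by omega))
  · rw [show minor M a b c * minor M x y b =
      minor M a y b * minor M x b c - minor M a x b * minor M y b c by simp only [minor_eq]; ring]
    exact Submodule.sub_mem _ (mul_minor_mem_of_le M (by omega) (by omega) (by omega) (by omega)
      (by omega) (by omega) (by omega) (by omega)) (mul_minor_mem_of_le M (by omega) (by omega)
      (by omega) (by omega) (by omega) (by omega) (by omega) (by omega))
  · rw [show minor M a b c * minor M x y c =
      minor M a y c * minor M x b c - minor M a x c * minor M y b c by simp only [minor_eq]; ring]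
    exact Submodule.sub_mem _ (mul_minor_mem_of_le M (by omega) (by omega) (by omega) (by omega)
      (by omega) (by omega) (by omega) (by omega)) (mul_minor_mem_of_le M (by omega) (by omega)
      (by omega) (by omega) (by omega) (by omega) (by omega) (by omega))

section

variable (M : ℕ → Fin 3 → R) (a b c d e f : ℕ)

theorem minor_straighten₁ : minor M a b f * minor M c d e =
    minor M a b c * minor M d e f - minor M a b d * minor M c e f +
      minor M a b e * minor M c d f := by
  simp only [minor_eq]; ring

theorem minor_straighten₂ : minor M a c f * minor M b d e =
    minor M a c e * minor M b d f -
      (minor M a b c * minor M d e f + minor M a c d * minor M b e f) := by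
  simp only [minor_eq]; ring

theorem minor_straighten₃ : minor M a d e * minor M b c f =
    minor M a b d * minor M c e f + minor M a c e * minor M b d f -
      (minor M a b c * minor M d e f + (minor M a b e * minor M c d f +
        minor M a c d * minor M b e f)) := by
  simp only [minor_eq]; ring

theorem minor_straighten₄ : minor M a d f * minor M b c e =
    minor M a c e * minor M b d f -
      (minor M a b c * minor M d e f + minor M a b e * minor M c d f) := by
  simp only [minor_eq]; ring

theorem minor_straighten₅ : minor M a e f * minor M b c d =
    minor M a b c * minor M d e f - minor M a b d * minor M c e f +
      minor M a c d * minor M b e f := by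
  simp only [minor_eq]; ring

end

theorem mul_minor_mem_of_compl [Algebra ℂ R] (M : ℕ → Fin 3 → R) {A : (ℕ × ℕ × ℕ) × (ℕ × ℕ × ℕ)}
    (h : A ∈ [((0,1,5),(2,3,4)), ((0,2,5),(1,3,4)), ((0,3,4),(1,2,5)), ((0,3,5),(1,2,4)),
      ((0,4,5),(1,2,3))]) :
    minor M A.1.1 A.1.2.1 A.1.2.2 * minor M A.2.1 A.2.2.1 A.2.2.2 ∈ standardSpan M := by
  have s₁ : minor M 0 1 2 * minor M 3 4 5 ∈ standardSpan M := by
    apply mul_minor_mem_of_le <;> norm_num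
  have s₂ : minor M 0 1 3 * minor M 2 4 5 ∈ standardSpan M := by
    apply mul_minor_mem_of_le <;> norm_num
  have s₃ : minor M 0 1 4 * minor M 2 3 5 ∈ standardSpan M := by
    apply mul_minor_mem_of_le <;> norm_num
  have s₄ : minor M 0 2 3 * minor M 1 4 5 ∈ standardSpan M := by
    apply mul_minor_mem_of_le <;> norm_num
  have s₅ : minor M 0 2 4 * minor M 1 3 5 ∈ standardSpan M := by
    apply mul_minor_mem_of_le <;> norm_num
  simp only [List.mem_cons, List.not_mem_nil, or_false] at h
  rcases h with rfl | rfl | rfl | rfl | rfl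
  · exact minor_straighten₁ M 0 1 2 3 4 5 ▸ Submodule.add_mem _ (Submodule.sub_mem _ s₁ s₂) s₃
  · exact minor_straighten₂ M 0 1 2 3 4 5 ▸ Submodule.sub_mem _ s₅ (Submodule.add_mem _ s₁ s₄)
  · exact minor_straighten₃ M 0 1 2 3 4 5 ▸ Submodule.sub_mem _ (Submodule.add_mem _ s₂ s₅)
      (Submodule.add_mem _ s₁ (Submodule.add_mem _ s₃ s₄))
  · exact minor_straighten₄ M 0 1 2 3 4 5 ▸ Submodule.sub_mem _ s₅ (Submodule.add_mem _ s₁ s₃)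
  · exact minor_straighten₅ M 0 1 2 3 4 5 ▸ Submodule.add_mem _ (Submodule.sub_mem _ s₁ s₂) s₄

/-- The product of two minors is a combination of standard products. -/
theorem mul_minor_mem_standardSpan [Algebra ℂ R] (M : ℕ → Fin 3 → R) {A B : ℕ × ℕ × ℕ}
    (hA : A ∈ incTriples) (hB : B ∈ incTriples) :
    minor M A.1 A.2.1 A.2.2 * minor M B.1 B.2.1 B.2.2 ∈ standardSpan M := by
  have hcases : ∀ A ∈ incTriples, ∀ B ∈ incTriples,
      (A.1 ≤ B.1 ∧ A.2.1 ≤ B.2.1 ∧ A.2.2 ≤ B.2.2) ∨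
      Nested A.1 A.2.1 A.2.2 B.1 B.2.1 B.2.2 ∨
      (A, B) ∈ [((0,1,5),(2,3,4)), ((0,2,5),(1,3,4)), ((0,3,4),(1,2,5)), ((0,3,5),(1,2,4)),
        ((0,4,5),(1,2,3))] ∨
      (B.1 ≤ A.1 ∧ B.2.1 ≤ A.2.1 ∧ B.2.2 ≤ A.2.2) ∨
      Nested B.1 B.2.1 B.2.2 A.1 A.2.1 A.2.2 ∨
      (B, A) ∈ [((0,1,5),(2,3,4)), ((0,2,5),(1,3,4)), ((0,3,4),(1,2,5)), ((0,3,5),(1,2,4)),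
        ((0,4,5),(1,2,3))] := by decide +kernel
  obtain ⟨a1, a2, a3⟩ := lt_of_mem_incTriples hA
  obtain ⟨b1, b2, b3⟩ := lt_of_mem_incTriples hB
  rcases hcases A hA B hB with h | h | h | h | h | h
  · exact mul_minor_mem_of_le M a1 a2 b1 b2 b3 h.1 h.2.1 h.2.2
  · exact mul_minor_mem_of_nested M a1 a2 b1 b2 a3 b3 h
  · exact mul_minor_mem_of_compl M (A := (_, _)) h
  all_goals rw [mul_comm]
  · exact mul_minor_mem_of_le M b1 b2 a1 a2 a3 h.1 h.2.1 h.2.2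
  · exact mul_minor_mem_of_nested M b1 b2 a1 a2 b3 a3 h
  · exact mul_minor_mem_of_compl M (A := (_, _)) h

theorem finrank_span_mul_minor_le [Algebra ℂ R] (M : ℕ → Fin 3 → R) {ι : Type*}
    (l : ι → ℕ × ℕ × ℕ) (hl : ∀ i, l i ∈ incTriples) :
    Module.finrank ℂ (Submodule.span ℂ (Set.range fun p : ι × ι =>
      minor M (l p.1).1 (l p.1).2.1 (l p.1).2.2 *
        minor M (l p.2).1 (l p.2).2.1 (l p.2).2.2)) ≤ 175 := by
  classical
  have hle : Submodule.span ℂ (Set.range fun p : ι × ι =>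
      minor M (l p.1).1 (l p.1).2.1 (l p.1).2.2 *
        minor M (l p.2).1 (l p.2).2.1 (l p.2).2.2) ≤ _ :=
    le_trans (by
      rw [Submodule.span_le]
      rintro _ ⟨p, rfl⟩
      exact mul_minor_mem_standardSpan M (hl p.1) (hl p.2)) (standardSpan_le M)
  have := Submodule.finrank_mono hle
  refine this.trans ((finrank_span_finset_le_card _).trans ((List.toFinset_card_le _).trans ?_))
  rw [List.length_map, length_standardPairs]

end Straightening

section LexLead

/-- The group in which the keys of exponents of the sequence `S` live. -/
abbrev KeyGroup (S : List (ℕ × ℕ)) : Type := Lex (Fin (S.length + 1) → ℤ)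

theorem Psi_add (a b : ℕ × ℕ →₀ ℕ) : Psi (a + b) = Psi a + Psi b := by
  classical
  exact Finsupp.sum_add_index' (by simp) (by intros; ring)

theorem Psi_zero : Psi 0 = 0 := Finsupp.sum_zero_index

theorem Psi_single (β : ℕ × ℕ) : Psi (Finsupp.single β 1) = Ht β := by
  rw [Psi, Finsupp.sum_single_index] <;> simp

/-- The additive map realizing the weighted reverse lexicographic order. -/
def psiKey (S : List (ℕ × ℕ)) : (ℕ × ℕ →₀ ℕ) →+ KeyGroup S where
  toFun d := toLex (Fin.cons (Psi d : ℤ) fun k => -(d (S.getD k (0, 0)) : ℤ))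
  map_zero' := by
    refine congrArg toLex (funext fun i => ?_)
    cases i using Fin.cases <;> simp [Psi_zero]
  map_add' a b := by
    refine congrArg toLex (funext fun i => ?_)
    cases i using Fin.cases <;> simp [Psi_add]
    ring

theorem psiKey_succ (S : List (ℕ × ℕ)) (d : ℕ × ℕ →₀ ℕ) (k : Fin S.length) :
    psiKey S d k.succ = -(d (S.getD k (0, 0)) : ℤ) := rfl

theorem psiKey_lt_iff {S : List (ℕ × ℕ)} {a b : ℕ × ℕ →₀ ℕ} :
    psiKey S a < psiKey S b ↔ psiLT S a b := by
  constructor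
  · rintro ⟨i, hi, hlt⟩
    cases i using Fin.cases with
    | zero =>
      exact Or.inl (Int.ofNat_lt.mp hlt)
    | succ k =>
      refine Or.inr ⟨Int.ofNat_inj.mp (hi 0 (Fin.succ_pos k)), k, k.2, fun m hm => ?_, ?_⟩
      · have := hi (Fin.succ ⟨m, hm.trans k.2⟩) (Fin.succ_lt_succ_iff.mpr hm)
        change -(a (S.getD m (0, 0)) : ℤ) = -(b (S.getD m (0, 0)) : ℤ) at this
        omega
      · change -(a (S.getD k (0, 0)) : ℤ) < -(b (S.getD k (0, 0)) : ℤ) at hlt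
        omega
  · rintro (h | ⟨h, k, hk, he, hlt⟩)
    · exact ⟨0, fun j hj => absurd hj (Fin.not_lt_zero j), by
        change (Psi a : ℤ) < Psi b
        exact_mod_cast h⟩
    · refine ⟨Fin.succ ⟨k, hk⟩, fun j hj => ?_, ?_⟩
      · cases j using Fin.cases with
        | zero =>
          change (Psi a : ℤ) = Psi b
          exact_mod_cast h
        | succ m =>
          have := he m (Fin.succ_lt_succ_iff.mp hj)
          change -(a (S.getD m (0, 0)) : ℤ) = -(b (S.getD m (0, 0)) : ℤ)
          rw [this]
      · change -(a (S.getD k (0, 0)) : ℤ) < -(b (S.getD k (0, 0)) : ℤ)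
        omega

theorem psiLE.psiKey_le {S : List (ℕ × ℕ)} {a b : ℕ × ℕ →₀ ℕ} (h : psiLE S a b) :
    psiKey S a ≤ psiKey S b := by
  rcases h with h | ⟨h, h' | h'⟩
  · exact (psiKey_lt_iff.mpr (Or.inl h)).le
  · exact (psiKey_lt_iff.mpr (Or.inr ⟨h, h'⟩)).le
  · refine le_of_eq (congrArg toLex (funext fun i => ?_))
    cases i using Fin.cases with
    | zero => simp [h]
    | succ k => simp only [Fin.cons_succ, h' k k.2]

theorem psiLE_of_psiKey_lt {S : List (ℕ × ℕ)} {a b : ℕ × ℕ →₀ ℕ} (h : psiKey S a < psiKey S b) :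
    psiLE S a b :=
  (psiKey_lt_iff.mp h).imp_right fun h => ⟨h.1, Or.inl h.2⟩

theorem eq_of_psiKey_eq {S : List (ℕ × ℕ)} {a b : ℕ × ℕ →₀ ℕ} (ha : ∀ β ∉ S, a β = 0)
    (hb : ∀ β ∉ S, b β = 0) (h : psiKey S a = psiKey S b) : a = b := by
  ext β
  by_cases hβ : β ∈ S
  · obtain ⟨k, hk, rfl⟩ := List.getElem_of_mem hβ
    have : psiKey S a (Fin.succ ⟨k, hk⟩) = psiKey S b (Fin.succ ⟨k, hk⟩) := by rw [h]
    rw [psiKey_succ, psiKey_succ, List.getD_eq_getElem _ _ hk] at this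
    omega
  · rw [ha β hβ, hb β hβ]

theorem IsLead.minSupp_eq {S : List (ℕ × ℕ)} {g : MvPolynomial (ℕ × ℕ) ℂ} {e : ℕ × ℕ →₀ ℕ}
    (h : IsLead (psiKey S) g e) : minSupp S g = e := by
  have hex : ∃ m ∈ g.support, ∀ m' ∈ g.support, psiLE S m m' := by
    refine ⟨e, mem_support_iff.mpr h.1, fun m' hm' => ?_⟩
    by_cases hne : m' = e
    · subst hne
      exact Or.inr ⟨rfl, Or.inr fun _ _ => rfl⟩
    · exact psiLE_of_psiKey_lt (h.2 m' hm' hne)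
  rw [minSupp, dif_pos hex]
  by_contra hne
  exact absurd (hex.choose_spec.2 e (mem_support_iff.mpr h.1)).psiKey_le
    (not_le.mpr (h.2 _ hex.choose_spec.1 hne))

theorem IsLead.of_neg {σ Γ : Type*} [AddCommGroup Γ] [LinearOrder Γ] {key : (σ →₀ ℕ) →+ Γ}
    {g : MvPolynomial σ ℂ} {e : σ →₀ ℕ} (h : IsLead key (-g) e) : IsLead key g e :=
  ⟨by simpa using h.1, fun m hm => h.2 m (by simpa using hm)⟩

theorem lexLT_cons {β : ℕ × ℕ} {L : List (ℕ × ℕ)} {a b : ℕ × ℕ →₀ ℕ} :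
    lexLT (β :: L) a b ↔ a β < b β ∨ a β = b β ∧ lexLT L a b := by
  constructor
  · rintro ⟨k, hk, he, hlt⟩
    cases k with
    | zero => exact Or.inl hlt
    | succ k =>
      exact Or.inr ⟨he 0 (Nat.succ_pos k), k, by simpa using hk,
        fun m hm => he (m + 1) (Nat.succ_lt_succ hm), hlt⟩
  · rintro (h | ⟨h, k, hk, he, hlt⟩)
    · exact ⟨0, by simp, by simp, h⟩
    · refine ⟨k + 1, by simpa using hk, fun m hm => ?_, hlt⟩
      cases m with
      | zero => exact h
      | succ m => exact he m (Nat.lt_of_succ_lt_succ hm)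

theorem lexLT.add_right {L : List (ℕ × ℕ)} {a b : ℕ × ℕ →₀ ℕ} (h : lexLT L a b)
    (c : ℕ × ℕ →₀ ℕ) : lexLT L (a + c) (b + c) := by
  obtain ⟨k, hk, he, hlt⟩ := h
  exact ⟨k, hk, fun m hm => by rw [Finsupp.add_apply, Finsupp.add_apply, he m hm],
    by rw [Finsupp.add_apply, Finsupp.add_apply]; omega⟩

/-- `e` is the lexicographically greatest exponent of `g`, the variables being ordered as in
`L`. -/
def LexLead (L : List (ℕ × ℕ)) (g : MvPolynomial (ℕ × ℕ) ℂ) (e : ℕ × ℕ →₀ ℕ) : Prop :=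
  g.coeff e ≠ 0 ∧ ∀ m ∈ g.support, m ≠ e → lexLT L m e

theorem LexLead.neg {L : List (ℕ × ℕ)} {g : MvPolynomial (ℕ × ℕ) ℂ} {e : ℕ × ℕ →₀ ℕ}
    (h : LexLead L g e) : LexLead L (-g) e :=
  ⟨by simpa using h.1, fun m hm => h.2 m (by simpa using hm)⟩

theorem LexLead.monomial (L : List (ℕ × ℕ)) (e : ℕ × ℕ →₀ ℕ) :
    LexLead L (MvPolynomial.monomial e (1 : ℂ)) e := by
  classical
  refine ⟨by simp, fun m hm hne => absurd ?_ hne⟩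
  rw [mem_support_iff, coeff_monomial] at hm
  exact (by simpa using hm : e = m).symm

theorem apply_eq_zero_of_mem_supported {σ : Type*} {s : Set σ} {β : σ} {g : MvPolynomial σ ℂ}
    (hg : g ∈ supported ℂ s) (hβ : β ∉ s) {m : σ →₀ ℕ} (hm : m ∈ g.support) : m β = 0 :=
  mem_support_notMem_vars_zero hm fun h => hβ (mem_supported.mp hg h)

theorem LexLead.cons_zero {L : List (ℕ × ℕ)} {g : MvPolynomial (ℕ × ℕ) ℂ} {e : ℕ × ℕ →₀ ℕ}
    {β : ℕ × ℕ} {s : Set (ℕ × ℕ)} (h : LexLead L g e) (hg : g ∈ supported ℂ s) (hβ : β ∉ s) :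
    LexLead (β :: L) g e :=
  ⟨h.1, fun m hm hne => lexLT_cons.mpr (Or.inr
    ⟨(apply_eq_zero_of_mem_supported hg hβ hm).trans
      (apply_eq_zero_of_mem_supported hg hβ (mem_support_iff.mpr h.1)).symm, h.2 m hm hne⟩)⟩

theorem LexLead.cons_mul {L : List (ℕ × ℕ)} {g h : MvPolynomial (ℕ × ℕ) ℂ} {e : ℕ × ℕ →₀ ℕ}
    {β : ℕ × ℕ} {s : Set (ℕ × ℕ)} (hh : LexLead L h e) (hg : g ∈ supported ℂ s)
    (hhs : h ∈ supported ℂ s) (hβ : β ∉ s) :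
    LexLead (β :: L) (X β * h + g) (Finsupp.single β 1 + e) := by
  classical
  have he := apply_eq_zero_of_mem_supported hhs hβ (mem_support_iff.mpr hh.1)
  have hg0 : g.coeff (Finsupp.single β 1 + e) = 0 := by
    by_contra hne
    have := apply_eq_zero_of_mem_supported hg hβ (mem_support_iff.mpr hne)
    simp at this
  refine ⟨by simpa [hg0, coeff_X_mul] using hh.1, fun m hm hne => lexLT_cons.mpr ?_⟩
  rcases Finset.mem_union.mp (support_add hm) with hm | hm
  · rw [support_X_mul, Finset.mem_map] at hm
    obtain ⟨m, hm', rfl⟩ := hm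
    have h0 := apply_eq_zero_of_mem_supported hhs hβ hm'
    refine Or.inr ⟨by simp [h0, he], ?_⟩
    have := (hh.2 m hm' fun h => hne (by simp [h])).add_right (Finsupp.single β 1)
    simpa [add_comm] using this
  · left
    simp [apply_eq_zero_of_mem_supported hg hβ hm]

/-- All exponents of `g` have the same value of `Psi`. -/
def PsiConst (g : MvPolynomial (ℕ × ℕ) ℂ) (d : ℤ) : Prop := ∀ m ∈ g.support, (Psi m : ℤ) = d

theorem PsiConst.neg {g : MvPolynomial (ℕ × ℕ) ℂ} {d : ℤ} (h : PsiConst g d) :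
    PsiConst (-g) d := fun m hm => h m (by simpa using hm)

theorem PsiConst.add {g h : MvPolynomial (ℕ × ℕ) ℂ} {d : ℤ} (hg : PsiConst g d)
    (hh : PsiConst h d) : PsiConst (g + h) d := by
  classical
  exact fun m hm => (Finset.mem_union.mp (support_add hm)).elim (hg m) (hh m)

theorem PsiConst.X_mul {g : MvPolynomial (ℕ × ℕ) ℂ} {d d' : ℤ} {β : ℕ × ℕ} (h : PsiConst g d)
    (hd : (Ht β : ℤ) + d = d') : PsiConst (X β * g) d' := by
  intro m hm
  rw [support_X_mul, Finset.mem_map] at hm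
  obtain ⟨m, hm, rfl⟩ := hm
  rw [addLeftEmbedding_apply, Psi_add, Psi_single, Nat.cast_add, h m hm, hd]

theorem LexLead.isLead {S : List (ℕ × ℕ)} {g : MvPolynomial (ℕ × ℕ) ℂ} {e : ℕ × ℕ →₀ ℕ} {d : ℤ}
    (h : LexLead S g e) (hd : PsiConst g d) : IsLead (psiKey S) g e :=
  ⟨h.1, fun m hm hne => psiKey_lt_iff.mpr (Or.inr
    ⟨by exact_mod_cast (hd e (mem_support_iff.mpr h.1)).trans (hd m hm).symm, h.2 m hm hne⟩)⟩

end LexLead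

section Columns

/-- The entries of a triple, numbered from one. -/
def entry (T : ℕ × ℕ × ℕ) (k : ℕ) : ℕ :=
  bif Nat.ble k 1 then T.1 else bif k.beq 2 then T.2.1 else T.2.2

/-- The first three elements of a list. -/
def listTriple (l : List ℕ) : ℕ × ℕ × ℕ := (l.getD 0 0, l.getD 1 0, l.getD 2 0)

/-- The labels at most four in the set encoded by a base, in increasing order. -/
def baseList (b : ℕ × ℕ) : List ℕ := (List.range 5).filter (inBase b)

/-- The columns of the minor belonging to a generator: a nonzero mark `s` replaces the `s`-th
entry of `T` by the label five. -/
def cols (T g : ℕ × ℕ × ℕ) : ℕ × ℕ × ℕ :=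
  listTriple (bif g.1.beq 0 then baseList g.2 else
    ((baseList g.2).filter fun i => !(i.beq (entry T g.1))) ++ [5])

theorem cols_mem_incTriples : ∀ T ∈ triples, ∀ g ∈ genList T, cols T g ∈ incTriples := by
  decide +kernel

theorem exists_cols_eq : ∀ T ∈ triples, ∀ A ∈ incTriples, ∃ g ∈ genList T, cols T g = A := by
  decide +kernel

theorem baseList_of_fst_eq_zero : ∀ b ∈ bases, b.1 = 0 → ∀ A, listTriple (baseList b) = A →
    (A.1 ≤ 3 ∧ A.2.1 ≤ 3 ∧ A.2.2 ≤ 3) ∧ [A.1, A.2.1, A.2.2, b.2].Nodup := by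
  simp only [forall_eq']
  decide +kernel

theorem baseList_of_fst_ne_zero : ∀ b ∈ bases, b.1 ≠ 0 → ∀ A, listTriple (baseList b) = A →
    (A.1 ≤ 3 ∧ A.2.1 ≤ 3 ∧ A.2.2 = 4) ∧ [A.1, A.2.1, entry (0, 1, 2) b.1, b.2].Nodup ∧
      ∀ k < b.1, 1 ≤ k → entry (0, 1, 2) k = A.1 ∨ entry (0, 1, 2) k = A.2.1 := by
  simp only [forall_eq']
  decide +kernel

theorem cols_of_fst_ne_zero : ∀ T ∈ triples, ∀ g ∈ genList T, g.1 ≠ 0 → ∀ A, cols T g = A →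
    (A.1 ≤ 4 ∧ A.2.1 ≤ 4 ∧ A.2.2 = 5) ∧
      (listTriple (baseList g.2) = (A.1, A.2.1, entry T g.1) ∨
        listTriple (baseList g.2) = (A.1, entry T g.1, A.2.1) ∨
        listTriple (baseList g.2) = (entry T g.1, A.1, A.2.1)) ∧
      ∀ k < g.1, 1 ≤ k → entry T k = A.1 ∨ entry T k = A.2.1 := by
  simp only [forall_eq']
  decide +kernel

theorem entry_le : ∀ T ∈ triples, entry T 1 ≤ 4 ∧ entry T 2 ≤ 4 ∧ entry T 3 ≤ 4 := by
  decide +kernel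

theorem entry_injective : ∀ T ∈ triples, ∀ v ∈ List.range 4, ∀ w ∈ List.range 4, v ≠ 0 → w ≠ 0 →
    entry T v = entry T w → v = w := by
  decide +kernel

theorem entry_mem (T : ℕ × ℕ × ℕ) (k : ℕ) :
    entry T k = entry T 1 ∨ entry T k = entry T 2 ∨ entry T k = entry T 3 := by
  rcases k with - | - | - | k
  exacts [Or.inl rfl, Or.inl rfl, Or.inr (Or.inl rfl), Or.inr (Or.inr rfl)]

end Columns

section Minors

variable {R : Type*} [CommRing R] (M : ℕ → Fin 3 → R)

theorem minor_swap_left (a b c : ℕ) : minor M a b c = -minor M b a c := by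
  simp only [minor_eq]; ring

theorem minor_swap_right (a b c : ℕ) : minor M a b c = -minor M a c b := by
  simp only [minor_eq]; ring

theorem minor_self_left (a b : ℕ) : minor M a b a = 0 := by
  simp only [minor_eq]; ring

theorem minor_self_right (a b : ℕ) : minor M a b b = 0 := by
  simp only [minor_eq]; ring

/-- Up to sign, a minor on distinct columns is a minor on increasing columns. -/
theorem exists_minor_sorted {a b c : ℕ} (hab : a ≠ b) (hac : a ≠ c) (hbc : b ≠ c) :
    ∃ x y z, x < y ∧ y < z ∧ (∀ P : ℕ → Prop, P a → P b → P c → P x ∧ P y ∧ P z) ∧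
      (minor M a b c = minor M x y z ∨ minor M a b c = -minor M x y z) := by
  rcases lt_or_gt_of_ne hab with h₁ | h₁ <;> rcases lt_or_gt_of_ne hac with h₂ | h₂ <;>
    rcases lt_or_gt_of_ne hbc with h₃ | h₃
  · exact ⟨a, b, c, h₁, h₃, fun P ha hb hc => ⟨ha, hb, hc⟩, Or.inl rfl⟩
  · exact ⟨a, c, b, h₂, h₃, fun P ha hb hc => ⟨ha, hc, hb⟩, Or.inr (minor_swap_right M a b c)⟩
  · omega
  · exact ⟨c, a, b, h₂, h₁, fun P ha hb hc => ⟨hc, ha, hb⟩, Or.inl (by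
      rw [minor_swap_right, minor_swap_left, neg_neg])⟩
  · exact ⟨b, a, c, h₁, h₂, fun P ha hb hc => ⟨hb, ha, hc⟩, Or.inr (minor_swap_left M a b c)⟩
  · omega
  · exact ⟨b, c, a, h₃, h₂, fun P ha hb hc => ⟨hb, hc, ha⟩, Or.inl (by
      rw [minor_swap_left, minor_swap_right, neg_neg])⟩
  · exact ⟨c, b, a, h₃, h₁, fun P ha hb hc => ⟨hc, hb, ha⟩, Or.inr (by
      rw [minor_swap_left, minor_swap_right, minor_swap_left, neg_neg])⟩

theorem minor_mem {A : Type*} [SetLike A R] [SubringClass A R] {s : A} {a b c : ℕ}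
    (ha : ∀ r, M a r ∈ s) (hb : ∀ r, M b r ∈ s) (hc : ∀ r, M c r ∈ s) : minor M a b c ∈ s := by
  rw [minor_eq]
  exact add_mem (sub_mem (mul_mem (ha _) (sub_mem (mul_mem (hb _) (hc _)) (mul_mem (hb _) (hc _))))
    (mul_mem (ha _) (sub_mem (mul_mem (hb _) (hc _)) (mul_mem (hb _) (hc _)))))
    (mul_mem (ha _) (sub_mem (mul_mem (hb _) (hc _)) (mul_mem (hb _) (hc _))))

end Minors

section Step

variable {M : ℕ → Fin 3 → MvPolynomial (ℕ × ℕ) ℂ}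

theorem PsiConst.sub {g h : MvPolynomial (ℕ × ℕ) ℂ} {d : ℤ} (hg : PsiConst g d)
    (hh : PsiConst h d) : PsiConst (g - h) d := by
  rw [sub_eq_add_neg]
  exact hg.add hh.neg

theorem PsiConst.mul {g h : MvPolynomial (ℕ × ℕ) ℂ} {d d' : ℤ} (hg : PsiConst g d)
    (hh : PsiConst h d') : PsiConst (g * h) (d + d') := by
  classical
  intro m hm
  obtain ⟨a, ha, b, hb, rfl⟩ := Finset.mem_add.mp (support_mul g h hm)
  rw [Psi_add, Nat.cast_add, hg a ha, hh b hb]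

theorem PsiConst.minor {a b c : ℕ} {p q s : ℤ} (ha : ∀ r : Fin 3, PsiConst (M a r) (p - (r + 1)))
    (hb : ∀ r : Fin 3, PsiConst (M b r) (q - (r + 1)))
    (hc : ∀ r : Fin 3, PsiConst (M c r) (s - (r + 1))) :
    PsiConst (minor M a b c) (p + q + s - 6) := by
  have key : ∀ i j k : Fin 3, (i : ℤ) + j + k = 3 →
      PsiConst (M a i * (M b j * M c k)) (p + q + s - 6) := by
    intro i j k h
    have := (ha i).mul ((hb j).mul (hc k))
    rwa [show p - (i + 1) + (q - (j + 1) + (s - (k + 1))) = p + q + s - 6 by linarith] at this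
  rw [minor_eq]
  simp only [mul_sub]
  exact (((key 0 1 2 rfl).sub (key 0 2 1 rfl)).sub ((key 1 0 2 rfl).sub (key 1 2 0 rfl))).add
    ((key 2 0 1 rfl).sub (key 2 1 0 rfl))

/-- The lead exponent of a minor whose last column is a combination of earlier columns. -/
theorem LexLead.minor_step {L : List (ℕ × ℕ)} {s : Set (ℕ × ℕ)} {v : ℕ → ℕ × ℕ}
    {T : ℕ × ℕ × ℕ} {w x y k : ℕ} {e : ℕ × ℕ →₀ ℕ}
    (hM : ∀ r, M w r = X (v 1) * M (entry T 1) r + X (v 2) * M (entry T 2) r +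
      X (v 3) * M (entry T 3) r)
    (hs : ∀ i, minor M x y (entry T i) ∈ supported ℂ s) (hv : ∀ i, v i ∉ s)
    (h₁₂ : v 1 ≠ v 2) (h₁₃ : v 1 ≠ v 3) (h₂₃ : v 2 ≠ v 3) (hk : 1 ≤ k) (hk' : k ≤ 3)
    (hlt : ∀ i < k, 1 ≤ i → entry T i = x ∨ entry T i = y)
    (h : LexLead L (minor M x y (entry T k)) e) :
    LexLead (v 1 :: v 2 :: v 3 :: L) (minor M x y w) (Finsupp.single (v k) 1 + e) := by
  have hmin : minor M x y w = X (v 1) * minor M x y (entry T 1) +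
      (X (v 2) * minor M x y (entry T 2) + X (v 3) * minor M x y (entry T 3)) := by
    simp only [minor_eq, hM]; ring
  have h0 : ∀ i < k, 1 ≤ i → minor M x y (entry T i) = 0 := by
    intro i hi hi'
    rcases hlt i hi hi' with h | h <;> rw [h]
    exacts [minor_self_left M x y, minor_self_right M x y]
  have hX : ∀ {i j}, v i ≠ v j → (X (v j) * minor M x y (entry T j)) ∈ supported ℂ {v i}ᶜ :=
    fun {i j} hij => mul_mem (X_mem_supported.mpr (Ne.symm hij))
      (supported_mono (Set.subset_compl_singleton_iff.mpr (hv i)) (hs j))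
  have hm : ∀ i j, minor M x y (entry T j) ∈ supported ℂ {v i}ᶜ :=
    fun i j => supported_mono (Set.subset_compl_singleton_iff.mpr (hv i)) (hs j)
  have hn : ∀ i, v i ∉ ({v i}ᶜ : Set (ℕ × ℕ)) := fun i => by simp
  rw [hmin]
  obtain rfl | rfl | rfl : k = 1 ∨ k = 2 ∨ k = 3 := by omega
  · exact ((h.cons_zero (hm 3 1) (hn 3)).cons_zero (hm 2 1) (hn 2)).cons_mul
      (add_mem (hX h₁₂) (hX h₁₃)) (hm 1 1) (hn 1)
  · rw [h0 1 (by norm_num) le_rfl, mul_zero, zero_add]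
    exact ((h.cons_zero (hm 3 2) (hn 3)).cons_mul (hX h₂₃) (hm 2 2) (hn 2)).cons_zero
      (add_mem (hX h₁₂) (hX h₁₃)) (hn 1)
  · rw [h0 1 (by norm_num) le_rfl, h0 2 (by norm_num) (by norm_num), mul_zero, zero_add,
      mul_zero, zero_add, ← add_zero (X (v 3) * _)]
    exact ((h.cons_mul (zero_mem _) (hm 3 3) (hn 3)).cons_zero
      (add_mem (hX h₂₃) (zero_mem _)) (hn 2)).cons_zero
      (add_mem (hX h₁₃) (zero_mem _)) (hn 1)

end Step

section Frame

/-- The variable multiplying the `s`-th column occurring in the sixth column. -/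
def posX (lab : ℕ → ℕ) (T : ℕ × ℕ × ℕ) (s : ℕ) : ℕ × ℕ := (lab (entry T s), 6)

/-- The variable multiplying the `t`-th column occurring in the fifth column. -/
def posY (lab : ℕ → ℕ) (t : ℕ) : ℕ × ℕ := (lab (entry (0, 1, 2) t), 5)

/-- The variable in the fourth column belonging to the label `u`. -/
def posZ (lab : ℕ → ℕ) (u : ℕ) : ℕ × ℕ := (lab u, 4)

/-- The lead exponent of a generator. -/
def genExp (lab : ℕ → ℕ) (v₀ : ℕ) {T : ℕ × ℕ × ℕ} (g : Gen T) : ℕ × ℕ →₀ ℕ :=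
  unitExp 0 (posX lab T) g.1.1 + unitExp 0 (posY lab) g.1.2.1 + unitExp v₀ (posZ lab) g.1.2.2

/-- The columns `M` are built from four columns by the recursion belonging to an iterated
sequence, whose variables for the first four columns are in the list `L`. -/
structure Frame (M : ℕ → Fin 3 → MvPolynomial (ℕ × ℕ) ℂ) (lab : ℕ → ℕ) (T : ℕ × ℕ × ℕ) (v₀ : ℕ)
    (L : List (ℕ × ℕ)) : Prop where
  mem_triples : T ∈ triples
  col_five : ∀ r, M 5 r = X (posX lab T 1) * M (entry T 1) r + X (posX lab T 2) * M (entry T 2) r +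
    X (posX lab T 3) * M (entry T 3) r
  col_four : ∀ r, M 4 r = X (posY lab 1) * M (entry (0, 1, 2) 1) r +
    X (posY lab 2) * M (entry (0, 1, 2) 2) r + X (posY lab 3) * M (entry (0, 1, 2) 3) r
  mem_supported : ∀ x ≤ 3, ∀ r, M x r ∈ supported ℂ {β : ℕ × ℕ | β.2 = 4}
  psiConst : ∀ x ≤ 3, ∀ r : Fin 3, PsiConst (M x r) (lab x - (r + 1))
  minor_base : ∀ x ≤ 3, ∀ y ≤ 3, ∀ z ≤ 3, ∀ u ≤ 3, [x, y, z, u].Nodup →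
    minor M x y z = monomial (unitExp v₀ (posZ lab) u) 1 ∨
      minor M x y z = -monomial (unitExp v₀ (posZ lab) u) 1
  lab_injective : ∀ x ≤ 4, ∀ y ≤ 4, lab x = lab y → x = y
  lab_le : ∀ x ≤ 3, lab x ≤ 4
  lab_four : lab 4 = 5
  lab_five : lab 5 = 6
  posZ_mem : ∀ u ≤ 3, u ≠ v₀ → posZ lab u ∈ L

namespace Frame

variable {M : ℕ → Fin 3 → MvPolynomial (ℕ × ℕ) ℂ} {lab : ℕ → ℕ} {T : ℕ × ℕ × ℕ} {v₀ : ℕ}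
  {L : List (ℕ × ℕ)}

theorem entry_le_four (F : Frame M lab T v₀ L) (k : ℕ) : entry T k ≤ 4 := by
  have := entry_le T F.mem_triples
  rcases entry_mem T k with h | h | h <;> omega

theorem entry_le_two (k : ℕ) : entry (0, 1, 2) k ≤ 2 := by
  rcases entry_mem (0, 1, 2) k with h | h | h <;> rw [h] <;> decide

theorem posX_ne (F : Frame M lab T v₀ L) {v w : ℕ} (hv : v ≤ 3) (hw : w ≤ 3) (hv0 : v ≠ 0)
    (hw0 : w ≠ 0) (h : v ≠ w) : posX lab T v ≠ posX lab T w := fun he =>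
  h (entry_injective T F.mem_triples v (List.mem_range.mpr (by omega)) w
    (List.mem_range.mpr (by omega)) hv0 hw0 (F.lab_injective _ (F.entry_le_four v) _
      (F.entry_le_four w) (congrArg Prod.fst he)))

theorem posY_ne (F : Frame M lab T v₀ L) {v w : ℕ} (hv : v ≤ 3) (hw : w ≤ 3) (hv0 : v ≠ 0)
    (hw0 : w ≠ 0) (h : v ≠ w) : posY lab v ≠ posY lab w := fun he =>
  h (entry_injective (0, 1, 2) (by decide +kernel) v (List.mem_range.mpr (by omega)) w
    (List.mem_range.mpr (by omega)) hv0 hw0 (F.lab_injective _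
      ((entry_le_two v).trans (by norm_num)) _ ((entry_le_two w).trans (by norm_num))
      (congrArg Prod.fst he)))

theorem isExp (F : Frame M lab T v₀ L) :
    IsExp (genExp lab v₀ (T := T)) v₀ (posX lab T) (posY lab) (posZ lab) where
  eq _ := rfl
  inj₁ v hv w hw hv0 hw0 h := by
    by_contra hne
    exact F.posX_ne hv hw hv0 hw0 hne h
  inj₂ v hv w hw hv0 hw0 h := by
    by_contra hne
    exact F.posY_ne hv hw hv0 hw0 hne h
  inj₃ v hv w hw _ _ h :=
    F.lab_injective v (by omega) w (by omega) (congrArg Prod.fst h)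
  ne₁₂ v w h := absurd (congrArg Prod.snd h) (by decide : (6 : ℕ) ≠ 5)
  ne₁₃ v w h := absurd (congrArg Prod.snd h) (by decide : (6 : ℕ) ≠ 4)
  ne₂₃ v w h := absurd (congrArg Prod.snd h) (by decide : (5 : ℕ) ≠ 4)

theorem mem_supported_four (F : Frame M lab T v₀ L) {x : ℕ} (hx : x ≤ 4) (r : Fin 3) :
    M x r ∈ supported ℂ {β : ℕ × ℕ | β.2 ≤ 5} := by
  have hsub : {β : ℕ × ℕ | β.2 = 4} ⊆ {β | β.2 ≤ 5} := by
    intro β hβ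
    simp only [Set.mem_ofPred_eq] at hβ ⊢
    omega
  have h3 : ∀ x ≤ 3, M x r ∈ supported ℂ {β : ℕ × ℕ | β.2 ≤ 5} := fun x hx =>
    supported_mono hsub (F.mem_supported x hx r)
  obtain hx | rfl := Nat.le_succ_iff.mp hx
  · exact h3 x hx
  · have hX : ∀ k, X (posY lab k) * M (entry (0, 1, 2) k) r ∈
        supported ℂ {β : ℕ × ℕ | β.2 ≤ 5} := fun k =>
      mul_mem (X_mem_supported.mpr (le_refl 5)) (h3 _ ((entry_le_two k).trans (by norm_num)))
    change M 4 r ∈ _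
    rw [F.col_four]
    exact add_mem (add_mem (hX 1) (hX 2)) (hX 3)

theorem psiConst_col (F : Frame M lab T v₀ L) {x : ℕ} (hx : x ≤ 5) (r : Fin 3) :
    PsiConst (M x r) (lab x - (r + 1)) := by
  have h4 : ∀ x ≤ 4, PsiConst (M x r) (lab x - (r + 1)) := by
    intro x hx
    obtain hx | rfl := Nat.le_succ_iff.mp hx
    · exact F.psiConst x hx r
    · have hX : ∀ k, PsiConst (X (posY lab k) * M (entry (0, 1, 2) k) r) (5 - (r + 1)) := by
        intro k
        have hk := (entry_le_two k).trans (by norm_num : 2 ≤ 3)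
        have hl := F.lab_le _ hk
        refine (F.psiConst _ hk r).X_mul ?_
        simp only [posY, Ht]
        omega
      change PsiConst (M 4 r) (lab 4 - (r + 1))
      rw [F.col_four, F.lab_four]
      exact ((hX 1).add (hX 2)).add (hX 3)
  obtain hx | rfl := Nat.le_succ_iff.mp hx
  · exact h4 x hx
  · have hX : ∀ k, PsiConst (X (posX lab T k) * M (entry T k) r) (6 - (r + 1)) := by
      intro k
      have hk := F.entry_le_four k
      have hl : lab (entry T k) ≤ 5 := by
        obtain hk | hk := Nat.le_succ_iff.mp hk
        · exact (F.lab_le _ hk).trans (by norm_num)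
        · rw [hk]
          exact F.lab_four.le
      refine (h4 _ hk).X_mul ?_
      simp only [posX, Ht]
      omega
    change PsiConst (M 5 r) (lab 5 - (r + 1))
    rw [F.col_five, F.lab_five]
    exact ((hX 1).add (hX 2)).add (hX 3)

theorem lexLead_base (F : Frame M lab T v₀ L) (L' : List (ℕ × ℕ)) {x y z u : ℕ} (hx : x ≤ 3)
    (hy : y ≤ 3) (hz : z ≤ 3) (hu : u ≤ 3) (h : [x, y, z, u].Nodup) :
    LexLead L' (minor M x y z) (unitExp v₀ (posZ lab) u) := by
  rcases F.minor_base x hx y hy z hz u hu h with h | h <;> rw [h]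
  exacts [.monomial _ _, (LexLead.monomial _ _).neg]

/-- The lead exponent of a minor not involving the last column. -/
theorem lexLead_baseList (F : Frame M lab T v₀ L) {b : ℕ × ℕ} (hb : b ∈ bases) {A : ℕ × ℕ × ℕ}
    (hA : listTriple (baseList b) = A) :
    LexLead (posY lab 1 :: posY lab 2 :: posY lab 3 :: L) (minor M A.1 A.2.1 A.2.2)
      (unitExp 0 (posY lab) b.1 + unitExp v₀ (posZ lab) b.2) := by
  have hb' := le_three_of_mem_bases hb
  by_cases h0 : b.1 = 0
  · obtain ⟨⟨h1, h2, h3⟩, hn⟩ := baseList_of_fst_eq_zero b hb h0 A hA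
    rw [unitExp, if_pos h0, zero_add]
    exact F.lexLead_base _ h1 h2 h3 hb'.2 hn
  · obtain ⟨⟨h1, h2, h3⟩, hn, hlt⟩ := baseList_of_fst_ne_zero b hb h0 A hA
    rw [unitExp, if_neg h0, h3]
    have hle : ∀ k, entry (0, 1, 2) k ≤ 3 := fun k => (entry_le_two k).trans (by norm_num)
    exact LexLead.minor_step (v := posY lab) F.col_four
      (fun i => minor_mem M (F.mem_supported _ h1) (F.mem_supported _ h2)
        (F.mem_supported _ (hle i)))
      (fun i => by simp [posY]) (F.posY_ne (by norm_num) (by norm_num) (by norm_num)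
      (by norm_num) (by norm_num)) (F.posY_ne (by norm_num) (by norm_num) (by norm_num)
      (by norm_num) (by norm_num)) (F.posY_ne (by norm_num) (by norm_num) (by norm_num)
      (by norm_num) (by norm_num)) (Nat.one_le_iff_ne_zero.mpr h0) (hb'.1.trans hb'.2) hlt
      (F.lexLead_base L h1 h2 (hle _) hb'.2 hn)

/-- The sequence of variables of a frame. -/
def seq (lab : ℕ → ℕ) (T : ℕ × ℕ × ℕ) (L : List (ℕ × ℕ)) : List (ℕ × ℕ) :=
  posX lab T 1 :: posX lab T 2 :: posX lab T 3 :: posY lab 1 :: posY lab 2 :: posY lab 3 :: L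

theorem lexLead_cols (F : Frame M lab T v₀ L) (g : Gen T) {A : ℕ × ℕ × ℕ}
    (hA : cols T g.1 = A) :
    LexLead (seq lab T L) (minor M A.1 A.2.1 A.2.2) (genExp lab v₀ g) := by
  have hg := mem_genList.mpr g.2
  have hn : ∀ i, posX lab T i ∉ {β : ℕ × ℕ | β.2 ≤ 5} := fun i => by simp [posX]
  have hsupp : ∀ {x y z}, x ≤ 4 → y ≤ 4 → z ≤ 4 →
      minor M x y z ∈ supported ℂ {β : ℕ × ℕ | β.2 ≤ 5} := fun hx hy hz =>
    minor_mem M (F.mem_supported_four hx) (F.mem_supported_four hy) (F.mem_supported_four hz)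
  rw [genExp, add_assoc]
  by_cases h0 : g.1.1 = 0
  · rw [unitExp, if_pos h0, zero_add]
    have hA' : listTriple (baseList g.1.2) = A := by
      rw [← hA, cols, h0]
      rfl
    have hle : A.1 ≤ 4 ∧ A.2.1 ≤ 4 ∧ A.2.2 ≤ 4 := by
      by_cases hb : g.1.2.1 = 0
      · have := (baseList_of_fst_eq_zero _ g.2.1 hb A hA').1
        omega
      · have := (baseList_of_fst_ne_zero _ g.2.1 hb A hA').1
        omega
    have hs := hsupp hle.1 hle.2.1 hle.2.2
    exact (((F.lexLead_baseList g.2.1 hA').cons_zero hs (hn 3)).cons_zero hs (hn 2)).cons_zero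
      hs (hn 1)
  · obtain ⟨⟨h1, h2, h3⟩, hperm, hlt⟩ := cols_of_fst_ne_zero T F.mem_triples g.1 hg h0 A hA
    rw [unitExp, if_neg h0, h3]
    refine LexLead.minor_step (v := posX lab T) F.col_five
      (fun i => hsupp h1 h2 (F.entry_le_four i)) hn (F.posX_ne (by norm_num) (by norm_num)
      (by norm_num) (by norm_num) (by norm_num)) (F.posX_ne (by norm_num) (by norm_num)
      (by norm_num) (by norm_num) (by norm_num)) (F.posX_ne (by norm_num) (by norm_num)
      (by norm_num) (by norm_num) (by norm_num)) (Nat.one_le_iff_ne_zero.mpr h0)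
      (g.2.2.trans (rk_le _ _)) hlt ?_
    have hbase : ∀ {x y z}, listTriple (baseList g.1.2) = (x, y, z) → _ := fun {x y z} h =>
      F.lexLead_baseList (b := g.1.2) g.2.1 (A := (x, y, z)) h
    rcases hperm with h | h | h
    · have := hbase h
      exact this
    · have := (hbase h).neg
      rw [minor_swap_right]
      exact this
    · have := hbase h
      rw [minor_swap_right, minor_swap_left, neg_neg]
      exact this

/-- The minor belonging to a generator. -/
def genMinor (M : ℕ → Fin 3 → MvPolynomial (ℕ × ℕ) ℂ) {T : ℕ × ℕ × ℕ} (g : Gen T) :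
    MvPolynomial (ℕ × ℕ) ℂ :=
  minor M (cols T g.1).1 (cols T g.1).2.1 (cols T g.1).2.2

theorem isLead (F : Frame M lab T v₀ L) (g : Gen T) :
    IsLead (psiKey (seq lab T L)) (genMinor M g) (genExp lab v₀ g) := by
  have hA := cols_mem_incTriples T F.mem_triples g.1 (mem_genList.mpr g.2)
  obtain ⟨h1, h2, h3⟩ := lt_of_mem_incTriples hA
  exact (F.lexLead_cols g rfl).isLead (PsiConst.minor (F.psiConst_col (by omega))
    (F.psiConst_col (by omega)) (F.psiConst_col h3))

theorem genExp_eq_zero (F : Frame M lab T v₀ L) (g : Gen T) {β : ℕ × ℕ}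
    (hβ : β ∉ seq lab T L) : genExp lab v₀ g β = 0 := by
  have key : ∀ (w : ℕ) (p : ℕ → ℕ × ℕ) (v : ℕ), (v ≠ w → p v ∈ seq lab T L) →
      unitExp w p v β = 0 := by
    intro w p v h
    rw [unitExp]
    split_ifs with hw
    · rfl
    · exact Finsupp.single_eq_of_ne fun he => hβ (he ▸ h hw)
  have hb := le_three_of_mem_bases g.2.1
  have hs := g.2.2.trans (rk_le _ _)
  rw [genExp, Finsupp.add_apply, Finsupp.add_apply, key, key, key]
  · intro h
    simp [seq, F.posZ_mem _ hb.2 h]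
  · intro h
    obtain h | h | h : g.1.2.1 = 1 ∨ g.1.2.1 = 2 ∨ g.1.2.1 = 3 := by omega
    all_goals simp [seq, h]
  · intro h
    obtain h | h | h : g.1.1 = 1 ∨ g.1.1 = 2 ∨ g.1.1 = 3 := by omega
    all_goals simp [seq, h]

/-- The minors form a Khovanskii basis: lead exponents of polynomial expressions in the minors
are sums of lead exponents of minors. -/
theorem exists_isLead (F : Frame M lab T v₀ L) {τ : Type*} (P : τ → MvPolynomial (ℕ × ℕ) ℂ)
    (hP : ∀ k, ∃ A ∈ incTriples, P k = minor M A.1 A.2.1 A.2.2 ∨ P k = -minor M A.1 A.2.1 A.2.2)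
    {A : ℕ × ℕ × ℕ} (hA : A ∈ incTriples) {c₀ : ℂ} (hone : c₀ • minor M A.1 A.2.1 A.2.2 = 1)
    (f : MvPolynomial τ ℂ) (hf : aeval P f ≠ 0) :
    ∃ m : Multiset (Gen T), IsLead (psiKey (seq lab T L)) (aeval P f)
      (m.map (genExp lab v₀)).sum := by
  have hgen : ∀ A ∈ incTriples, ∃ g : Gen T, genMinor M g = minor M A.1 A.2.1 A.2.2 := by
    intro A hA
    obtain ⟨g, hg, rfl⟩ := exists_cols_eq T F.mem_triples A hA
    exact ⟨⟨g, mem_genList.mp hg⟩, rfl⟩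
  obtain ⟨g₀, hg₀⟩ := hgen A hA
  obtain ⟨n, hn⟩ := exists_aeval_mem_span (Q := genMinor M) (i₀ := g₀) (hg₀ ▸ hone) P (by
    intro k
    obtain ⟨A, hA, hk⟩ := hP k
    obtain ⟨g, hg⟩ := hgen A hA
    refine ⟨g, ?_⟩
    rw [hg]
    rcases hk with hk | hk
    · exact ⟨1, by rw [hk, one_smul]⟩
    · exact ⟨-1, by rw [hk, neg_smul, one_smul]⟩) f
  have hzero : ∀ (m : Multiset (Gen T)), ∀ β ∉ seq lab T L,
      (m.map (genExp lab v₀)).sum β = 0 := by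
    intro m β hβ
    induction m using Multiset.induction_on with
    | empty => simp
    | cons g m ih => simp [F.genExp_eq_zero g hβ, ih]
  exact exists_isLead_of_mem_span F.isLead
    (fun m m' h => eq_of_psiKey_eq (hzero m) (hzero m') h)
    (fun m m' hm hm' h => F.isExp.leadEquiv F.mem_triples F.isLead
      (finrank_span_mul_minor_le M (fun g : Gen T => cols T g.1)
        fun g => cols_mem_incTriples T F.mem_triples g.1 (mem_genList.mpr g.2))
      (hm.trans hm'.symm) h) hn hf

end Frame

end Frame

section Recursion

theorem ASmat_cons {n : ℕ} {β : ℕ × ℕ} (L : List (ℕ × ℕ)) (i : ℕ) {j : ℕ} (hj : 1 ≤ j ∧ j ≤ n)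
    (hβ : 1 ≤ β.1 ∧ β.1 ≤ n) : ASmat n (β :: L) i j =
      ASmat n L i j + if j = β.2 then X β * ASmat n L i β.1 else 0 := by
  have h : ∀ k, ASmat n L i k * factor β k j = (if k = j then ASmat n L i k else 0) +
      if k = β.1 then (if j = β.2 then X β * ASmat n L i k else 0) else 0 := by
    intro k
    simp only [factor, mul_add, ite_and]
    split_ifs <;> ring
  simp only [ASmat, matMul, h, Finset.sum_add_distrib, Finset.sum_ite_eq', Finset.mem_Icc, hj, hβ,
    and_self, if_true]

theorem ASmat_cons_of_ne {n : ℕ} {β : ℕ × ℕ} (L : List (ℕ × ℕ)) (i : ℕ) {j : ℕ}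
    (hj : 1 ≤ j ∧ j ≤ n) (hβ : 1 ≤ β.1 ∧ β.1 ≤ n) (h : j ≠ β.2) :
    ASmat n (β :: L) i j = ASmat n L i j := by
  rw [ASmat_cons L i hj hβ, if_neg h, add_zero]

theorem ASmat_cons_self {n : ℕ} {a j : ℕ} (L : List (ℕ × ℕ)) (i : ℕ)
    (hj : 1 ≤ j ∧ j ≤ n) (ha : 1 ≤ a ∧ a ≤ n) :
    ASmat n ((a, j) :: L) i j = ASmat n L i j + X (a, j) * ASmat n L i a := by
  rw [ASmat_cons L i hj ha, if_pos rfl]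

/-- A column is unchanged by factors modifying another column. -/
theorem ASmat_triple_of_ne {n a b c j k : ℕ} (L : List (ℕ × ℕ)) (i : ℕ)
    (hj : 1 ≤ j ∧ j ≤ n) (ha : 1 ≤ a ∧ a ≤ n) (hb : 1 ≤ b ∧ b ≤ n) (hc : 1 ≤ c ∧ c ≤ n)
    (h : j ≠ k) : ASmat n ((a, k) :: (b, k) :: (c, k) :: L) i j = ASmat n L i j := by
  rw [ASmat_cons_of_ne _ i hj ha h, ASmat_cons_of_ne _ i hj hb h, ASmat_cons_of_ne _ i hj hc h]

theorem ASmat_triple_self {n a b c k : ℕ} (L : List (ℕ × ℕ)) (i : ℕ)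
    (hk : 1 ≤ k ∧ k ≤ n) (ha : 1 ≤ a ∧ a < k) (hb : 1 ≤ b ∧ b < k) (hc : 1 ≤ c ∧ c < k) :
    ASmat n ((a, k) :: (b, k) :: (c, k) :: L) i k = ASmat n L i k + X (a, k) * ASmat n L i a +
      X (b, k) * ASmat n L i b + X (c, k) * ASmat n L i c := by
  have ha' : 1 ≤ a ∧ a ≤ n := by omega
  have hb' : 1 ≤ b ∧ b ≤ n := by omega
  have hc' : 1 ≤ c ∧ c ≤ n := by omega
  rw [ASmat_cons_self _ i hk ha', ASmat_cons_self _ i hk hb', ASmat_cons_self _ i hk hc',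
    ASmat_cons_of_ne _ i ha' hb' ha.2.ne, ASmat_cons_of_ne _ i ha' hc' ha.2.ne,
    ASmat_cons_of_ne _ i hb' hc' hb.2.ne]
  ring

theorem ASmat_of_snd_eq {n k : ℕ} {L : List (ℕ × ℕ)} (hL : ∀ β ∈ L, β.2 = k ∧ 1 ≤ β.1 ∧ β.1 < k)
    (hk : k ≤ n) (i : ℕ) {j : ℕ} (hj : 1 ≤ j ∧ j ≤ n) : ASmat n L i j = idN i j +
      if j = k then (L.map fun β => X β * idN i β.1).sum else 0 := by
  induction L generalizing j with
  | nil => simp [ASmat]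
  | cons β L ih =>
    obtain ⟨hβ, h1, h2⟩ := hL β (by simp)
    have hL' := fun β h => hL β (List.mem_cons_of_mem _ h)
    have hβn := h2.le.trans hk
    rw [ASmat_cons L i hj ⟨h1, hβn⟩, ih hL' hj, ih hL' ⟨h1, hβn⟩, if_neg h2.ne, hβ]
    split_ifs
    · simp only [List.map_cons, List.sum_cons]
      ring
    · simp

/-- The columns of the matrix of a reordering of the base sequence. -/
theorem ASmat_base {n : ℕ} (hn : 4 ≤ n) {L : List (ℕ × ℕ)}
    (hL : L.Perm [(1, 4), (2, 4), (3, 4)]) (r : Fin 3) {j : ℕ} (hj : 1 ≤ j ∧ j ≤ n) :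
    ASmat n L (r + 1) j =
      if j = 4 then X ((r : ℕ) + 1, 4) else if j = (r : ℕ) + 1 then 1 else 0 := by
  rw [ASmat_of_snd_eq (k := 4) _ hn _ hj, (hL.map _).sum_eq]
  · by_cases h : j = 4
    · subst h
      fin_cases r <;> simp [idN]
    · simp [idN, h, eq_comm]
  · intro β hβ
    have := hL.mem_iff.mp hβ
    simp only [List.mem_cons, List.not_mem_nil, or_false] at this
    rcases this with rfl | rfl | rfl <;> decide

end Recursion

section Construction

/-- The columns of the matrix of a sequence. -/
def seqCol (S : List (ℕ × ℕ)) (l : ℕ) (r : Fin 3) : MvPolynomial (ℕ × ℕ) ℂ :=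
  ASmat 6 S (r + 1) l

theorem minor_comp {R : Type*} [CommRing R] (M : ℕ → Fin 3 → R) (f : ℕ → ℕ) (a b c : ℕ) :
    minor (fun x => M (f x)) a b c = minor M (f a) (f b) (f c) := by
  simp only [minor_eq]

theorem phiStar_eq_minor (S : List (ℕ × ℕ)) (K : Fin 3 → ℕ) :
    phiStar 6 S K = minor (seqCol S) (K 0) (K 1) (K 2) := by
  have h : ![K 0, K 1, K 2] = K := by
    ext i
    fin_cases i <;> rfl
  rw [minor, h]
  rfl

/-- The labelling of the columns, in the order in which they occur in the fifth column. -/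
def iterLab (a b c : ℕ) (x : ℕ) : ℕ :=
  if x = 0 then a else if x = 1 then b else if x = 2 then c else
    if x = 3 then 10 - a - b - c else x + 1

theorem minor_eq_monomial {M : ℕ → Fin 3 → MvPolynomial (ℕ × ℕ) ℂ}
    (hM : ∀ l, 1 ≤ l → l ≤ 4 → ∀ r : Fin 3,
      M l r = if l = 4 then X ((r : ℕ) + 1, 4) else if l = (r : ℕ) + 1 then 1 else 0)
    {p q s w : ℕ} (hp : 1 ≤ p ∧ p ≤ 4) (hq : 1 ≤ q ∧ q ≤ 4) (hs : 1 ≤ s ∧ s ≤ 4)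
    (hw : 1 ≤ w ∧ w ≤ 4) (h : [p, q, s, w].Nodup) :
    minor M p q s = monomial (if w = 4 then 0 else Finsupp.single (w, 4) 1) 1 ∨
      minor M p q s = -monomial (if w = 4 then 0 else Finsupp.single (w, 4) 1) 1 := by
  obtain ⟨hp1, hp2⟩ := hp
  obtain ⟨hq1, hq2⟩ := hq
  obtain ⟨hs1, hs2⟩ := hs
  obtain ⟨hw1, hw2⟩ := hw
  simp only [List.nodup_cons, List.mem_cons, List.not_mem_nil, or_false, not_or] at h
  have hX : ∀ β : ℕ × ℕ, monomial (Finsupp.single β 1) (1 : ℂ) = X β := fun _ => rfl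
  rw [minor_eq]
  simp only [hM p hp1 hp2, hM q hq1 hq2, hM s hs1 hs2]
  interval_cases p <;> interval_cases q <;> first | omega | interval_cases s <;>
    first | omega | interval_cases w <;> first | omega | simp [hX]

theorem frame_seqCol {L : List (ℕ × ℕ)} (hL : L.Perm [(1, 4), (2, 4), (3, 4)]) {a b c p q s : ℕ}
    (ha : 1 ≤ a ∧ a ≤ 4) (hb : 1 ≤ b ∧ b ≤ 4) (hc : 1 ≤ c ∧ c ≤ 4) (hab : a ≠ b) (hac : a ≠ c)
    (hbc : b ≠ c) (hp : p ≤ 4) (hq : q ≤ 4) (hs : s ≤ 4) (hpq : p ≠ q) (hps : p ≠ s)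
    (hqs : q ≠ s) {v₀ : ℕ} (hv₀ : v₀ ≤ 3) (hv : iterLab a b c v₀ = 4) :
    Frame (fun x => seqCol (Frame.seq (iterLab a b c) (p, q, s) L) (iterLab a b c x))
      (iterLab a b c) (p, q, s) v₀ L := by
  have hlab : ∀ x ≤ 3, 1 ≤ iterLab a b c x ∧ iterLab a b c x ≤ 4 := by
    intro x hx
    simp only [iterLab]
    split_ifs <;> omega
  have hinj : ∀ x ≤ 4, ∀ y ≤ 4, iterLab a b c x = iterLab a b c y → x = y := by
    intro x hx y hy
    simp only [iterLab]
    split_ifs <;> omega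
  have hlab' : ∀ x ≤ 4, 1 ≤ iterLab a b c x ∧ iterLab a b c x < 6 := by
    intro x hx
    simp only [iterLab]
    split_ifs <;> omega
  have hS : Frame.seq (iterLab a b c) (p, q, s) L =
      (iterLab a b c p, 6) :: (iterLab a b c q, 6) :: (iterLab a b c s, 6) ::
        (a, 5) :: (b, 5) :: (c, 5) :: L := rfl
  have hle : ∀ {x}, 1 ≤ x ∧ x < 6 → 1 ≤ x ∧ x ≤ 6 := fun h => ⟨h.1, h.2.le⟩
  have hle' : ∀ {x}, 1 ≤ x ∧ x ≤ 4 → 1 ≤ x ∧ x ≤ 6 := fun h => ⟨h.1, by omega⟩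
  have hlt : ∀ {x}, 1 ≤ x ∧ x ≤ 4 → 1 ≤ x ∧ x < 5 := fun h => ⟨h.1, by omega⟩
  have hsix : ∀ j (r : Fin 3), 1 ≤ j ∧ j < 6 →
      seqCol (Frame.seq (iterLab a b c) (p, q, s) L) j r =
        ASmat 6 ((a, 5) :: (b, 5) :: (c, 5) :: L) (r + 1) j := fun j r hj => by
    rw [seqCol, hS, ASmat_triple_of_ne _ _ (hle hj) (hle (hlab' p hp)) (hle (hlab' q hq))
      (hle (hlab' s hs)) hj.2.ne]
  have hfour : ∀ j, 1 ≤ j → j ≤ 4 → ∀ r : Fin 3,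
      seqCol (Frame.seq (iterLab a b c) (p, q, s) L) j r =
        if j = 4 then X ((r : ℕ) + 1, 4) else if j = (r : ℕ) + 1 then 1 else 0 := by
    intro j hj hj' r
    rw [hsix j r ⟨hj, by omega⟩, ASmat_triple_of_ne _ _ (hle' ⟨hj, hj'⟩) (hle' ha) (hle' hb)
      (hle' hc) (by omega), ASmat_base (by norm_num) hL r (hle' ⟨hj, hj'⟩)]
  have hbase : ∀ j, 4 < j → j ≤ 6 → ∀ r : Fin 3, ASmat 6 L (r + 1) j = 0 := by
    intro j hj hj' r
    rw [ASmat_base (by norm_num) hL r ⟨by omega, hj'⟩, if_neg (by omega), if_neg (by omega)]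
  refine ⟨?_, ?_, ?_, ?_, ?_, ?_, hinj, fun x hx => (hlab x hx).2, rfl, rfl, ?_⟩
  · simp only [triples, List.mem_filter, List.mem_flatMap, List.mem_map, List.mem_range,
      Prod.mk.injEq]
    refine ⟨⟨p, by omega, q, by omega, s, by omega, rfl, rfl, rfl⟩, ?_⟩
    simp [← Bool.not_eq_true, Nat.beq_eq, hpq, hps, hqs]
  · intro r
    change seqCol _ 6 r = X (_, 6) * seqCol _ (iterLab a b c p) r +
      X (_, 6) * seqCol _ (iterLab a b c q) r + X (_, 6) * seqCol _ (iterLab a b c s) r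
    rw [hsix _ r (hlab' p hp), hsix _ r (hlab' q hq), hsix _ r (hlab' s hs), seqCol, hS,
      ASmat_triple_self _ _ (by norm_num) (hlab' p hp) (hlab' q hq) (hlab' s hs),
      ASmat_triple_of_ne _ _ (by norm_num) (hle' ha) (hle' hb) (hle' hc) (by norm_num),
      hbase 6 (by norm_num) le_rfl, zero_add]
    rfl
  · intro r
    change seqCol _ 5 r = X (a, 5) * seqCol _ a r + X (b, 5) * seqCol _ b r +
      X (c, 5) * seqCol _ c r
    rw [hfour a ha.1 ha.2, hfour b hb.1 hb.2, hfour c hc.1 hc.2, hsix 5 r (by norm_num),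
      ASmat_triple_self _ _ (by norm_num) (hlt ha) (hlt hb) (hlt hc), hbase 5 (by norm_num)
      (by norm_num), zero_add, ASmat_base (by norm_num) hL r (hle' ha),
      ASmat_base (by norm_num) hL r (hle' hb), ASmat_base (by norm_num) hL r (hle' hc)]
  · intro x hx r
    rw [hfour _ (hlab x hx).1 (hlab x hx).2]
    split_ifs
    exacts [X_mem_supported.mpr rfl, one_mem _, zero_mem _]
  · intro x hx r
    rw [hfour _ (hlab x hx).1 (hlab x hx).2]
    intro m hm
    split_ifs at hm with h h'
    · rw [support_X, Finset.mem_singleton] at hm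
      rw [hm, Psi_single, h, Ht]
      have := r.isLt
      omega
    · rw [support_one, Finset.mem_singleton] at hm
      rw [hm, Psi_zero, h']
      simp
    · simp at hm
  · intro x hx y hy z hz u hu h
    have hexp : unitExp v₀ (posZ (iterLab a b c)) u = if iterLab a b c u = 4 then 0 else
        Finsupp.single (iterLab a b c u, 4) 1 := by
      rw [unitExp]
      by_cases huv : u = v₀
      · rw [if_pos huv, huv, if_pos hv]
      · rw [if_neg huv, if_neg fun h => huv (hinj u (by omega) v₀ (by omega) (h.trans hv.symm))]
        rfl
    rw [hexp, minor_comp]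
    refine minor_eq_monomial hfour (hlab x hx) (hlab y hy) (hlab z hz) (hlab u hu)
      (h.map_on (l := [x, y, z, u]) (f := iterLab a b c) ?_)
    intro t ht t' ht'
    have hmem : ∀ t ∈ [x, y, z, u], t ≤ 4 := by
      intro t ht
      simp only [List.mem_cons, List.not_mem_nil, or_false] at ht
      omega
    exact hinj t (hmem t ht) t' (hmem t' ht')
  · intro u hu huv
    have h4 : iterLab a b c u ≠ 4 := fun h =>
      huv (hinj u (by omega) v₀ (by omega) (h.trans hv.symm))
    have := hlab u hu
    rw [hL.mem_iff, posZ]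
    obtain h | h | h : iterLab a b c u = 1 ∨ iterLab a b c u = 2 ∨ iterLab a b c u = 3 := by omega
    all_goals rw [h]; decide

theorem exists_iterLab_eq {a b c : ℕ} (ha : 1 ≤ a ∧ a ≤ 4) (hb : 1 ≤ b ∧ b ≤ 4)
    (hc : 1 ≤ c ∧ c ≤ 4) (hab : a ≠ b) (hac : a ≠ c) (hbc : b ≠ c) {i n : ℕ} (hi : 1 ≤ i)
    (hin : i ≤ n + 1) (hn : 3 ≤ n) : ∃ x ≤ n, iterLab a b c x = i := by
  by_cases h : i = a
  · exact ⟨0, by omega, by simp [iterLab, h]⟩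
  by_cases h : i = b
  · exact ⟨1, by omega, by simp [iterLab, h]⟩
  by_cases h : i = c
  · exact ⟨2, by omega, by simp [iterLab, h]⟩
  by_cases h : i ≤ 4
  · exact ⟨3, by omega, by simp only [iterLab]; norm_num; omega⟩
  · exact ⟨i - 1, by omega, by simp only [iterLab]; split_ifs <;> omega⟩

/-- An iterated sequence for `Gr(3,6)` comes from a frame. -/
theorem IsIter.exists_frame {S : List (ℕ × ℕ)} (hS : IsIter 6 S) :
    ∃ (lab : ℕ → ℕ) (T : ℕ × ℕ × ℕ) (v₀ : ℕ) (L : List (ℕ × ℕ)),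
      S = Frame.seq lab T L ∧ Frame (fun x => seqCol S (lab x)) lab T v₀ L ∧
      (∀ i, 1 ≤ i → i ≤ 6 → ∃ x ≤ 5, lab x = i) ∧ ∀ x ≤ 5, 1 ≤ lab x ∧ lab x ≤ 6 := by
  rcases hS with - | ⟨r, S₅, i₁, i₂, i₃, -, h₅, hi₁, hi₁', hi₂, hi₂', hi₃, hi₃', h₁₂, h₁₃, h₂₃⟩
  rcases h₅ with - | ⟨r, L, a, b, c, -, h₄, ha, ha', hb, hb', hc, hc', hab, hac, hbc⟩
  rcases h₄ with ⟨L, hL⟩ | ⟨_, _, _, _, _, h, -⟩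
  swap
  · omega
  have hex := fun {i n} => exists_iterLab_eq (i := i) (n := n)
    ⟨ha, ha'⟩ ⟨hb, hb'⟩ ⟨hc, hc'⟩ hab hac hbc
  obtain ⟨p, hp, rfl⟩ := hex hi₁ hi₁' (by norm_num)
  obtain ⟨q, hq, rfl⟩ := hex hi₂ hi₂' (by norm_num)
  obtain ⟨s, hs, rfl⟩ := hex hi₃ hi₃' (by norm_num)
  obtain ⟨v₀, hv₀, hv⟩ := hex (i := 4) (n := 3) (by norm_num) le_rfl le_rfl
  refine ⟨iterLab a b c, (p, q, s), v₀, L, rfl, frame_seqCol hL ⟨ha, ha'⟩ ⟨hb, hb'⟩ ⟨hc, hc'⟩ hab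
    hac hbc hp hq hs (ne_of_apply_ne _ h₁₂) (ne_of_apply_ne _ h₁₃) (ne_of_apply_ne _ h₂₃) hv₀ hv,
    fun i h h' => hex h h' (by norm_num), fun x hx => ?_⟩
  simp only [iterLab]
  split_ifs <;> omega

end Construction

section Plucker

/-- The lead exponents of the generators of a frame are valuations of Plücker coordinates. -/
theorem Frame.exists_valS_eq {S : List (ℕ × ℕ)} {lab : ℕ → ℕ} {T : ℕ × ℕ × ℕ} {v₀ : ℕ}
    {L : List (ℕ × ℕ)} (hS : S = Frame.seq lab T L)
    (F : Frame (fun x => seqCol S (lab x)) lab T v₀ L)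
    (hlab : ∀ x ≤ 5, 1 ≤ lab x ∧ lab x ≤ 6) (g : Gen T) :
    ∃ K : MI 6, valS 6 S K.val = genExp lab v₀ g := by
  obtain ⟨h₁, h₂, h₃⟩ := lt_of_mem_incTriples
    (cols_mem_incTriples T F.mem_triples g.1 (mem_genList.mpr g.2))
  have hinj : ∀ {x y}, x < y → y ≤ 5 → lab x ≠ lab y := by
    intro x y hxy hy h
    obtain hy | rfl := Nat.le_succ_iff.mp hy
    · exact hxy.ne (F.lab_injective x (by omega) y hy h)
    · obtain hx | rfl := Nat.le_succ_iff.mp (Nat.le_of_lt_succ hxy)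
      · have := F.lab_le x hx
        rw [h] at this
        exact absurd (F.lab_five.ge.trans this) (by norm_num)
      · exact absurd (F.lab_four.symm.trans (h.trans F.lab_five)) (by norm_num)
  obtain ⟨x, y, z, hxy, hyz, hP, hm⟩ := exists_minor_sorted (seqCol S)
    (hinj h₁ (h₂.le.trans h₃)) (hinj (h₁.trans h₂) h₃) (hinj h₂ h₃)
  have hK := hP (fun l => 1 ≤ l ∧ l ≤ 6) (hlab _ (by omega)) (hlab _ (by omega)) (hlab _ h₃)
  refine ⟨⟨![x, y, z], ?_, ?_⟩, ?_⟩
  · intro i j hij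
    fin_cases i <;> fin_cases j <;> simp_all [hxy.trans hyz]
  · intro i
    fin_cases i
    exacts [hK.1, hK.2.1, hK.2.2]
  · have hlead := F.isLead g
    rw [genMinor, minor_comp, ← hS] at hlead
    refine IsLead.minSupp_eq ?_
    rw [phiStar_eq_minor]
    change IsLead _ (minor (seqCol S) x y z) _
    rcases hm with hm | hm
    · rwa [hm] at hlead
    · rw [hm] at hlead
      exact hlead.of_neg

/-- The Plücker coordinates are, up to sign, minors on increasing labels. -/
theorem exists_phiStar_eq {S : List (ℕ × ℕ)} {lab : ℕ → ℕ}
    (hex : ∀ i, 1 ≤ i → i ≤ 6 → ∃ x ≤ 5, lab x = i) (K : MI 6) : ∃ A ∈ incTriples,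
      phiStar 6 S K.val = minor (fun x => seqCol S (lab x)) A.1 A.2.1 A.2.2 ∨
        phiStar 6 S K.val = -minor (fun x => seqCol S (lab x)) A.1 A.2.1 A.2.2 := by
  obtain ⟨K, hK, hK'⟩ := K
  choose t ht hlt using fun i => hex (K i) (hK' i).1 (hK' i).2
  have hne : ∀ {i j}, i ≠ j → t i ≠ t j := fun {i j} hij h =>
    hij (hK.injective ((hlt i).symm.trans ((congrArg lab h).trans (hlt j))))
  obtain ⟨x, y, z, hxy, hyz, hP, hm⟩ := exists_minor_sorted (fun x => seqCol S (lab x))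
    (hne (by decide : (0 : Fin 3) ≠ 1)) (hne (by decide : (0 : Fin 3) ≠ 2))
    (hne (by decide : (1 : Fin 3) ≠ 2))
  refine ⟨(x, y, z), mem_incTriples hxy hyz (hP (· ≤ 5) (ht 0) (ht 1) (ht 2)).2.2, ?_⟩
  change phiStar 6 S K = _ ∨ phiStar 6 S K = _
  rwa [phiStar_eq_minor, ← hlt 0, ← hlt 1, ← hlt 2, ← minor_comp (seqCol S) lab]

theorem ASmat_of_snd_ne {n : ℕ} {S : List (ℕ × ℕ)} {j : ℕ} (hj : 1 ≤ j ∧ j ≤ n)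
    (hS : ∀ β ∈ S, j ≠ β.2 ∧ 1 ≤ β.1 ∧ β.1 ≤ n) (i : ℕ) : ASmat n S i j = idN i j := by
  induction S with
  | nil => rfl
  | cons β S ih =>
    obtain ⟨h, hβ⟩ := hS β (by simp)
    rw [ASmat_cons_of_ne S i hj hβ h, ih fun β hβ => hS β (List.mem_cons_of_mem _ hβ)]

theorem IsIter.bounds {n : ℕ} {S : List (ℕ × ℕ)} (hS : IsIter n S) :
    ∀ β ∈ S, 4 ≤ β.2 ∧ 1 ≤ β.1 ∧ β.1 ≤ n := by
  induction hS with
  | base L hL =>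
    intro β hβ
    have := hL.mem_iff.mp hβ
    simp only [List.mem_cons, List.not_mem_nil, or_false] at this
    rcases this with rfl | rfl | rfl <;> decide
  | step r L a b c hr _ ha ha' hb hb' hc hc' _ _ _ ih =>
    intro β hβ
    simp only [List.mem_cons] at hβ
    rcases hβ with rfl | rfl | rfl | hβ
    · exact ⟨by omega, ha, by omega⟩
    · exact ⟨by omega, hb, by omega⟩
    · exact ⟨by omega, hc, by omega⟩
    · have := ih β hβ
      omega

theorem IsIter.phiStar_eq_one {S : List (ℕ × ℕ)} (hS : IsIter 6 S) :
    phiStar 6 S ![1, 2, 3] = 1 := by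
  have h : ∀ j : ℕ, 1 ≤ j ∧ j ≤ 3 → ∀ r : Fin 3, seqCol S j r = idN ((r : ℕ) + 1) j := by
    intro j hj r
    refine ASmat_of_snd_ne (by omega) (fun β hβ => ?_) _
    have := hS.bounds β hβ
    omega
  rw [phiStar_eq_minor]
  change minor _ 1 2 3 = 1
  rw [minor_eq]
  simp [h, idN]

theorem minSupp_zero (S : List (ℕ × ℕ)) : minSupp S 0 = 0 := by
  rw [minSupp, dif_neg]
  simp

end Plucker

end

/-- The Plücker coordinates form a Khovanskii basis of `(A_{3,6}, v_S)`: for every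
`f ∉ 𝓘_{3,6}`, the valuation of `f̄` (the `⪯_{Ψ_S}`-minimum of the support of the image
of `f` under `p_K ↦ φ_S^*(p̄_K)`) lies in the additive submonoid generated by the
valuations `v_S(p̄_K)` of the Plücker coordinates. -/
theorem khovanskii_basis (S : List (ℕ × ℕ)) (hS : IsIter 6 S)
    (f : PRing 6) (hf : f ∉ PluckerIdeal 6) :
    minSupp S (MvPolynomial.aeval (fun K : MI 6 => phiStar 6 S K.val) f) ∈
      AddSubmonoid.closure (Set.range fun K : MI 6 => valS 6 S K.val) := by
  by_cases h0 : aeval (fun K : MI 6 => phiStar 6 S K.val) f = 0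
  · rw [h0, minSupp_zero]
    exact zero_mem _
  obtain ⟨lab, T, v₀, L, hseq, F, hex, hlab⟩ := hS.exists_frame
  have hP := exists_phiStar_eq (S := S) hex
  obtain ⟨A, hA, hone⟩ : ∃ A ∈ incTriples, ∃ c₀ : ℂ,
      c₀ • minor (fun x => seqCol S (lab x)) A.1 A.2.1 A.2.2 = 1 := by
    obtain ⟨A, hA, h | h⟩ := hP ⟨![1, 2, 3], by decide, by decide⟩ <;>
      rw [hS.phiStar_eq_one] at h
    · exact ⟨A, hA, 1, by rw [← h, one_smul]⟩
    · exact ⟨A, hA, -1, by rw [neg_smul, one_smul, ← h]⟩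
  obtain ⟨c₀, hone⟩ := hone
  obtain ⟨m, hm⟩ := F.exists_isLead (fun K : MI 6 => phiStar 6 S K.val) hP hA hone f h0
  rw [← hseq] at hm
  rw [hm.minSupp_eq]
  refine AddSubmonoid.multiset_sum_mem _ _ fun e he => ?_
  obtain ⟨g, -, rfl⟩ := Multiset.mem_map.mp he
  obtain ⟨K, hK⟩ := F.exists_valS_eq hseq hlab g
  exact AddSubmonoid.subset_closure ⟨K, hK⟩
end

section
/- Let S' be an iterated sequence for Gr(3,n−1) and S = ((l_1,n),(l_2,n),(l_3,n), S') the iterated sequence for Gr(3,n) obtained by iterating with pairwise distinct indices l_1,l_2,l_3 ∈ [n−1]. Identify the variables of S' with the corresponding variables of S. Then: (a) if n ∉ I, φ_S^*(p̄_I) = φ_{S'}^*(p̄_I); and (b) if n ∈ I, the support of φ_S^*(p̄_I) equals { x_{(l,n)}·x^b : l ∈ {l_1,l_2,l_3}, l ∉ I∖n, and x^b is in the support of φ_{S'}^*(p̄_{(I∖n)∪l}) }. -/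
/-!
Common framework: iterated sequences for Gr(3,n), the matrix `A_S`, pullbacks of
Plücker coordinates, the weighted reverse lexicographic order, lowest-term
valuations, Plücker relations, weighting matrices and initial ideals.
-/

open MvPolynomial

theorem matMul_factor (n : ℕ) (A : NMat) (β : ℕ × ℕ) (hβ : 1 ≤ β.1 ∧ β.1 ≤ n) (i j : ℕ)
    (hj : 1 ≤ j ∧ j ≤ n) :
    matMul n A (factor β) i j = A i j + if j = β.2 then A i β.1 * X β else 0 := by
  unfold matMul factor
  simp only [mul_add, Finset.sum_add_distrib]
  congr 1
  · rw [Finset.sum_eq_single j]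
    · simp
    · intro k _ hk
      simp [hk]
    · intro h
      exact absurd (Finset.mem_Icc.2 hj) h
  · rw [Finset.sum_eq_single β.1]
    · by_cases h : j = β.2 <;> simp [h]
    · intro k _ hk
      simp [hk]
    · intro h
      exact absurd (Finset.mem_Icc.2 hβ) h

theorem IsIter.index_bounds {m : ℕ} {S : List (ℕ × ℕ)} (h : IsIter m S) :
    ∀ β ∈ S, (1 ≤ β.1 ∧ β.1 ≤ m) ∧ β.2 ≤ m := by
  induction h with
  | base L hL =>
    intro β hβ
    have := hL.mem_iff.1 hβ
    simp only [List.mem_cons, List.not_mem_nil, or_false] at this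
    rcases this with rfl | rfl | rfl <;> simp
  | step r L i₁ i₂ i₃ hr _ a₁ b₁ a₂ b₂ a₃ b₃ _ _ _ ih =>
    intro β hβ
    simp only [List.mem_cons] at hβ
    rcases hβ with rfl | rfl | rfl | hβ
    · exact ⟨⟨a₁, by simp; omega⟩, le_rfl⟩
    · exact ⟨⟨a₂, by simp; omega⟩, le_rfl⟩
    · exact ⟨⟨a₃, by simp; omega⟩, le_rfl⟩
    · have := ih β hβ
      omega

theorem ASmat_succ_of_le (m : ℕ) (S : List (ℕ × ℕ))
    (hS : ∀ β ∈ S, (1 ≤ β.1 ∧ β.1 ≤ m) ∧ β.2 ≤ m) (i j : ℕ) (hj : 1 ≤ j ∧ j ≤ m) :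
    ASmat (m + 1) S i j = ASmat m S i j := by
  induction S generalizing j with
  | nil => rfl
  | cons β L ih =>
    have hβ := (hS β (by simp)).1
    have ih' := ih fun γ hγ => hS γ (by simp [hγ])
    simp only [ASmat]
    rw [matMul_factor _ _ _ (by omega) _ _ (by omega), matMul_factor _ _ _ hβ _ _ hj,
      ih' j hj, ih' _ hβ]

theorem ASmat_succ_last (m : ℕ) (S : List (ℕ × ℕ))
    (hS : ∀ β ∈ S, (1 ≤ β.1 ∧ β.1 ≤ m) ∧ β.2 ≤ m) (i : ℕ) (hi : i ≤ m) :
    ASmat (m + 1) S i (m + 1) = 0 := by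
  induction S with
  | nil =>
    have : i ≠ m + 1 := by omega
    simp [ASmat, idN, this]
  | cons β L ih =>
    have hβ := hS β (by simp)
    have hne : m + 1 ≠ β.2 := by omega
    simp only [ASmat]
    rw [matMul_factor _ _ _ (by omega) _ _ (by omega), if_neg hne,
      ih fun γ hγ => hS γ (by simp [hγ]), add_zero]

theorem ASmat_mem_supported (m : ℕ) (S : List (ℕ × ℕ)) (hS : ∀ β ∈ S, β.2 ≤ m) (i j : ℕ) :
    ASmat m S i j ∈ supported ℂ {β : ℕ × ℕ | β.2 ≤ m} := by
  induction S generalizing j with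
  | nil =>
    simp only [ASmat, idN]
    split_ifs
    · exact one_mem _
    · exact zero_mem _
  | cons β L ih =>
    simp only [ASmat, matMul, factor]
    refine sum_mem fun k _ => mul_mem (ih (fun γ hγ => hS γ (by simp [hγ])) k) (add_mem ?_ ?_)
    · split_ifs
      · exact one_mem _
      · exact zero_mem _
    · split_ifs
      · exact X_mem_supported.2 (hS β (by simp))
      · exact zero_mem _

/-- The minor of `A_S` on rows `(1,2,3)` and three not necessarily sorted columns. -/
theorem phiStar_eq (m : ℕ) (S : List (ℕ × ℕ)) (c : Fin 3 → ℕ) :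
    phiStar m S c =
      ASmat m S 1 (c 0) * ASmat m S 2 (c 1) * ASmat m S 3 (c 2)
      - ASmat m S 1 (c 0) * ASmat m S 2 (c 2) * ASmat m S 3 (c 1)
      - ASmat m S 1 (c 1) * ASmat m S 2 (c 0) * ASmat m S 3 (c 2)
      + ASmat m S 1 (c 1) * ASmat m S 2 (c 2) * ASmat m S 3 (c 0)
      + ASmat m S 1 (c 2) * ASmat m S 2 (c 0) * ASmat m S 3 (c 1)
      - ASmat m S 1 (c 2) * ASmat m S 2 (c 1) * ASmat m S 3 (c 0) := by
  simp [phiStar, Matrix.det_fin_three]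

theorem phiStar_mem_supported (m : ℕ) (S : List (ℕ × ℕ)) (hS : ∀ β ∈ S, β.2 ≤ m)
    (c : Fin 3 → ℕ) : phiStar m S c ∈ supported ℂ {β : ℕ × ℕ | β.2 ≤ m} := by
  have h := ASmat_mem_supported m S hS
  rw [phiStar_eq]
  refine sub_mem (add_mem (add_mem (sub_mem (sub_mem ?_ ?_) ?_) ?_) ?_) ?_ <;>
    exact mul_mem (mul_mem (h _ _) (h _ _)) (h _ _)

theorem phiStar_eq_zero (m : ℕ) (S : List (ℕ × ℕ)) (c : Fin 3 → ℕ) {a b : Fin 3} (hab : a ≠ b)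
    (hc : c a = c b) : phiStar m S c = 0 :=
  Matrix.det_zero_of_column_eq hab fun i => by simp [hc]

theorem support_phiStar_insert3 (m : ℕ) (S : List (ℕ × ℕ)) (J : Fin 2 → ℕ) (hJ : J 0 < J 1)
    (l : ℕ) :
    (phiStar m S (insert3 J l)).support = (phiStar m S ![J 0, J 1, l]).support := by
  rcases le_or_gt (J 1) l with h | h
  · have : insert3 J l = ![J 0, J 1, l] := by
      ext a
      fin_cases a <;> simp [insert3, List.insertionSort, h, hJ.le]
    rw [this]
  · rcases le_or_gt (J 0) l with h' | h'
    · have : insert3 J l = ![J 0, l, J 1] := by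
        ext a
        fin_cases a <;>
          simp [insert3, List.insertionSort, List.orderedInsert, h', not_le.2 h]
      rw [this, ← support_neg]
      refine congrArg support ?_
      simp only [phiStar_eq, Matrix.cons_val]
      ring
    · have : insert3 J l = ![l, J 0, J 1] := by
        ext a
        fin_cases a <;>
          simp [insert3, List.insertionSort, List.orderedInsert, hJ.le, not_le.2 h, not_le.2 h']
      rw [this]
      refine congrArg support ?_
      simp only [phiStar_eq, Matrix.cons_val]
      ring

theorem ASmat_triple (m : ℕ) (S : List (ℕ × ℕ))
    (hS : ∀ β ∈ S, (1 ≤ β.1 ∧ β.1 ≤ m) ∧ β.2 ≤ m) (l₁ l₂ l₃ : ℕ)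
    (h₁ : 1 ≤ l₁ ∧ l₁ ≤ m) (h₂ : 1 ≤ l₂ ∧ l₂ ≤ m) (h₃ : 1 ≤ l₃ ∧ l₃ ≤ m) (i j : ℕ)
    (hi : i ≤ m) (hj : 1 ≤ j ∧ j ≤ m + 1) :
    ASmat (m + 1) ((l₁, m + 1) :: (l₂, m + 1) :: (l₃, m + 1) :: S) i j =
      if j = m + 1 then ASmat m S i l₁ * X (l₁, m + 1) + ASmat m S i l₂ * X (l₂, m + 1) +
        ASmat m S i l₃ * X (l₃, m + 1)
      else ASmat m S i j := by
  have e (A : NMat) (l : ℕ) (hl : 1 ≤ l ∧ l ≤ m) (j : ℕ) (hj : 1 ≤ j ∧ j ≤ m + 1) :=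
    matMul_factor (m + 1) A (l, m + 1) (by simp; omega) i j hj
  have n₁ : l₁ ≠ m + 1 := by omega
  have n₂ : l₂ ≠ m + 1 := by omega
  simp only [ASmat]
  rw [e _ _ h₁ _ hj, e _ _ h₂ _ hj, e _ _ h₃ _ hj]
  split_ifs with h
  · subst h
    rw [ASmat_succ_last m S hS i hi]
    simp only
    rw [e _ _ h₂ _ (by omega), e _ _ h₃ _ (by omega), e _ _ h₃ _ (by omega)]
    simp only [n₁, n₂, if_false, add_zero]
    rw [ASmat_succ_of_le m S hS i _ h₁, ASmat_succ_of_le m S hS i _ h₂,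
      ASmat_succ_of_le m S hS i _ h₃]
    ring
  · rw [ASmat_succ_of_le m S hS i j (by omega)]
    simp

theorem mem_support_sum_X_mul {σ R : Type*} [CommSemiring R] {s : Set σ}
    (T : Finset σ) (hT : ∀ v ∈ T, v ∉ s) (p : σ → MvPolynomial σ R)
    (hp : ∀ v, p v ∈ supported R s) (d : σ →₀ ℕ) :
    d ∈ (∑ v ∈ T, X v * p v).support ↔
      ∃ v ∈ T, ∃ b ∈ (p v).support, d = Finsupp.single v 1 + b := by
  classical
  constructor
  · intro hd
    obtain ⟨v, hv, hd⟩ := Finset.mem_biUnion.1 (support_sum hd)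
    rw [support_X_mul] at hd
    obtain ⟨b, hb, rfl⟩ := Finset.mem_map.1 hd
    exact ⟨v, hv, b, hb, rfl⟩
  · have hzero (v w : σ) (hw : w ∈ T) (b : σ →₀ ℕ) (hb : b ∈ (p v).support) : b w = 0 := by
      by_contra h
      exact hT w hw (mem_supported.1 (hp v)
        ((mem_vars_iff_mem_support w).2 ⟨b, hb, Finsupp.mem_support_iff.2 h⟩))
    rintro ⟨v, hv, b, hb, rfl⟩
    rw [mem_support_iff, coeff_sum, Finset.sum_eq_single v, coeff_X_mul]
    · exact mem_support_iff.1 hb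
    · intro w hw hwv
      by_contra h
      have hmem := mem_support_iff.2 h
      rw [support_X_mul] at hmem
      obtain ⟨b', hb', e⟩ := Finset.mem_map.1 hmem
      have := DFunLike.congr_fun e w
      simp [hzero v w hw b hb, hwv.symm] at this
    · exact fun h => absurd hv h

/-- Behaviour of the pullbacks of Plücker coordinates under one iteration step
(`n = m + 1`): (a) if `n ∉ I` then `φ_S^*(p̄_I) = φ_{S'}^*(p̄_I)`; (b) if `n ∈ I` then the
support of `φ_S^*(p̄_I)` consists of the monomials `x_{(l,n)} · x^b` with
`l ∈ {l₁,l₂,l₃}`, `l ∉ I ∖ n` and `x^b` in the support of `φ_{S'}^*(p̄_{(I∖n)∪l})`. -/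
theorem pullback_iteration (m : ℕ) (hm : 4 ≤ m) (S' : List (ℕ × ℕ)) (hS' : IsIter m S')
    (l₁ l₂ l₃ : ℕ)
    (h₁ : 1 ≤ l₁ ∧ l₁ ≤ m) (h₂ : 1 ≤ l₂ ∧ l₂ ≤ m) (h₃ : 1 ≤ l₃ ∧ l₃ ≤ m)
    (hd₁ : l₁ ≠ l₂) (hd₂ : l₁ ≠ l₃) (hd₃ : l₂ ≠ l₃)
    (I : Fin 3 → ℕ) (hI : Sorted 3 (m+1) I) :
    ((∀ a, I a ≠ m + 1) →
      phiStar (m+1) ((l₁, m+1) :: (l₂, m+1) :: (l₃, m+1) :: S') I = phiStar m S' I) ∧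
    ((∃ a, I a = m + 1) →
      (↑(phiStar (m+1) ((l₁, m+1) :: (l₂, m+1) :: (l₃, m+1) :: S') I).support
          : Set ((ℕ × ℕ) →₀ ℕ)) =
        {d | ∃ l, (l = l₁ ∨ l = l₂ ∨ l = l₃) ∧ l ≠ I 0 ∧ l ≠ I 1 ∧
          ∃ b ∈ (phiStar m S' (insert3 (fun t : Fin 2 => I t.castSucc) l)).support,
            d = Finsupp.single (l, m+1) 1 + b}) := by
  have hS := hS'.index_bounds
  have hA := ASmat_triple m S' hS l₁ l₂ l₃ h₁ h₂ h₃
  obtain ⟨hmono, hb⟩ := hI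
  have h01 : I 0 < I 1 := hmono (by decide)
  have h12 : I 1 < I 2 := hmono (by decide)
  constructor
  · intro hne
    simp only [phiStar]
    congr 1
    ext1 a b
    simp only [Matrix.of_apply]
    rw [hA _ _ (by omega) (hb b), if_neg (hne b)]
  · rintro ⟨a, ha⟩
    have hI2 : I 2 = m + 1 := by
      have := hmono.monotone (Fin.le_last a)
      have := (hb 2).2
      change I a ≤ I 2 at *
      omega
    have n0 : I 0 ≠ m + 1 := by omega
    have n1 : I 1 ≠ m + 1 := by omega
    let p : ℕ × ℕ → MvPolynomial (ℕ × ℕ) ℂ := fun v => phiStar m S' ![I 0, I 1, v.1]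
    let T : Finset (ℕ × ℕ) := {(l₁, m + 1), (l₂, m + 1), (l₃, m + 1)}
    have hsum : phiStar (m + 1) ((l₁, m + 1) :: (l₂, m + 1) :: (l₃, m + 1) :: S') I =
        ∑ v ∈ T, X v * p v := by
      rw [Finset.sum_insert (by simp [hd₁, hd₂]), Finset.sum_insert (by simp [hd₃]),
        Finset.sum_singleton, phiStar_eq]
      have hL (i : ℕ) (hi : i ≤ m) := (hA i (m + 1) hi (by omega)).trans (if_pos rfl)
      have hR (i : ℕ) (hi : i ≤ m) := (hA i (I 0) hi (hb 0)).trans (if_neg n0)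
      have hR' (i : ℕ) (hi : i ≤ m) := (hA i (I 1) hi (hb 1)).trans (if_neg n1)
      rw [hI2, hL 1 (by omega), hL 2 (by omega), hL 3 (by omega), hR 1 (by omega),
        hR 2 (by omega), hR 3 (by omega), hR' 1 (by omega), hR' 2 (by omega), hR' 3 (by omega)]
      simp only [p, phiStar_eq, Matrix.cons_val]
      ring
    have hins (l : ℕ) : (phiStar m S' (insert3 (fun t : Fin 2 => I t.castSucc) l)).support =
        (p (l, m + 1)).support := support_phiStar_insert3 m S' _ h01 l
    ext d
    rw [hsum, Finset.mem_coe, mem_support_sum_X_mul (s := {β : ℕ × ℕ | β.2 ≤ m}) T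
      (by simp [T]) p (fun v => phiStar_mem_supported m S' (fun β hβ => (hS β hβ).2) _)]
    simp only [Set.mem_ofPred_eq, hins]
    constructor
    · rintro ⟨v, hv, b, hbv, rfl⟩
      obtain ⟨l, hl, rfl⟩ : ∃ l, (l = l₁ ∨ l = l₂ ∨ l = l₃) ∧ v = (l, m + 1) := by
        simp only [T, Finset.mem_insert, Finset.mem_singleton] at hv
        rcases hv with rfl | rfl | rfl <;> simp
      refine ⟨l, hl, ?_, ?_, b, hbv, rfl⟩
      · rintro rfl
        exact mem_support_iff.1 hbv (by
          rw [show p (I 0, m + 1) = 0 from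
            phiStar_eq_zero m S' _ (a := 0) (b := 2) (by decide) rfl, coeff_zero])
      · rintro rfl
        exact mem_support_iff.1 hbv (by
          rw [show p (I 1, m + 1) = 0 from
            phiStar_eq_zero m S' _ (a := 1) (b := 2) (by decide) rfl, coeff_zero])
    · rintro ⟨l, hl, -, -, b, hbl, rfl⟩
      refine ⟨(l, m + 1), ?_, b, hbl, rfl⟩
      rcases hl with rfl | rfl | rfl <;> simp [T]
end
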